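/- Let p ≥ 11 be prime and let G ≤ GL_{p+1}(ℚ) be an s.i.m.f. subgroup whose order is divisible by p. Then p ≡ 3 (mod 4) and G is isomorphic as an abstract group to SL(2, p). -/

import Mathlib

open Matrix
open scoped MatrixGroups

/-- `G ≤ GL_m(ℚ)` is symplectic if it fixes some invertible skew-symmetric form. -/
def IsSymplecticGroup {m : ℕ} (G : Subgroup (GL (Fin m) ℚ)) : Prop :=
  ∃ A : Matrix (Fin m) (Fin m) ℚ, Aᵀ = -A ∧ IsUnit A ∧
    ∀ g ∈ G, (g : Matrix (Fin m) (Fin m) ℚ) * A * (g : Matrix (Fin m) (Fin m) ℚ)ᵀ = A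

/-- A `ℚ`-subspace of the natural (right) module `ℚ^{1×m}` invariant under `G`. -/
def IsInvariantSubspace {m : ℕ} (G : Subgroup (GL (Fin m) ℚ))
    (W : Submodule ℚ (Fin m → ℚ)) : Prop :=
  ∀ g ∈ G, ∀ v ∈ W, v ᵥ* (g : Matrix (Fin m) (Fin m) ℚ) ∈ W

/-- `G ≤ GL_m(ℚ)` is rationally irreducible. -/
def IsRatIrreducible {m : ℕ} (G : Subgroup (GL (Fin m) ℚ)) : Prop :=
  ∀ W : Submodule ℚ (Fin m → ℚ), IsInvariantSubspace G W → W = ⊥ ∨ W = ⊤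

/-- `G ≤ GL_m(ℚ)` is s.i.m.f.: finite, symplectic, rationally irreducible, and maximal
among finite symplectic subgroups of `GL_m(ℚ)`. -/
def IsSIMF {m : ℕ} (G : Subgroup (GL (Fin m) ℚ)) : Prop :=
  (G : Set (GL (Fin m) ℚ)).Finite ∧ IsSymplecticGroup G ∧ IsRatIrreducible G ∧
    ∀ H : Subgroup (GL (Fin m) ℚ), (H : Set (GL (Fin m) ℚ)).Finite →
      IsSymplecticGroup H → G ≤ H → H = G

open Finset in
/-- The exponential series truncated below degree `p`. -/
def texp {p : ℕ} {E : Type*} [Ring E] [Algebra (ZMod p) E] (a : E) : E :=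
  ∑ i ∈ range p, ((i.factorial : ZMod p)⁻¹) • a ^ i

section TruncatedExp

open Finset

variable {p : ℕ} [hp : Fact p.Prime] {E E' : Type*} [Ring E] [Algebra (ZMod p) E]
  [Ring E'] [Algebra (ZMod p) E']

theorem factorial_cast_ne_zero {i : ℕ} (hi : i < p) : (i.factorial : ZMod p) ≠ 0 := by
  rw [Ne, ZMod.natCast_eq_zero_iff, hp.out.dvd_factorial]
  omega

theorem texp_map (φ : E →ₐ[ZMod p] E') (a : E) : φ (texp (p := p) a) = texp (p := p) (φ a) := by
  simp [texp]

theorem texp_zero : texp (p := p) (0 : E) = 1 := by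
  obtain ⟨m, hm⟩ : ∃ m, p = m + 1 := ⟨p - 1, by have := hp.out.pos; omega⟩
  rw [texp]
  rw [Finset.sum_eq_single 0]
  · simp
  · intro i _ hi
    simp [hi]
  · intro h
    exact absurd (Finset.mem_range.2 hp.out.pos) h

theorem texp_add {a b : E} (hab : Commute a b) (h : ∀ i j, p ≤ i + j → a ^ i * b ^ j = 0) :
    texp (p := p) (a + b) = texp (p := p) a * texp (p := p) b := by
  have h1 : texp (p := p) (a + b) = ∑ m ∈ range p, ∑ i ∈ range (m + 1),
      ((i.factorial : ZMod p)⁻¹ * ((m - i).factorial : ZMod p)⁻¹) • (a ^ i * b ^ (m - i)) := by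
    refine Finset.sum_congr rfl fun m hm => ?_
    rw [hab.add_pow, Finset.smul_sum]
    refine Finset.sum_congr rfl fun i hi => ?_
    have hmp := Finset.mem_range.1 hm
    have him : i ≤ m := by have := Finset.mem_range.1 hi; omega
    have e1 := factorial_cast_ne_zero (p := p) hmp
    have e2 := factorial_cast_ne_zero (p := p) (i := i) (by omega)
    have e3 := factorial_cast_ne_zero (p := p) (i := m - i) (by omega)
    have e4 : ((m.choose i : ℕ) : ZMod p) * i.factorial * (m - i).factorial = m.factorial := by
      exact_mod_cast congrArg (Nat.cast (R := ZMod p)) (Nat.choose_mul_factorial_mul_factorial him)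
    have e5 : (m.factorial : ZMod p)⁻¹ * (m.choose i : ℕ) =
        (i.factorial : ZMod p)⁻¹ * ((m - i).factorial : ZMod p)⁻¹ := by
      field_simp
      rw [← e4]
    rw [← e5, mul_smul, ← Nat.cast_comm]
    congr 1
    rw [← nsmul_eq_mul, Nat.cast_smul_eq_nsmul]
  rw [h1, Finset.sum_range_diag_flip p
    (fun i j => ((i.factorial : ZMod p)⁻¹ * (j.factorial : ZMod p)⁻¹) • (a ^ i * b ^ j))]
  rw [texp, texp, Finset.sum_mul_sum]
  refine Finset.sum_congr rfl fun i hi => ?_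
  have hi' := Finset.mem_range.1 hi
  rw [← Finset.sum_subset (s₁ := range (p - i)) (s₂ := range p)]
  · refine Finset.sum_congr rfl fun j _ => ?_
    rw [smul_mul_smul_comm]
  · intro j hj
    rw [Finset.mem_range] at *
    omega
  · intro j hj hj'
    rw [Finset.mem_range] at *
    rw [smul_mul_smul_comm, h i j (by omega), smul_zero]

theorem texp_natCast_smul {a : E} (ha : a ^ p = 0) (m : ℕ) :
    texp (p := p) ((m : ZMod p) • a) = texp (p := p) a ^ m := by
  induction m with
  | zero => simp [texp_zero]
  | succ m ih =>
    rw [Nat.cast_succ, add_smul, one_smul, texp_add, ih, pow_succ]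
    · exact (Commute.refl a).smul_left _
    · intro i j hij
      rw [smul_pow, smul_mul_assoc, ← pow_add, pow_eq_zero_of_le hij ha, smul_zero]

theorem texp_smul {a : E} (ha : a ^ p = 0) (s : ZMod p) :
    texp (p := p) (s • a) = texp (p := p) a ^ s.val := by
  rw [← texp_natCast_smul ha, ZMod.natCast_zmod_val]

theorem texp_pow_prime {a : E} (ha : a ^ p = 0) : texp (p := p) a ^ p = 1 := by
  rw [← texp_natCast_smul ha]
  simp [texp_zero]

theorem sum_texp_smul (a : E) :
    ∑ s : ZMod p, texp (p := p) (s • a) = -(((p - 1).factorial : ZMod p)⁻¹ • a ^ (p - 1)) := by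
  have h2 := hp.out.two_le
  simp only [texp, smul_pow, smul_smul]
  rw [Finset.sum_comm]
  simp only [← Finset.sum_smul, ← Finset.mul_sum]
  rw [Finset.sum_eq_single (p - 1)]
  · have : ∑ s : ZMod p, s ^ (p - 1) = -1 := by
      have h0 := FiniteField.sum_pow_units (ZMod p) (p - 1)
      rw [ZMod.card] at h0
      simp only [dvd_refl, if_true] at h0
      rw [← h0, ← Finset.sum_subset (Finset.subset_univ ({0}ᶜ : Finset (ZMod p)))]
      · symm
        refine Finset.sum_bij (fun u _ => (u : ZMod p)) ?_ ?_ ?_ ?_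
        · intro u _; simp
        · intro u _ w _ h; exact Units.ext h
        · intro b hb
          exact ⟨Units.mk0 b (by simpa using hb), by simp, rfl⟩
        · intro u _; simp
      · intro s _ hs
        have : s = 0 := by simpa using hs
        rw [this, zero_pow (by omega)]
    rw [this]; simp
  · intro i hi hne
    have hi' := Finset.mem_range.1 hi
    rw [FiniteField.sum_pow_lt_card_sub_one (ZMod p) i (by rw [ZMod.card]; omega)]
    simp
  · intro h; exact absurd (Finset.mem_range.2 (by omega)) h

theorem sum_inv_smul_texp_smul (hp2 : 2 < p) (a : E) :
    ∑ s : ZMod p, s⁻¹ • texp (p := p) (s • a) = -a := by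
  simp only [texp, smul_pow, smul_smul, Finset.smul_sum]
  rw [Finset.sum_comm]
  simp only [← Finset.sum_smul]
  have key : ∀ i, ∑ s : ZMod p, s⁻¹ * ((i.factorial : ZMod p)⁻¹ * s ^ i) =
      (i.factorial : ZMod p)⁻¹ * ∑ s : ZMod p, s⁻¹ * s ^ i := by
    intro i
    rw [Finset.mul_sum]
    exact Finset.sum_congr rfl fun s _ => by ring
  simp only [key]
  have inv_eq : ∀ s : ZMod p, s⁻¹ = s ^ (p - 2) := by
    intro s
    by_cases hs : s = 0
    · rw [hs, _root_.inv_zero, zero_pow (by omega)]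
    · rw [inv_eq_iff_eq_inv, eq_comm, inv_eq_of_mul_eq_one_left]
      rw [← pow_succ', show p - 2 + 1 = p - 1 by omega, ZMod.pow_card_sub_one_eq_one hs]
  rw [Finset.sum_eq_single 1]
  · have : ∑ s : ZMod p, s⁻¹ * s ^ 1 = -1 := by
      have h1 : ∀ s : ZMod p, s⁻¹ * s ^ 1 = 1 - (if s = 0 then 1 else 0) := by
        intro s
        by_cases hs : s = 0
        · simp [hs]
        · simp [hs]
      simp only [h1, Finset.sum_sub_distrib]
      simp
    rw [this]; simp
  · intro i hi hne
    have hi' := Finset.mem_range.1 hi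
    rcases Nat.eq_zero_or_pos i with rfl | hpos
    · have : ∑ s : ZMod p, s⁻¹ * s ^ 0 = 0 := by
        simp only [inv_eq, pow_zero, mul_one]
        exact FiniteField.sum_pow_lt_card_sub_one (ZMod p) _ (by rw [ZMod.card]; omega)
      rw [this]; simp
    · have : ∑ s : ZMod p, s⁻¹ * s ^ i = 0 := by
        have : ∀ s : ZMod p, s⁻¹ * s ^ i = s ^ (i - 1) := by
          intro s
          by_cases hs : s = 0
          · rw [hs, _root_.inv_zero, zero_mul, zero_pow (by omega)]
          · obtain ⟨j, rfl⟩ : ∃ j, i = j + 1 := ⟨i - 1, by omega⟩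
            rw [pow_succ']
            simp [hs]
        simp only [this]
        exact FiniteField.sum_pow_lt_card_sub_one (ZMod p) _ (by rw [ZMod.card]; omega)
      rw [this]; simp
  · intro h; exact absurd (Finset.mem_range.2 (by omega)) h

end TruncatedExp

section JordanBlock

open Module

/-- `e` is nilpotent with a single Jordan block of size `n = dim M`. -/
structure IsJordanBlock {k M : Type*} [Field k] [AddCommGroup M] [Module k M]
    (n : ℕ) (e : End k M) : Prop where
  finrank_eq : finrank k M = n
  pow_eq_zero : e ^ n = 0
  pow_pred_ne_zero : e ^ (n - 1) ≠ 0

namespace IsJordanBlock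

variable {k M : Type*} [Field k] [AddCommGroup M] [Module k M] {n : ℕ} {e : End k M}

theorem pos (he : IsJordanBlock n e) : 0 < n := by
  rcases Nat.eq_zero_or_pos n with rfl | h
  · exact absurd he.pow_eq_zero (by simpa using he.pow_pred_ne_zero)
  · exact h

theorem finiteDimensional (he : IsJordanBlock n e) : FiniteDimensional k M :=
  FiniteDimensional.of_finrank_pos (by rw [he.finrank_eq]; exact he.pos)

theorem exists_cyclic (he : IsJordanBlock n e) : ∃ v, (e ^ (n - 1)) v ≠ 0 := by
  by_contra! h
  exact he.pow_pred_ne_zero (LinearMap.ext h)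

theorem pow_apply_eq_zero (he : IsJordanBlock n e) {i : ℕ} (hi : n ≤ i) (v : M) :
    (e ^ i) v = 0 := by
  rw [pow_eq_zero_of_le hi he.pow_eq_zero, LinearMap.zero_apply]

theorem linearIndependent (he : IsJordanBlock n e) {v : M} (hv : (e ^ (n - 1)) v ≠ 0) :
    LinearIndependent k (fun i : Fin n => (e ^ (i : ℕ)) v) := by
  classical
  rw [Fintype.linearIndependent_iff]
  intro c hc
  by_contra! hne
  obtain ⟨i, hi⟩ := hne
  let S := Finset.univ.filter fun i => c i ≠ 0
  have hS : S.Nonempty := ⟨i, by simp [S, hi]⟩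
  obtain ⟨i0, hi0, hmin⟩ := S.exists_min_image id hS
  have h1 := congrArg (e ^ (n - 1 - (i0 : ℕ))) hc
  rw [map_sum, map_zero, Finset.sum_eq_single i0] at h1
  · rw [map_smul, ← Module.End.mul_apply, ← pow_add,
      show n - 1 - (i0 : ℕ) + i0 = n - 1 by omega] at h1
    rcases smul_eq_zero.1 h1 with h | h
    · exact (Finset.mem_filter.1 hi0).2 h
    · exact hv h
  · intro j _ hj
    by_cases hcj : c j = 0
    · simp [hcj]
    · have : i0 ≤ j := hmin j (by simp [S, hcj])
      have h' : (i0 : ℕ) < j := lt_of_le_of_ne this (fun h => hj (Fin.ext h.symm))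
      rw [map_smul, ← Module.End.mul_apply, ← pow_add, he.pow_apply_eq_zero (by omega), smul_zero]
  · intro h; exact absurd (Finset.mem_univ _) h

/-- The basis `v, e v, e² v, …`. -/
noncomputable def basis (he : IsJordanBlock n e) {v : M} (hv : (e ^ (n - 1)) v ≠ 0) :
    Basis (Fin n) k M :=
  haveI : Nonempty (Fin n) := ⟨⟨0, he.pos⟩⟩
  basisOfLinearIndependentOfCardEqFinrank (he.linearIndependent hv) (by simp [he.finrank_eq])

@[simp] theorem basis_apply (he : IsJordanBlock n e) {v : M} (hv : (e ^ (n - 1)) v ≠ 0)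
    (i : Fin n) : he.basis hv i = (e ^ (i : ℕ)) v := by
  simp [basis]

theorem exists_sum_eq (he : IsJordanBlock n e) {v : M} (hv : (e ^ (n - 1)) v ≠ 0) (m : M) :
    ∃ c : ℕ → k, m = ∑ i ∈ Finset.range n, c i • (e ^ i) v := by
  refine ⟨fun i => if h : i < n then (he.basis hv).repr m ⟨i, h⟩ else 0, ?_⟩
  conv_lhs => rw [← (he.basis hv).sum_repr m]
  rw [← Fin.sum_univ_eq_sum_range
    (fun i => (if h : i < n then (he.basis hv).repr m ⟨i, h⟩ else 0) • (e ^ i) v)]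
  simp

theorem ext_cyclic (he : IsJordanBlock n e) {v : M} (hv : (e ^ (n - 1)) v ≠ 0)
    {N : Type*} [AddCommGroup N] [Module k N]
    {X Y : M →ₗ[k] N} (h : ∀ i, X ((e ^ i) v) = Y ((e ^ i) v)) : X = Y :=
  (he.basis hv).ext fun i => by rw [basis_apply]; exact h i

theorem exists_eq_of_commute (he : IsJordanBlock n e) {X : End k M} (hX : Commute X e) :
    ∃ c : ℕ → k, X = ∑ i ∈ Finset.range n, c i • e ^ i := by
  obtain ⟨v, hv⟩ := he.exists_cyclic
  obtain ⟨c, hc⟩ := he.exists_sum_eq hv (X v)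
  refine ⟨c, he.ext_cyclic hv fun i => ?_⟩
  rw [← Module.End.mul_apply, (hX.pow_right i).eq, Module.End.mul_apply, hc,
    ← Module.End.mul_apply]
  have : Commute (∑ i ∈ Finset.range n, c i • e ^ i) (e ^ i) :=
    Commute.sum_left _ _ _ fun j _ => ((Commute.refl e).pow_pow j i).smul_left _
  rw [this.eq]
  simp [LinearMap.sum_apply]

theorem sum_pow_eq_zero (he : IsJordanBlock n e) {c : ℕ → k}
    (h : ∑ i ∈ Finset.range n, c i • e ^ i = 0) {i : ℕ} (hi : i < n) : c i = 0 := by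
  obtain ⟨v, hv⟩ := he.exists_cyclic
  have := Fintype.linearIndependent_iff.1 (he.linearIndependent hv) (fun i => c i) (by
    have h2 := LinearMap.congr_fun h v
    rw [← Fin.sum_univ_eq_sum_range (fun i => c i • e ^ i)] at h2
    simpa [LinearMap.sum_apply] using h2) ⟨i, hi⟩
  exact this

theorem pow_ne_zero (he : IsJordanBlock n e) {i : ℕ} (hi : i < n) : e ^ i ≠ 0 := fun h =>
  he.pow_pred_ne_zero (pow_eq_zero_of_le (by omega) h)

/-- `ker e ^ d ⊆ range e ^ (n - d)` -/
theorem exists_of_pow_apply_eq_zero (he : IsJordanBlock n e) {d : ℕ} (hd : d ≤ n) {m : M}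
    (hm : (e ^ d) m = 0) : ∃ m', m = (e ^ (n - d)) m' := by
  obtain ⟨v, hv⟩ := he.exists_cyclic
  obtain ⟨c, rfl⟩ := he.exists_sum_eq hv m
  have key : ∀ i, i < n - d → c i = 0 := by
    intro i hi
    induction i using Nat.strong_induction_on with
    | _ i ih =>
      have h1 := congrArg (e ^ (n - 1 - d - i)) hm
      rw [← Module.End.mul_apply, ← pow_add, map_sum, map_zero, Finset.sum_eq_single i] at h1
      · rw [map_smul, ← Module.End.mul_apply, ← pow_add,
          show n - 1 - d - i + d + i = n - 1 by omega] at h1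
        exact (smul_eq_zero.1 h1).resolve_right hv
      · intro j _ hj
        rcases lt_or_gt_of_ne hj with h | h
        · rw [ih j h (by omega), zero_smul, map_zero]
        · rw [map_smul, ← Module.End.mul_apply, ← pow_add, he.pow_apply_eq_zero (by omega),
            smul_zero]
      · intro h; exact absurd (Finset.mem_range.2 (by omega)) h
  refine ⟨∑ i ∈ Finset.range d, c (n - d + i) • (e ^ i) v, ?_⟩
  conv_lhs => rw [show n = (n - d) + d by omega, Finset.sum_range_add]
  rw [Finset.sum_eq_zero, zero_add, map_sum]
  · refine Finset.sum_congr rfl fun i _ => ?_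
    rw [map_smul, ← Module.End.mul_apply, ← pow_add]
  · intro i hi
    rw [key i (Finset.mem_range.1 hi), zero_smul]

/-- A vector killed by `e` is a multiple of `e ^ (n - 1) v`. -/
theorem exists_smul_of_apply_eq_zero (he : IsJordanBlock n e) {v : M}
    (hv : (e ^ (n - 1)) v ≠ 0) {m : M} (hm : e m = 0) : ∃ c : k, m = c • (e ^ (n - 1)) v := by
  obtain ⟨m', rfl⟩ := he.exists_of_pow_apply_eq_zero (d := 1) he.pos (by simpa using hm)
  obtain ⟨c, rfl⟩ := he.exists_sum_eq hv m'
  refine ⟨c 0, ?_⟩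
  rw [map_sum, Finset.sum_eq_single 0]
  · simp
  · intro j _ hj
    rw [map_smul, ← Module.End.mul_apply, ← pow_add, he.pow_apply_eq_zero (by omega), smul_zero]
  · intro h; exact absurd (Finset.mem_range.2 he.pos) h

theorem pow_pred_mul_mul_pow_pred (he : IsJordanBlock n e) (X : End k M) :
    ∃ c : k, e ^ (n - 1) * X * e ^ (n - 1) = c • e ^ (n - 1) := by
  obtain ⟨v, hv⟩ := he.exists_cyclic
  have h1 : e * e ^ (n - 1) = 0 := by
    rw [← pow_succ', show n - 1 + 1 = n by have := he.pos; omega, he.pow_eq_zero]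
  have h2 : e ^ (n - 1) * e = 0 := by
    rw [← pow_succ, show n - 1 + 1 = n by have := he.pos; omega, he.pow_eq_zero]
  obtain ⟨c, hc⟩ := he.exists_smul_of_apply_eq_zero hv (m := (e ^ (n - 1) * X * e ^ (n - 1)) v) (by
    rw [← Module.End.mul_apply, ← mul_assoc, ← mul_assoc, h1, zero_mul, zero_mul,
      LinearMap.zero_apply])
  refine ⟨c, he.ext_cyclic hv fun i => ?_⟩
  rcases Nat.eq_zero_or_pos i with rfl | hi
  · simpa using hc
  · obtain ⟨j, rfl⟩ : ∃ j, i = j + 1 := ⟨i - 1, by omega⟩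
    rw [pow_succ', Module.End.mul_apply e, ← Module.End.mul_apply _ e, mul_assoc _ _ e, h2,
      LinearMap.smul_apply, ← Module.End.mul_apply (e ^ (n - 1)) e, h2]
    simp

end IsJordanBlock

end JordanBlock

section JordanLog

open Module

namespace IsJordanBlock

variable {k M : Type*} [Field k] [AddCommGroup M] [Module k M] {n : ℕ} {e e' : End k M}

theorem exists_conj (he : IsJordanBlock n e) (he' : IsJordanBlock n e') :
    ∃ Ψ : M ≃ₗ[k] M, ∀ m, Ψ (e m) = e' (Ψ m) := by
  obtain ⟨v, hv⟩ := he.exists_cyclic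
  obtain ⟨v', hv'⟩ := he'.exists_cyclic
  let Ψ : M ≃ₗ[k] M := (he.basis hv).equiv (he'.basis hv') (Equiv.refl _)
  have hΨ : ∀ i, Ψ ((e ^ i) v) = (e' ^ i) v' := by
    intro i
    rcases lt_or_ge i n with hi | hi
    · have := (he.basis hv).equiv_apply ⟨i, hi⟩ (he'.basis hv') (Equiv.refl _)
      simpa using this
    · rw [he.pow_apply_eq_zero hi, he'.pow_apply_eq_zero hi, map_zero]
  refine ⟨Ψ, fun m => ?_⟩
  have : (Ψ : M →ₗ[k] M) ∘ₗ e = e' ∘ₗ (Ψ : M →ₗ[k] M) := he.ext_cyclic hv fun i => by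
    change Ψ (e ((e ^ i) v)) = e' (Ψ ((e ^ i) v))
    rw [hΨ, ← Module.End.mul_apply, ← pow_succ', hΨ, ← Module.End.mul_apply, ← pow_succ']
  exact LinearMap.congr_fun this m

end IsJordanBlock

variable {p : ℕ} [hp : Fact p.Prime] {M : Type*} [AddCommGroup M] [Module (ZMod p) M] {n : ℕ}

theorem IsJordanBlock.texp_sub_one {u : End (ZMod p) M} (hu : IsJordanBlock n u) :
    IsJordanBlock n (texp (p := p) u - 1) := by
  have h2 := hp.out.two_le
  obtain ⟨w2, hw2⟩ : ∃ w2, texp (p := p) u - 1 = u * (1 + u * w2) ∧ Commute u w2 := by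
    refine ⟨∑ i ∈ Finset.range (p - 2), (((i + 2).factorial : ZMod p)⁻¹) • u ^ i, ?_, ?_⟩
    · have hr : Finset.range p = Finset.range (p - 2 + 1 + 1) := by congr 1; omega
      rw [texp, hr, Finset.sum_range_succ', Finset.sum_range_succ']
      simp only [Nat.factorial_zero, Nat.cast_one, inv_one, pow_zero, one_smul, zero_add,
        Nat.factorial_one, pow_one, add_sub_cancel_right]
      rw [mul_add, mul_one, Finset.mul_sum, Finset.mul_sum, add_comm]
      congr 1
      refine Finset.sum_congr rfl fun i _ => ?_
      rw [mul_smul_comm, mul_smul_comm, ← pow_succ', ← pow_succ']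
    · exact Commute.sum_right _ _ _ fun i _ => ((Commute.refl u).pow_right i).smul_right _
  obtain ⟨hw, hc⟩ := hw2
  have hc1 : Commute u (1 + u * w2) :=
    (Commute.one_right u).add_right ((Commute.refl u).mul_right hc)
  refine ⟨hu.finrank_eq, ?_, ?_⟩
  · rw [hw, hc1.mul_pow, hu.pow_eq_zero, zero_mul]
  · have h0 : u ^ (n - 1) * u = 0 := by
      rw [← pow_succ, show n - 1 + 1 = n by have := hu.pos; omega, hu.pow_eq_zero]
    have h1 : ∀ i, u ^ (n - 1) * (1 + u * w2) ^ i = u ^ (n - 1) := by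
      intro i
      induction i with
      | zero => simp
      | succ i ih => rw [pow_succ, ← mul_assoc, ih, mul_add, mul_one, ← mul_assoc, h0, zero_mul,
          add_zero]
    rw [hw, hc1.mul_pow, h1]
    exact hu.pow_pred_ne_zero

/-- A unipotent single Jordan block has a logarithm. -/
theorem IsJordanBlock.exists_texp_eq {x : End (ZMod p) M} (hx : IsJordanBlock n (x - 1)) :
    ∃ e : End (ZMod p) M, IsJordanBlock n e ∧ texp (p := p) e = x := by
  obtain ⟨Ψ, hΨ⟩ := (hx.texp_sub_one).exists_conj hx
  let φ := Ψ.conjAlgEquiv (ZMod p)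
  have hφ : φ (texp (p := p) (x - 1) - 1) = x - 1 := by
    refine LinearMap.ext fun m => ?_
    simp [φ, LinearEquiv.conjAlgEquiv_apply, hΨ, -LinearMap.sub_apply]
  refine ⟨φ (x - 1), ⟨hx.finrank_eq, ?_, ?_⟩, ?_⟩
  · rw [← map_pow, hx.pow_eq_zero, map_zero]
  · rw [← map_pow]
    exact fun h => hx.pow_pred_ne_zero ((map_eq_zero_iff φ φ.injective).1 h)
  · have := texp_map (p := p) (φ : End (ZMod p) M →ₐ[ZMod p] End (ZMod p) M) (x - 1)
    rw [AlgEquiv.coe_toAlgHom] at this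
    rw [← this]
    rw [map_sub, map_one, sub_left_inj] at hφ
    exact hφ

end JordanLog

section AdNilpotent

/-- The commutator map `X ↦ a X - X a`. -/
def adOp (p : ℕ) {E : Type*} [Ring E] [Algebra (ZMod p) E] (a : E) : Module.End (ZMod p) E :=
  LinearMap.mulLeft (ZMod p) a - LinearMap.mulRight (ZMod p) a

@[simp] theorem adOp_apply {p : ℕ} {E : Type*} [Ring E] [Algebra (ZMod p) E] (a X : E) :
    adOp p a X = a * X - X * a := by
  simp [adOp]

variable {p : ℕ} [hp : Fact p.Prime] {E : Type*} [Ring E] [Algebra (ZMod p) E]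

theorem texp_mulLeft (a : E) :
    texp (p := p) (LinearMap.mulLeft (ZMod p) a) = LinearMap.mulLeft (ZMod p) (texp (p := p) a) := by
  refine LinearMap.ext fun X => ?_
  simp only [texp, LinearMap.sum_apply, LinearMap.smul_apply, LinearMap.pow_mulLeft,
    LinearMap.mulLeft_apply, Finset.sum_mul, smul_mul_assoc]

theorem texp_mulRight (a : E) :
    texp (p := p) (LinearMap.mulRight (ZMod p) a) =
      LinearMap.mulRight (ZMod p) (texp (p := p) a) := by
  refine LinearMap.ext fun X => ?_
  simp only [texp, LinearMap.sum_apply, LinearMap.smul_apply, LinearMap.pow_mulRight,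
    LinearMap.mulRight_apply, Finset.mul_sum, mul_smul_comm]

variable {n : ℕ}

theorem commute_mulLeft_neg_mulRight (a : E) :
    Commute (LinearMap.mulLeft (ZMod p) a) (-LinearMap.mulRight (ZMod p) a) :=
  Commute.neg_right (R := Module.End (ZMod p) E) (LinearMap.commute_mulLeft_right a a)

theorem adOp_pow_apply (a X : E) (m : ℕ) : (adOp p a ^ m) X =
    ∑ i ∈ Finset.range (m + 1), (m.choose i) • (a ^ i * X * (-a) ^ (m - i)) := by
  rw [adOp, sub_eq_add_neg, (commute_mulLeft_neg_mulRight a).add_pow, LinearMap.sum_apply]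
  refine Finset.sum_congr rfl fun i _ => ?_
  have h1 : -LinearMap.mulRight (ZMod p) a = LinearMap.mulRight (ZMod p) (-a) := by
    ext; simp
  rw [h1, ← Nat.cast_comm, ← nsmul_eq_mul, LinearMap.smul_apply, Module.End.mul_apply,
    LinearMap.pow_mulLeft, LinearMap.pow_mulRight, LinearMap.mulLeft_apply,
    LinearMap.mulRight_apply, mul_assoc]

theorem texp_smul_adOp (hn : 2 * n = p + 1) {a : E} (ha : a ^ n = 0) (s : ZMod p) (X : E) :
    texp (p := p) (s • adOp p a) X = texp (p := p) (s • a) * X * texp (p := p) (-(s • a)) := by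
  have h1 : s • adOp p a =
      LinearMap.mulLeft (ZMod p) (s • a) + LinearMap.mulRight (ZMod p) (-(s • a)) := by
    ext X; simp [sub_eq_add_neg]
  rw [h1, texp_add (LinearMap.commute_mulLeft_right _ _), texp_mulLeft, texp_mulRight]
  · simp [mul_assoc]
  · intro i j hij
    rw [LinearMap.pow_mulLeft, LinearMap.pow_mulRight]
    rcases lt_or_ge i n with hi | hi
    · rw [neg_pow, smul_pow s a j, pow_eq_zero_of_le (show n ≤ j by omega) ha]
      ext; simp
    · rw [smul_pow, pow_eq_zero_of_le hi ha]
      ext; simp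

theorem adOp_pow_prime (hn : 2 * n = p + 1) {a : E} (ha : a ^ n = 0) : adOp p a ^ p = 0 := by
  refine LinearMap.ext fun X => ?_
  rw [adOp_pow_apply, Finset.sum_eq_zero, LinearMap.zero_apply]
  intro i _
  rcases lt_or_ge i n with hi | hi
  · rw [neg_pow, pow_eq_zero_of_le (show n ≤ p - i by omega) ha]; simp
  · rw [pow_eq_zero_of_le hi ha]; simp

theorem sum_texp_conj_eq_zero (hn : 2 * n = p + 1) {a : E} (ha : a ^ n = 0) {X : E}
    (hX : a ^ (n - 1) * X * a ^ (n - 1) = 0) :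
    ∑ s : ZMod p, texp (p := p) (s • a) * X * texp (p := p) (-(s • a)) = 0 := by
  have h2 := hp.out.two_le
  simp only [← texp_smul_adOp hn ha]
  rw [← LinearMap.sum_apply, sum_texp_smul, LinearMap.neg_apply, LinearMap.smul_apply,
    adOp_pow_apply, Finset.sum_eq_zero, smul_zero, neg_zero]
  intro i _
  rcases lt_trichotomy i (n - 1) with hi | hi | hi
  · rw [neg_pow, pow_eq_zero_of_le (show n ≤ p - 1 - i by omega) ha]; simp
  · rw [hi, show p - 1 - (n - 1) = n - 1 by omega, neg_pow, ← mul_assoc,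
      ((Commute.neg_one_left (a ^ (n-1) * X)).pow_left (n-1)).eq.symm, mul_assoc, hX]; simp
  · rw [pow_eq_zero_of_le (show n ≤ i by omega) ha]; simp

/-- Subspaces stable under conjugation by `texp (s • a)` are stable under `adOp a`. -/
theorem adOp_mem (hn : 2 * n = p + 1) (hp2 : 2 < p) {a : E} (ha : a ^ n = 0)
    (W : Submodule (ZMod p) E)
    (hW : ∀ s : ZMod p, ∀ X ∈ W, texp (p := p) (s • a) * X * texp (p := p) (-(s • a)) ∈ W)
    {X : E} (hX : X ∈ W) : adOp p a X ∈ W := by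
  have h := LinearMap.congr_fun (sum_inv_smul_texp_smul hp2 (adOp p a)) X
  rw [LinearMap.sum_apply] at h
  have h2 : -(adOp p a X) ∈ W := by
    rw [← LinearMap.neg_apply, ← h]
    refine W.sum_mem fun s _ => ?_
    rw [LinearMap.smul_apply, texp_smul_adOp hn ha]
    exact W.smul_mem _ (hW s X hX)
  simpa using W.neg_mem h2

end AdNilpotent

section OrbitSum

open Finset Function

theorem sum_eq_sum_fixed_of_invariant {Q A : Type*} [DecidableEq Q] [AddCommGroup A] {p : ℕ}
    (hp : p.Prime) (f : Q → Q) (hf : ∀ q, f^[p] q = q) (F : Q → A)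
    (hF : ∀ q, f q ≠ q → ∑ i ∈ range p, F (f^[i] q) = 0) (S : Finset Q)
    (hS : ∀ q ∈ S, f q ∈ S) : ∑ q ∈ S, F q = ∑ q ∈ S with f q = q, F q := by
  induction S using Finset.strongInduction with
  | H S ih =>
    by_cases hfix : ∀ q ∈ S, f q = q
    · rw [Finset.filter_true_of_mem hfix]
    · push Not at hfix
      obtain ⟨q, hq, hne⟩ := hfix
      have hper : minimalPeriod f q = p := by
        have hd : minimalPeriod f q ∣ p := IsPeriodicPt.minimalPeriod_dvd (hf q)
        rcases (Nat.dvd_prime hp).1 hd with h | h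
        · exact absurd (minimalPeriod_eq_one_iff_isFixedPt.1 h) hne
        · exact h
      have hinj : Set.InjOn (fun i => f^[i] q) (range p : Finset ℕ) := by
        have := iterate_injOn_Iio_minimalPeriod (f := f) (x := q)
        rw [hper] at this
        intro i hi j hj h
        exact this (by simpa using hi) (by simpa using hj) h
      let O := (range p).image fun i => f^[i] q
      have hOS : O ⊆ S := by
        intro r hr
        obtain ⟨i, hi, rfl⟩ := Finset.mem_image.1 hr
        clear hr hi
        induction i with
        | zero => exact hq
        | succ i ihi => exact (iterate_succ_apply' f i q) ▸ hS _ ihi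
      have hOf : ∀ r, f r ∈ O → r ∈ O := by
        intro r hr
        obtain ⟨i, hi, hir⟩ := Finset.mem_image.1 hr
        have hpp := hp.pos
        have hr' : r = f^[p - 1 + i] q := by
          rw [iterate_add_apply, hir, ← iterate_succ_apply, show (p - 1).succ = p by omega, hf]
        refine Finset.mem_image.2 ⟨(p - 1 + i) % p, Finset.mem_range.2 (Nat.mod_lt _ hpp), ?_⟩
        rw [hr']
        exact (IsPeriodicPt.iterate_mod_apply (hf q) _)
      have hOne : ∀ r ∈ O, f r ≠ r := by
        intro r hr h
        obtain ⟨i, _, rfl⟩ := Finset.mem_image.1 hr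
        have h1 : f^[p] (f^[1] q) = f^[p] q := by
          have hi := Finset.mem_range.1 ‹i ∈ range p›
          rw [show p = (p - i) + i by omega, iterate_add_apply, iterate_add_apply,
            ← iterate_add_apply f i 1, add_comm i 1, iterate_add_apply, iterate_one, h]
        rw [hf, hf] at h1
        exact hne h1
      have hlt : S \ O ⊂ S := by
        refine Finset.sdiff_ssubset hOS ⟨q, Finset.mem_image.2 ⟨0, ?_, rfl⟩⟩
        exact Finset.mem_range.2 hp.pos
      have h1 := ih (S \ O) hlt (by
        intro r hr
        rw [Finset.mem_sdiff] at hr ⊢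
        exact ⟨hS r hr.1, fun h => hr.2 (hOf r h)⟩)
      rw [← Finset.sum_sdiff hOS, h1]
      have h2 : ∑ r ∈ O, F r = 0 := by
        rw [Finset.sum_image hinj]
        exact hF q hne
      rw [h2, add_zero]
      congr 1
      ext r
      simp only [Finset.mem_filter, Finset.mem_sdiff]
      exact ⟨fun h => ⟨h.1.1, h.2⟩, fun h => ⟨⟨h.1, fun hr => hOne r hr h.2⟩, h.2⟩⟩

end OrbitSum

section CosetSum

variable {G : Type*} [Group G] {p : ℕ} [hp : Fact p.Prime]

/-- A sum over the cosets of a subgroup of order `p` reduces to the cosets in its normalizer. -/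
theorem sum_cosets_eq_sum_fixed [Finite G] {A : Type*} [AddCommGroup A] {x : G} (hx : x ^ p = 1)
    [Fintype (G ⧸ Subgroup.zpowers x)] (Φ : G → A)
    (hΦ : ∀ g i, Φ (g * x ^ i) = Φ g)
    (h0 : ∀ g, (∀ b : ℕ, g⁻¹ * x * g ≠ x ^ b) → ∑ i ∈ Finset.range p, Φ (x ^ i * g) = 0) :
    ∃ S : Finset (G ⧸ Subgroup.zpowers x),
      (S.card : ZMod p) = (Nat.card (G ⧸ Subgroup.zpowers x) : ZMod p) ∧
      (∀ q ∈ S, ∃ b : ℕ, q.out⁻¹ * x * q.out = x ^ b) ∧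
      ∑ q : G ⧸ Subgroup.zpowers x, Φ q.out = ∑ q ∈ S, Φ q.out := by
  classical
  have hpow : ∀ {y : G}, y ∈ Subgroup.zpowers x → ∃ b : ℕ, y = x ^ b := by
    intro y hy
    obtain ⟨b, hb⟩ := (mem_powers_iff_mem_zpowers.2 hy)
    exact ⟨b, hb.symm⟩
  let f : G ⧸ Subgroup.zpowers x → G ⧸ Subgroup.zpowers x := fun q => x • q
  have hfi : ∀ i q, f^[i] q = x ^ i • q := by
    intro i
    induction i with
    | zero => intro q; simp
    | succ i ih => intro q; rw [Function.iterate_succ_apply', ih, pow_succ', mul_smul]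
  have hfp : ∀ q, f^[p] q = q := fun q => by rw [hfi, hx, one_smul]
  have hout : ∀ g : G, ∃ i : ℕ, (Quotient.out (g : G ⧸ Subgroup.zpowers x)) = g * x ^ i := by
    intro g
    obtain ⟨h, hh⟩ := QuotientGroup.mk_out_eq_mul (Subgroup.zpowers x) g
    obtain ⟨b, hb⟩ := hpow h.2
    exact ⟨b, by rw [hh, hb]⟩
  have hfq : ∀ q i, Φ (Quotient.out (f^[i] q)) = Φ (x ^ i * Quotient.out q) := by
    intro q i
    obtain ⟨j, hj⟩ := hout (x ^ i * q.out)
    have : f^[i] q = ((x ^ i * q.out : G) : G ⧸ Subgroup.zpowers x) := by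
      rw [hfi]
      conv_lhs => rw [← QuotientGroup.out_eq' q]
      rfl
    rw [this, hj, hΦ]
  have hfix : ∀ q, f q = q ↔ ∃ b : ℕ, q.out⁻¹ * x * q.out = x ^ b := by
    intro q
    have : f q = q ↔ q.out⁻¹ * x * q.out ∈ Subgroup.zpowers x := by
      have h1 : f q = ((x * q.out : G) : G ⧸ Subgroup.zpowers x) := by
        conv_lhs => rw [← QuotientGroup.out_eq' q]
        rfl
      conv_lhs => rw [h1, eq_comm]; lhs; rw [← QuotientGroup.out_eq' q]
      rw [QuotientGroup.eq, mul_assoc]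
    rw [this]
    exact ⟨hpow, fun ⟨b, hb⟩ => hb ▸ Subgroup.npow_mem_zpowers x b⟩
  refine ⟨Finset.univ.filter fun q => f q = q, ?_, ?_, ?_⟩
  · have := sum_eq_sum_fixed_of_invariant hp.out f hfp (fun _ => (1 : ZMod p)) (by simp)
      Finset.univ (by simp)
    simp only [Finset.sum_const, nsmul_eq_mul, mul_one] at this
    rw [← this, Finset.card_univ, Nat.card_eq_fintype_card]
  · intro q hq
    exact (hfix q).1 (Finset.mem_filter.1 hq).2
  · refine sum_eq_sum_fixed_of_invariant hp.out f hfp _ ?_ Finset.univ (by simp)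
    intro q hq
    simp only [hfq]
    refine h0 _ fun b hb => hq ((hfix q).2 ⟨b, hb⟩)

theorem sum_cosets_mul_left [Finite G] {A : Type*} [AddCommGroup A] {x : G}
    [Fintype (G ⧸ Subgroup.zpowers x)] (Φ : G → A)
    (hΦ : ∀ g i, Φ (g * x ^ i) = Φ g) (g : G) :
    ∑ q : G ⧸ Subgroup.zpowers x, Φ (g * q.out) = ∑ q : G ⧸ Subgroup.zpowers x, Φ q.out := by
  refine Fintype.sum_equiv (MulAction.toPerm g) _ _ fun q => ?_
  have h1 : MulAction.toPerm g q = ((g * q.out : G) : G ⧸ Subgroup.zpowers x) := by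
    rw [MulAction.toPerm_apply]
    conv_lhs => rw [← QuotientGroup.out_eq' q]
    rfl
  obtain ⟨h, hh⟩ := QuotientGroup.mk_out_eq_mul (Subgroup.zpowers x) (g * q.out)
  obtain ⟨b, hb⟩ := mem_powers_iff_mem_zpowers.2 h.2
  rw [h1, hh, ← hb, hΦ]

theorem sum_zmod_val {A : Type*} [AddCommGroup A] (F : ℕ → A) :
    ∑ s : ZMod p, F s.val = ∑ i ∈ Finset.range p, F i := by
  refine Finset.sum_bij' (fun s _ => s.val) (fun i _ => (i : ZMod p)) ?_ ?_ ?_ ?_ ?_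
  · intro s _; exact Finset.mem_range.2 (ZMod.val_lt s)
  · intro i _; exact Finset.mem_univ _
  · intro s _; exact ZMod.natCast_zmod_val s
  · intro i hi; exact ZMod.val_natCast_of_lt (Finset.mem_range.1 hi)
  · intro s _; rfl

theorem card_quotient_zpowers_cast_ne_zero {x : G} (hx : orderOf x = p)
    (hG : ¬ p ^ 2 ∣ Nat.card G) : (Nat.card (G ⧸ Subgroup.zpowers x) : ZMod p) ≠ 0 := by
  rw [Ne, ZMod.natCast_eq_zero_iff]
  rintro h
  apply hG
  rw [Subgroup.card_eq_card_quotient_mul_card_subgroup (Subgroup.zpowers x), Nat.card_zpowers, hx,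
    pow_two]
  exact Nat.mul_dvd_mul_right h p

end CosetSum

section Lowering

open Module

theorem LinearMap.trace_eq_sum_of_apply_basis {k M ι : Type*} [Field k] [AddCommGroup M]
    [Module k M] [Fintype ι] [DecidableEq ι] (b : Basis ι k M) (X : End k M) (c : ι → k)
    (h : ∀ i, X (b i) = c i • b i) : LinearMap.trace k M X = ∑ i, c i := by
  rw [LinearMap.trace_eq_matrix_trace k b, Matrix.trace]
  refine Finset.sum_congr rfl fun i _ => ?_
  rw [Matrix.diag_apply, LinearMap.toMatrix_apply, h]
  simp

theorem six_mul_sum_weights {R : Type*} [CommRing R] (N : R) (m : ℕ) :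
    6 * ∑ i ∈ Finset.range m, ((i : R) + 1) * (N - i - 1) =
      m * (m + 1) * (3 * N - 2 * m - 1) := by
  induction m with
  | zero => simp
  | succ m ih =>
    rw [Finset.sum_range_succ, mul_add, ih]
    push_cast
    ring

theorem thirty_mul_sum_weights {R : Type*} [CommRing R] (N : R) (m : ℕ) :
    30 * ∑ i ∈ Finset.range m, ((i : R) + 1) * (i + 2) * ((N - i - 1) * (N - i - 2)) =
      m * (m + 1) * (m + 2) * (10 * N ^ 2 - 15 * N * m - 15 * N + 6 * m ^ 2 + 12 * m + 2) := by
  induction m with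
  | zero => simp
  | succ m ih =>
    rw [Finset.sum_range_succ, mul_add, ih]
    push_cast
    ring

namespace IsJordanBlock

variable {k M : Type*} [Field k] [AddCommGroup M] [Module k M] {n : ℕ} {e : End k M}

/-- A lowering operator `f` completing `e` to an `sl₂`-triple up to sign conventions. -/
theorem exists_lowering (he : IsJordanBlock n e) : ∃ f h : End k M,
    e * f - f * e = h ∧ e * h - h * e = -(2 : k) • e ∧ h * f - f * h = -(2 : k) • f ∧
    (∀ m, e m = 0 → h m = ((n : k) - 1) • m) ∧
    LinearMap.trace k M (f * e) = ∑ i ∈ Finset.range n, ((i : k) + 1) * (n - i - 1) ∧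
    LinearMap.trace k M (f * f * e ^ 2) =
      ∑ i ∈ Finset.range n, ((i : k) + 1) * (i + 2) * ((n - i - 1) * (n - i - 2)) := by
  obtain ⟨v, hv⟩ := he.exists_cyclic
  let f : End k M := (he.basis hv).constr k fun i => ((i : k) * (n - i)) • (e ^ ((i : ℕ) - 1)) v
  have hf : ∀ i : ℕ, f ((e ^ i) v) = ((i : k) * (n - i)) • (e ^ (i - 1)) v := by
    intro i
    rcases lt_trichotomy i n with hi | hi | hi
    · have := (he.basis hv).constr_basis k
        (fun i => ((i : k) * (n - i)) • (e ^ ((i : ℕ) - 1)) v) ⟨i, hi⟩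
      rw [basis_apply] at this
      exact this
    · subst hi
      rw [he.pow_apply_eq_zero le_rfl]; simp
    · rw [he.pow_apply_eq_zero hi.le, he.pow_apply_eq_zero (show n ≤ i - 1 by omega)]; simp
  have he1 : ∀ i, e ((e ^ i) v) = (e ^ (i + 1)) v := fun i => by
    rw [pow_succ', Module.End.mul_apply]
  have hh : ∀ i : ℕ, (e * f - f * e) ((e ^ i) v) = (2 * (i : k) - n + 1) • (e ^ i) v := by
    intro i
    simp only [LinearMap.sub_apply, Module.End.mul_apply, he1, hf, map_smul]
    rcases Nat.eq_zero_or_pos i with rfl | hi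
    · simp only [← neg_smul, Nat.cast_zero, zero_mul, zero_smul, zero_add, zero_sub,
        mul_zero]
      congr 1; push_cast; ring
    · rw [Nat.sub_add_cancel hi, Nat.add_sub_cancel, ← sub_smul]
      congr 1; push_cast; ring
  have hfe : ∀ i : ℕ, (f * e) ((e ^ i) v) = (((i : k) + 1) * (n - i - 1)) • (e ^ i) v := by
    intro i
    simp only [Module.End.mul_apply, he1, hf, Nat.add_sub_cancel]
    congr 1; push_cast; ring
  refine ⟨f, e * f - f * e, rfl, ?_, ?_, ?_, ?_, ?_⟩
  · refine he.ext_cyclic hv fun i => ?_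
    rw [LinearMap.sub_apply, Module.End.mul_apply, Module.End.mul_apply, hh, he1, hh, map_smul, he1,
      LinearMap.smul_apply, he1, ← sub_smul]
    congr 1; push_cast; ring
  · refine he.ext_cyclic hv fun i => ?_
    rw [LinearMap.sub_apply, Module.End.mul_apply, Module.End.mul_apply, hh, hf, map_smul, hh,
      map_smul, hf, LinearMap.smul_apply, hf, smul_smul, smul_smul, smul_smul, ← sub_smul]
    rcases Nat.eq_zero_or_pos i with rfl | hi
    · simp
    · congr 1; rw [Nat.cast_sub hi]; push_cast; ring
  · intro m hm
    obtain ⟨c, rfl⟩ := he.exists_smul_of_apply_eq_zero hv hm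
    rw [map_smul, hh, smul_comm, Nat.cast_sub he.pos]
    congr 2; push_cast; ring
  · rw [LinearMap.trace_eq_sum_of_apply_basis (he.basis hv) (f * e)
      (fun i => ((i : k) + 1) * (n - i - 1)) (fun i => by rw [basis_apply]; exact hfe i),
      Fin.sum_univ_eq_sum_range (fun i => ((i : k) + 1) * (n - i - 1))]
  · rw [LinearMap.trace_eq_sum_of_apply_basis (he.basis hv) (f * f * e ^ 2)
      (fun i => ((i : k) + 1) * (i + 2) * ((n - i - 1) * (n - i - 2))),
      Fin.sum_univ_eq_sum_range
        (fun i => ((i : k) + 1) * (i + 2) * ((n - i - 1) * (n - i - 2)))]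
    intro i
    rw [basis_apply, pow_two, mul_assoc, ← mul_assoc f e e, Module.End.mul_apply,
      Module.End.mul_apply, he1, hfe, map_smul, hf, smul_smul, Nat.add_sub_cancel]
    congr 1; push_cast; ring

end IsJordanBlock

end Lowering

section TransferOperator

open Module

variable {p : ℕ} [hp : Fact p.Prime] {M : Type*} [AddCommGroup M] [Module (ZMod p) M] {n : ℕ}
  {e : End (ZMod p) M}

theorem adOp_mul {A : Type*} [Ring A] [Algebra (ZMod p) A] (a X Y : A) :
    adOp p a (X * Y) = adOp p a X * Y + X * adOp p a Y := by
  simp only [adOp_apply]; noncomm_ring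

theorem ZMod.natCast_ne_zero_of_lt {m : ℕ} (h0 : m ≠ 0) (hm : m < p) : (m : ZMod p) ≠ 0 := by
  rw [Ne, ZMod.natCast_eq_zero_iff]
  exact fun h => absurd (Nat.le_of_dvd (Nat.pos_of_ne_zero h0) h) (by omega)

theorem ZMod.two_mul_natCast_eq_one (hn : 2 * n = p + 1) : 2 * (n : ZMod p) = 1 := by
  have : ((2 * n : ℕ) : ZMod p) = ((p + 1 : ℕ) : ZMod p) := by rw [hn]
  simpa using this

theorem sum_weights_ne_zero (h11 : 11 ≤ p) (hn : 2 * n = p + 1) :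
    ∑ i ∈ Finset.range n, ((i : ZMod p) + 1) * (n - i - 1) ≠ 0 := by
  intro h
  have h1 := six_mul_sum_weights (n : ZMod p) n
  rw [h, mul_zero] at h1
  have h2 := ZMod.two_mul_natCast_eq_one hn
  have h3 : ((3 : ℕ) : ZMod p) = 0 := by
    push_cast
    have : (n : ZMod p) * (n + 1) * (3 * n - 2 * n - 1) * 8 =
      (2 * n) * (2 * n + 2) * (2 * n - 2) := by ring
    rw [← h1, h2] at this
    linear_combination this
  exact ZMod.natCast_ne_zero_of_lt (by norm_num) (by omega) h3

theorem sum_weights_two_ne_zero (h11 : 11 ≤ p) (hn : 2 * n = p + 1) :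
    ∑ i ∈ Finset.range n,
      ((i : ZMod p) + 1) * (i + 2) * ((n - i - 1) * (n - i - 2)) ≠ 0 := by
  intro h
  have h1 := thirty_mul_sum_weights (n : ZMod p) n
  rw [h, mul_zero] at h1
  have h2 := ZMod.two_mul_natCast_eq_one hn
  have h3 : ((3 : ℕ) : ZMod p) * (3 : ℕ) * (5 : ℕ) = 0 := by
    push_cast
    have : (n : ZMod p) * (n + 1) * (n + 2) * (10 * n ^ 2 - 15 * n * n - 15 * n + 6 * n ^ 2
      + 12 * n + 2) * 32 =
      (2 * n) * (2 * n + 2) * (2 * n + 4) * (2 * n - 2) * (2 * n - 4) := by ring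
    rw [← h1, h2] at this
    linear_combination -this
  exact mul_ne_zero (mul_ne_zero (ZMod.natCast_ne_zero_of_lt (by norm_num) (by omega))
    (ZMod.natCast_ne_zero_of_lt (by norm_num) (by omega)))
    (ZMod.natCast_ne_zero_of_lt (by norm_num) (by omega)) h3

/-- An operator on `End M` commuting with `ad e` which detects `e ^ 2` among the powers of `e`. -/
theorem IsJordanBlock.exists_commute_adOp (he : IsJordanBlock n e) (h11 : 11 ≤ p)
    (hn : 2 * n = p + 1) : ∃ φ : End (ZMod p) (End (ZMod p) M), Commute φ (adOp p e) ∧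
      (∃ c : ZMod p, c ≠ 0 ∧ φ (e ^ 2) = c • e ^ 2) ∧ ∀ j < n, j ≠ 2 → φ (e ^ j) = 0 := by
  have := he.finiteDimensional
  obtain ⟨f, h, h1, h2, h3, -, -, h5⟩ := he.exists_lowering
  set D := adOp p e with hD
  set ζ := f * f with hζ
  have D1 : D f = h := by rw [hD, adOp_apply, h1]
  have D2 : D h = -(2 : ZMod p) • e := by rw [hD, adOp_apply, h2]
  have D3 : D e = 0 := by simp [hD]
  have Z1 : D ζ = h * f + f * h := by rw [hζ, hD, adOp_mul, ← hD, D1]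
  have Z2 : D (D ζ) = -(2 : ZMod p) • (e * f + f * e) + (2 : ZMod p) • (h * h) := by
    rw [Z1, map_add, hD, adOp_mul, adOp_mul, ← hD, D1, D2, smul_mul_assoc, mul_smul_comm, smul_add,
      two_smul _ (h * h)]
    abel
  have Z3 : D (D (D ζ)) = -(6 : ZMod p) • (e * h + h * e) := by
    rw [Z2, map_add, map_smul, map_smul, map_add, hD, adOp_mul, adOp_mul, adOp_mul, ← hD, D1, D2,
      D3]
    simp only [smul_mul_assoc, mul_smul_comm, zero_mul, mul_zero, zero_add, add_zero]
    module
  have Z4 : D (D (D (D ζ))) = (24 : ZMod p) • e ^ 2 := by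
    rw [Z3, map_smul, map_add, hD, adOp_mul, adOp_mul, ← hD, D2, D3]
    simp only [smul_mul_assoc, mul_smul_comm, zero_mul, mul_zero, zero_add, add_zero, pow_two]
    module
  have Dpow : ∀ j, D (e ^ j) = 0 := by
    intro j; rw [hD, adOp_apply, ← pow_succ, ← pow_succ', sub_self]
  have Z5 : D (D (D (D (D ζ)))) = 0 := by rw [Z4, map_smul, Dpow, smul_zero]
  have htr : ∀ X Y, LinearMap.trace (ZMod p) M (X * D Y) =
      -LinearMap.trace (ZMod p) M (D X * Y) := by
    intro X Y
    simp only [hD, adOp_apply, mul_sub, sub_mul, map_sub]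
    have := LinearMap.trace_mul_comm (ZMod p) (X * Y) e
    simp only [mul_assoc] at this ⊢
    rw [this]; ring
  let R : End (ZMod p) (End (ZMod p) M) :=
    ((LinearMap.trace (ZMod p) M) ∘ₗ LinearMap.mulLeft (ZMod p) ζ).smulRight ζ
  have hR : ∀ X, R X = LinearMap.trace (ZMod p) M (ζ * X) • ζ := fun X => rfl
  have hDR : D ^ 5 * R = 0 := by
    refine LinearMap.ext fun X => ?_
    simp only [Module.End.mul_apply, hR, map_smul, pow_succ, pow_zero, Module.End.one_apply]
    rw [Z5, smul_zero, LinearMap.zero_apply]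
  have hRD : R * D ^ 5 = 0 := by
    refine LinearMap.ext fun X => ?_
    simp only [Module.End.mul_apply, hR, pow_succ, pow_zero, Module.End.one_apply]
    rw [htr, htr, htr, htr, htr, Z5]; simp
  have hz2 : LinearMap.trace (ZMod p) M (ζ * e ^ 2) ≠ 0 := by
    rw [h5]; exact sum_weights_two_ne_zero h11 hn
  have hzj : ∀ j < n, j ≠ 2 → LinearMap.trace (ZMod p) M (ζ * e ^ j) = 0 := by
    intro j hj hj2
    have hej : ∀ j : ℕ, h * e ^ j - e ^ j * h = (2 * j : ZMod p) • e ^ j := by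
      intro j
      induction j with
      | zero => simp
      | succ j ih =>
        have e1 : h * e - e * h = (2 : ZMod p) • e := by
          rw [← neg_sub, h2, neg_smul, neg_neg]
        have : h * e ^ (j + 1) - e ^ (j + 1) * h =
            (h * e ^ j - e ^ j * h) * e + e ^ j * (h * e - e * h) := by
          rw [pow_succ]; noncomm_ring
        rw [this, ih, e1, smul_mul_assoc, mul_smul_comm, ← pow_succ, ← add_smul]
        congr 1; push_cast; ring
    have hzz : h * ζ - ζ * h = -(4 : ZMod p) • ζ := by
      have : h * ζ - ζ * h = (h * f - f * h) * f + f * (h * f - f * h) := by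
        rw [hζ]; noncomm_ring
      rw [this, h3, smul_mul_assoc, mul_smul_comm, ← add_smul, hζ]
      congr 1; ring
    have hw : h * (ζ * e ^ j) - (ζ * e ^ j) * h = (2 * (j : ZMod p) - 4) • (ζ * e ^ j) := by
      have : h * (ζ * e ^ j) - (ζ * e ^ j) * h =
          (h * ζ - ζ * h) * e ^ j + ζ * (h * e ^ j - e ^ j * h) := by noncomm_ring
      rw [this, hzz, hej, smul_mul_assoc, mul_smul_comm, ← add_smul]
      congr 1; ring
    have h0 := congrArg (LinearMap.trace (ZMod p) M) hw
    rw [map_sub, LinearMap.trace_mul_comm, sub_self, map_smul, smul_eq_mul] at h0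
    refine (mul_eq_zero.1 h0.symm).resolve_left fun h6 => ?_
    have h7 : ((2 : ℕ) : ZMod p) ≠ 0 := ZMod.natCast_ne_zero_of_lt (by norm_num) (by omega)
    have h8 : ((j : ℕ) : ZMod p) = ((2 : ℕ) : ZMod p) := by
      refine mul_left_cancel₀ h7 ?_
      push_cast
      linear_combination h6
    rw [ZMod.natCast_eq_natCast_iff'] at h8
    rw [Nat.mod_eq_of_lt (by omega), Nat.mod_eq_of_lt (by omega)] at h8
    exact hj2 h8
  have hφe : ∀ j, (D ^ 4 * R + D ^ 3 * R * D + D ^ 2 * R * D ^ 2 + D * R * D ^ 3 + R * D ^ 4) (e ^ j)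
      = LinearMap.trace (ZMod p) M (ζ * e ^ j) • (24 : ZMod p) • e ^ 2 := by
    intro j
    simp only [LinearMap.add_apply, Module.End.mul_apply, Dpow, map_zero, hR, map_smul, pow_succ,
      pow_zero, add_zero, one_mul, mul_zero, zero_smul]
    rw [Z4, pow_two]
  refine ⟨D ^ 4 * R + D ^ 3 * R * D + D ^ 2 * R * D ^ 2 + D * R * D ^ 3 + R * D ^ 4, ?_, ?_, ?_⟩
  · have : D * (D ^ 4 * R + D ^ 3 * R * D + D ^ 2 * R * D ^ 2 + D * R * D ^ 3 + R * D ^ 4) -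
        (D ^ 4 * R + D ^ 3 * R * D + D ^ 2 * R * D ^ 2 + D * R * D ^ 3 + R * D ^ 4) * D =
        D ^ 5 * R - R * D ^ 5 := by noncomm_ring
    rw [hDR, hRD, sub_zero] at this
    exact (sub_eq_zero.1 this).symm
  · refine ⟨_, ?_, (hφe 2).trans (smul_smul _ _ _)⟩
    refine mul_ne_zero hz2 ?_
    have : ((2 : ℕ) : ZMod p) * (2 : ℕ) * (2 : ℕ) * (3 : ℕ) ≠ 0 := by
      have h2 : ((2 : ℕ) : ZMod p) ≠ 0 := ZMod.natCast_ne_zero_of_lt (by norm_num) (by omega)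
      exact mul_ne_zero (mul_ne_zero (mul_ne_zero h2 h2) h2)
        (ZMod.natCast_ne_zero_of_lt (by norm_num) (by omega))
    intro h24
    apply this
    push_cast
    linear_combination h24
  · intro j hj hj2
    rw [hφe, hzj j hj hj2, zero_smul]

end TransferOperator

section ConjugationRep

open Module

/-- The conjugation action on endomorphisms of a representation. -/
noncomputable def conjRep {k G M : Type*} [Field k] [Group G] [AddCommGroup M] [Module k M]
    (ρ : Representation k G M) : Representation k G (End k M) :=
  Representation.linHom ρ ρ

theorem conjRep_apply {k G M : Type*} [Field k] [Group G] [AddCommGroup M] [Module k M]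
    (ρ : Representation k G M) (g : G) (X : End k M) :
    conjRep ρ g X = ρ g * X * ρ g⁻¹ := by
  rw [conjRep, Representation.linHom_apply, mul_assoc]; rfl

theorem conjRep_mul {k G M : Type*} [Field k] [Group G] [AddCommGroup M] [Module k M]
    (ρ : Representation k G M) (g : G) (X Y : End k M) :
    conjRep ρ g (X * Y) = conjRep ρ g X * conjRep ρ g Y := by
  have : ρ g⁻¹ * ρ g = 1 := by rw [← map_mul, inv_mul_cancel, map_one]
  simp only [conjRep_apply, mul_assoc]
  rw [← mul_assoc (ρ g⁻¹) (ρ g), this, one_mul]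

theorem conjRep_pow {k G M : Type*} [Field k] [Group G] [AddCommGroup M] [Module k M]
    (ρ : Representation k G M) (g : G) (X : End k M) (i : ℕ) :
    conjRep ρ g (X ^ i) = conjRep ρ g X ^ i := by
  induction i with
  | zero =>
    rw [pow_zero, pow_zero, conjRep_apply, mul_one, ← map_mul, mul_inv_cancel, map_one]
  | succ i ih => rw [pow_succ, pow_succ, conjRep_mul, ih]

end ConjugationRep

/-- An irreducible faithful self-dual representation of degree `(p + 1) / 2` in characteristic `p`,
with an element `x = exp e` acting by a single Jordan block; `σ` is the adjoint involution. -/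
structure IsUnipotentCore {p : ℕ} [Fact p.Prime] {G M : Type*} [Group G] [AddCommGroup M]
    [Module (ZMod p) M] (ρ : Representation (ZMod p) G M) (n : ℕ) (x : G)
    (e : Module.End (ZMod p) M)
    (σ : Module.End (ZMod p) M →ₗ[ZMod p] Module.End (ZMod p) M) : Prop where
  eleven_le : 11 ≤ p
  two_mul_eq : 2 * n = p + 1
  even : Even n
  injective : Function.Injective ρ
  irreducible : ∀ W : Submodule (ZMod p) M, (∀ g, ∀ m ∈ W, ρ g m ∈ W) → W = ⊥ ∨ W = ⊤
  card : ¬ p ^ 2 ∣ Nat.card G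
  jordan : IsJordanBlock n e
  texp_eq : texp (p := p) e = ρ x
  σ_mul : ∀ X Y, σ (X * Y) = σ Y * σ X
  σ_σ : ∀ X, σ (σ X) = X
  σ_rep : ∀ g, σ (ρ g) = ρ g⁻¹
  σ_e : σ e = -e

namespace IsUnipotentCore

open Module

variable {p : ℕ} [hp : Fact p.Prime] {G M : Type*} [Group G] [AddCommGroup M]
    [Module (ZMod p) M] {ρ : Representation (ZMod p) G M} {n : ℕ} {x : G}
    {e : Module.End (ZMod p) M} {σ : Module.End (ZMod p) M →ₗ[ZMod p] Module.End (ZMod p) M}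

theorem six_le (h : IsUnipotentCore ρ n x e σ) : 6 ≤ n := by
  have := h.eleven_le; have := h.two_mul_eq; omega

theorem le_p (h : IsUnipotentCore ρ n x e σ) : n ≤ p := by
  have := h.eleven_le; have := h.two_mul_eq; omega

theorem two_ne_zero (h : IsUnipotentCore ρ n x e σ) : (2 : ZMod p) ≠ 0 := by
  have := ZMod.natCast_ne_zero_of_lt (p := p) (m := 2) (by norm_num) (by have := h.eleven_le; omega)
  simpa using this

theorem e_pow_prime (h : IsUnipotentCore ρ n x e σ) : e ^ p = 0 :=
  pow_eq_zero_of_le h.le_p h.jordan.pow_eq_zero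

theorem texp_smul (h : IsUnipotentCore ρ n x e σ) (s : ZMod p) :
    texp (p := p) (s • e) = ρ (x ^ s.val) := by
  rw [_root_.texp_smul h.e_pow_prime, h.texp_eq, map_pow]

theorem x_pow (h : IsUnipotentCore ρ n x e σ) : x ^ p = 1 := by
  apply h.injective
  rw [map_pow, ← h.texp_eq, texp_pow_prime h.e_pow_prime, map_one]

theorem texp_neg_smul (h : IsUnipotentCore ρ n x e σ) (s : ZMod p) :
    texp (p := p) (-(s • e)) = ρ (x ^ s.val)⁻¹ := by
  have h1 : texp (p := p) (-(s • e)) * texp (p := p) (s • e) = 1 := by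
    rw [← texp_add (Commute.refl _).neg_left, neg_add_cancel, texp_zero]
    intro i j hij
    rw [neg_pow, mul_assoc, ← pow_add, smul_pow, pow_eq_zero_of_le hij h.e_pow_prime]
    simp
  have h2 : ρ (x ^ s.val) * ρ (x ^ s.val)⁻¹ = 1 := by rw [← map_mul, mul_inv_cancel, map_one]
  rw [h.texp_smul] at h1
  calc _ = texp (p := p) (-(s • e)) * (ρ (x ^ s.val) * ρ (x ^ s.val)⁻¹) := by rw [h2, mul_one]
    _ = _ := by rw [← mul_assoc, h1, one_mul]

theorem x_ne_one (h : IsUnipotentCore ρ n x e σ) : x ≠ 1 := by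
  rintro rfl
  have h1 := sum_inv_smul_texp_smul (p := p) (by have := h.eleven_le; omega) e
  simp only [h.texp_smul, one_pow, map_one] at h1
  rw [← Finset.sum_smul] at h1
  have h6 := h.six_le
  have h2 := congrArg (fun X => e ^ (n - 1) * X) h1
  have h3 : e ^ (n - 1) * -e = 0 := by
    rw [mul_neg, ← pow_succ, show n - 1 + 1 = n by omega, h.jordan.pow_eq_zero, neg_zero]
  simp only [h3, mul_smul_comm, mul_one] at h2
  have h4 := (smul_eq_zero.1 h2).resolve_right h.jordan.pow_pred_ne_zero
  rw [h4, zero_smul] at h1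
  exact h.jordan.pow_ne_zero (i := 1) (by omega) (by rw [pow_one, neg_eq_zero.1 h1.symm])

theorem orderOf_x (h : IsUnipotentCore ρ n x e σ) : orderOf x = p :=
  orderOf_eq_prime h.x_pow h.x_ne_one

theorem texp_smul_adOp (h : IsUnipotentCore ρ n x e σ) (s : ZMod p) :
    texp (p := p) (s • adOp p e) = conjRep ρ (x ^ s.val) := by
  refine LinearMap.ext fun X => ?_
  rw [_root_.texp_smul_adOp h.two_mul_eq h.jordan.pow_eq_zero, h.texp_smul, h.texp_neg_smul,
    conjRep_apply]

/-- Stable subspaces of `End M` are stable under `ad e`. -/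
theorem adOp_mem (h : IsUnipotentCore ρ n x e σ) {W : Submodule (ZMod p) (End (ZMod p) M)}
    (hW : ∀ g, ∀ X ∈ W, conjRep ρ g X ∈ W) {X : End (ZMod p) M} (hX : X ∈ W) :
    e * X - X * e ∈ W := by
  rw [← adOp_apply (p := p)]
  refine _root_.adOp_mem h.two_mul_eq (by have := h.eleven_le; omega) h.jordan.pow_eq_zero W ?_ hX
  intro s X hX
  rw [h.texp_smul, h.texp_neg_smul, ← conjRep_apply]
  exact hW _ X hX

theorem σ_pow (h : IsUnipotentCore ρ n x e σ) (j : ℕ) :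
    σ (e ^ j) = (-1) ^ j * e ^ j := by
  induction j with
  | zero =>
    have := h.σ_rep 1
    rw [inv_one, map_one] at this
    simpa using this
  | succ j ih =>
    rw [pow_succ, h.σ_mul, ih, h.σ_e, pow_succ', neg_mul, ← mul_assoc,
      ((Commute.neg_one_left e).pow_left j).eq.symm, mul_assoc, ← pow_succ', ← pow_succ]
    simp

theorem σ_conjRep (h : IsUnipotentCore ρ n x e σ) (g : G) (X : End (ZMod p) M) :
    σ (conjRep ρ g X) = conjRep ρ g (σ X) := by
  rw [conjRep_apply, conjRep_apply, h.σ_mul, h.σ_mul, h.σ_rep, h.σ_rep, inv_inv, mul_assoc]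

theorem pow_mul_mul_pow_eq_zero (h : IsUnipotentCore ρ n x e σ) {X : End (ZMod p) M}
    (hX : σ X = X) : e ^ (n - 1) * X * e ^ (n - 1) = 0 := by
  obtain ⟨c, hc⟩ := h.jordan.pow_pred_mul_mul_pow_pred X
  have hodd : Odd (n - 1) := by
    obtain ⟨m, hm⟩ := h.even
    exact ⟨m - 1, by have := h.six_le; omega⟩
  have h1 : σ (e ^ (n - 1)) = -e ^ (n - 1) := by rw [h.σ_pow, hodd.neg_one_pow, neg_one_mul]
  have h2 := congrArg σ hc
  rw [h.σ_mul, h.σ_mul, hX, h1, map_smul, h1, ← mul_assoc, neg_mul, neg_mul, mul_neg, neg_neg, hc,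
    smul_neg] at h2
  have h3 : (2 : ZMod p) • c • e ^ (n - 1) = 0 := by
    rw [two_smul]
    exact eq_neg_iff_add_eq_zero.1 h2
  rw [hc]
  exact (smul_eq_zero.1 h3).resolve_left h.two_ne_zero

/-- `x` normalised by `g` gives `e` scaled by `g`. -/
theorem conjRep_of_conj_eq_pow (h : IsUnipotentCore ρ n x e σ) {g : G} {b : ℕ}
    (hg : g * x * g⁻¹ = x ^ b) : conjRep ρ g e = (b : ZMod p) • e := by
  have h2 : 2 < p := by have := h.eleven_le; omega
  have h1 := sum_inv_smul_texp_smul (p := p) h2 e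
  have h3 := congrArg (conjRep ρ g) h1
  rw [map_neg, map_sum] at h3
  have key : ∀ s : ZMod p, conjRep ρ g (s⁻¹ • texp (p := p) (s • e)) =
      s⁻¹ • texp (p := p) (s • ((b : ZMod p) • e)) := by
    intro s
    rw [map_smul, h.texp_smul, smul_comm, texp_natCast_smul, h.texp_smul, conjRep_apply, ← map_mul,
      ← map_mul, ← conj_pow, hg, ← map_pow, ← pow_mul, ← pow_mul, mul_comm]
    rw [smul_pow, h.e_pow_prime, smul_zero]
  simp only [key] at h3
  rw [sum_inv_smul_texp_smul h2] at h3
  exact (neg_injective h3).symm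

theorem exists_transfer (h : IsUnipotentCore ρ n x e σ) [Finite G] :
    ∃ f : End (ZMod p) (End (ZMod p) M), (∀ g X, f (conjRep ρ g X) = conjRep ρ g (f X)) ∧
      ∃ c : ZMod p, c ≠ 0 ∧ f (e ^ 2) = c • e ^ 2 ∧ ∀ j < n, j ≠ 2 → f (e ^ j) = 0 := by
  classical
  obtain ⟨φ, hφ, ⟨c, hc0, hc⟩, hj⟩ := h.jordan.exists_commute_adOp h.eleven_le h.two_mul_eq
  let φ' : End (ZMod p) (End (ZMod p) M) := φ + σ ∘ₗ φ
  have hσD : Commute (σ : End (ZMod p) (End (ZMod p) M)) (adOp p e) := by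
    refine LinearMap.ext fun X => ?_
    simp only [Module.End.mul_apply, adOp_apply, map_sub, h.σ_mul, h.σ_e]
    noncomm_ring
  have hφ'D : Commute φ' (adOp p e) := hφ.add_left (hσD.mul_left hφ)
  have hφ'x : ∀ i X, φ' (conjRep ρ (x ^ i) X) = conjRep ρ (x ^ i) (φ' X) := by
    intro i X
    have h1 : Commute φ' (conjRep ρ x) := by
      have := h.texp_smul_adOp 1
      rw [one_smul, ZMod.val_one, pow_one] at this
      rw [← this, texp]
      exact Commute.sum_right _ _ _ fun i _ => (hφ'D.pow_right i).smul_right _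
    rw [map_pow]
    exact LinearMap.congr_fun (h1.pow_right i).eq X
  have hφ'σ : ∀ X, σ (φ' X) = φ' X := by
    intro X
    simp only [φ', LinearMap.add_apply, LinearMap.comp_apply, map_add, h.σ_σ]
    exact add_comm _ _
  have hσ2 : σ (e ^ 2) = e ^ 2 := by rw [h.σ_pow]; simp
  have hφ'2 : φ' (e ^ 2) = (2 * c) • e ^ 2 := by
    simp only [φ', LinearMap.add_apply, LinearMap.comp_apply, hc, map_smul, hσ2]
    rw [← add_smul, two_mul]
  have hφ'j : ∀ j < n, j ≠ 2 → φ' (e ^ j) = 0 := by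
    intro j hjn hj2
    simp only [φ', LinearMap.add_apply, LinearMap.comp_apply, hj j hjn hj2, map_zero, add_zero]
  let Φ : G → End (ZMod p) (End (ZMod p) M) := fun g => conjRep ρ g * φ' * conjRep ρ g⁻¹
  have hmul : ∀ a b X, conjRep ρ (a * b) X = conjRep ρ a (conjRep ρ b X) := by
    intro a b X; rw [map_mul]; rfl
  have hone : ∀ X, conjRep ρ 1 X = X := by intro X; rw [map_one]; rfl
  have hΦ : ∀ g i, Φ (g * x ^ i) = Φ g := by
    intro g i
    refine LinearMap.ext fun X => ?_
    simp only [Φ, Module.End.mul_apply]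
    rw [hmul, ← hφ'x, _root_.mul_inv_rev, ← hmul (x ^ i), mul_inv_cancel_left]
  have := Fintype.ofFinite (G ⧸ Subgroup.zpowers x)
  refine ⟨∑ q : G ⧸ Subgroup.zpowers x, Φ q.out, ?_, ?_⟩
  · intro g X
    have h1 := congrArg (fun T => T (conjRep ρ g X)) (sum_cosets_mul_left Φ hΦ g)
    rw [← h1, LinearMap.sum_apply, LinearMap.sum_apply, map_sum]
    refine Finset.sum_congr rfl fun q _ => ?_
    simp only [Φ, Module.End.mul_apply]
    rw [hmul, _root_.mul_inv_rev, hmul _ g⁻¹, ← hmul g⁻¹ g, inv_mul_cancel, hone]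
  · have hsum : ∀ j, ∃ S : Finset (G ⧸ Subgroup.zpowers x),
        (S.card : ZMod p) = (Nat.card (G ⧸ Subgroup.zpowers x) : ZMod p) ∧
        (∀ q ∈ S, ∃ b : ℕ, q.out⁻¹ * x * q.out = x ^ b) ∧
        (∑ q : G ⧸ Subgroup.zpowers x, Φ q.out) (e ^ j) = ∑ q ∈ S, Φ q.out (e ^ j) := by
      intro j
      rw [LinearMap.sum_apply]
      refine sum_cosets_eq_sum_fixed h.x_pow (fun g => Φ g (e ^ j))
        (fun g i => by simp only [hΦ]) ?_
      intro g _
      have hxe : ∀ i : ℕ, conjRep ρ (x ^ i)⁻¹ (e ^ j) = e ^ j := by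
        intro i
        have hcomm : Commute (ρ (x ^ i)⁻¹) (e ^ j) := by
          have : ρ (x ^ i)⁻¹ = texp (p := p) (-((i : ZMod p) • e)) := by
            have hmod := pow_mod_orderOf x i
            rw [h.orderOf_x] at hmod
            rw [h.texp_neg_smul, ZMod.val_natCast, hmod]
          rw [this, texp]
          refine Commute.sum_left _ _ _ fun t _ => Commute.smul_left ?_ _
          exact ((((Commute.refl e).smul_left _).neg_left).pow_pow t j)
        rw [conjRep_apply, hcomm.eq, mul_assoc, ← map_mul, mul_inv_cancel, map_one, mul_one]
      have hterm : ∀ i : ℕ, Φ (x ^ i * g) (e ^ j) = conjRep ρ (x ^ i) (Φ g (e ^ j)) := by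
        intro i
        simp only [Φ, Module.End.mul_apply]
        rw [_root_.mul_inv_rev, hmul, hmul, hxe]
      simp only [hterm]
      rw [← sum_zmod_val (p := p) (fun i => conjRep ρ (x ^ i) (Φ g (e ^ j)))]
      rw [← sum_texp_conj_eq_zero h.two_mul_eq h.jordan.pow_eq_zero (X := Φ g (e ^ j))]
      · refine Finset.sum_congr rfl fun s _ => ?_
        rw [h.texp_smul, h.texp_neg_smul, conjRep_apply]
      · apply h.pow_mul_mul_pow_eq_zero
        simp only [Φ, Module.End.mul_apply]
        rw [h.σ_conjRep, hφ'σ]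
    have hval : ∀ q : G, ∀ b : ℕ, q⁻¹ * x * q = x ^ b → ∀ j, conjRep ρ q⁻¹ (e ^ j) =
        ((b : ZMod p) ^ j) • e ^ j := by
      intro q b hb j
      rw [conjRep_pow, h.conjRep_of_conj_eq_pow (b := b) (by rw [inv_inv]; exact hb), smul_pow]
    refine ⟨(Nat.card (G ⧸ Subgroup.zpowers x) : ZMod p) * (2 * c), ?_, ?_, ?_⟩
    · exact mul_ne_zero (card_quotient_zpowers_cast_ne_zero h.orderOf_x h.card)
        (mul_ne_zero h.two_ne_zero hc0)
    · obtain ⟨S, hS, hfix, hSsum⟩ := hsum 2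
      rw [hSsum, ← hS]
      have : ∀ q ∈ S, Φ q.out (e ^ 2) = (2 * c) • e ^ 2 := by
        intro q hq
        obtain ⟨b, hb⟩ := hfix q hq
        have h1 := hval _ b hb 2
        have h2 := congrArg (conjRep ρ q.out) h1
        rw [← hmul, mul_inv_cancel, hone, map_smul] at h2
        simp only [Φ, Module.End.mul_apply]
        rw [h1, map_smul, hφ'2, smul_comm, map_smul, map_smul, ← h2]
      rw [Finset.sum_congr rfl this, Finset.sum_const, ← Nat.cast_smul_eq_nsmul (ZMod p), smul_smul]
    · intro j hjn hj2
      obtain ⟨S, hS, hfix, hSsum⟩ := hsum j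
      rw [hSsum]
      refine Finset.sum_eq_zero fun q hq => ?_
      obtain ⟨b, hb⟩ := hfix q hq
      simp only [Φ, Module.End.mul_apply]
      rw [hval _ b hb j, map_smul, hφ'j j hjn hj2, smul_zero, map_zero]

/-- A stable subspace containing `e ^ 2` in which the centraliser of `e` is one-dimensional. -/
theorem exists_square_submodule (h : IsUnipotentCore ρ n x e σ) [Finite G] :
    ∃ U : Submodule (ZMod p) (End (ZMod p) M), (∀ g, ∀ X ∈ U, conjRep ρ g X ∈ U) ∧ e ^ 2 ∈ U ∧
      ∀ y ∈ U, Commute y e → ∃ c : ZMod p, y = c • e ^ 2 := by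
  obtain ⟨f, hf, c, hc0, hc, hj⟩ := h.exists_transfer
  have hone : ∀ X, conjRep ρ 1 X = X := by intro X; rw [map_one]; rfl
  refine ⟨Submodule.span _ (Set.range fun g => conjRep ρ g (e ^ 2)), ?_, ?_, ?_⟩
  · intro g X hX
    have : Submodule.span (ZMod p) (Set.range fun g => conjRep ρ g (e ^ 2)) ≤
        (Submodule.span (ZMod p) (Set.range fun g => conjRep ρ g (e ^ 2))).comap (conjRep ρ g) := by
      rw [Submodule.span_le]
      rintro _ ⟨g', rfl⟩
      refine Submodule.subset_span ⟨g * g', ?_⟩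
      simp only [map_mul]; rfl
    exact this hX
  · exact Submodule.subset_span ⟨1, hone _⟩
  · intro y hy hcomm
    have hfy : f y = c • y := by
      have : Submodule.span (ZMod p) (Set.range fun g => conjRep ρ g (e ^ 2)) ≤
          LinearMap.ker (f - c • LinearMap.id) := by
        rw [Submodule.span_le]
        rintro _ ⟨g', rfl⟩
        rw [SetLike.mem_coe, LinearMap.mem_ker]
        simp [hf, hc]
      have h1 := this hy
      rw [LinearMap.mem_ker] at h1
      simpa [sub_eq_zero] using h1
    obtain ⟨d, rfl⟩ := h.jordan.exists_eq_of_commute hcomm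
    have h6 := h.six_le
    rw [map_sum, Finset.sum_eq_single 2] at hfy
    · refine ⟨d 2, ?_⟩
      rw [map_smul, hc, smul_comm] at hfy
      exact (smul_right_injective _ hc0 hfy).symm
    · intro j hjn hj2
      rw [map_smul, hj j (Finset.mem_range.1 hjn) hj2, smul_zero]
    · intro h; exact absurd (Finset.mem_range.2 (by omega)) h

end IsUnipotentCore

theorem exists_pow_apply_eq_of_ker {k V : Type*} [Field k] [AddCommGroup V] [Module k V]
    (D : Module.End k V) {N : ℕ} (hN : D ^ N = 0) (W : Submodule k V) (hW : ∀ X ∈ W, D X ∈ W)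
    {a : V} (ha : ∀ y ∈ W, D y = 0 → ∃ c : k, y = c • a) {i : ℕ} {z : V} (hz : z ∈ W)
    (hzi : (D ^ i) z ≠ 0) : ∃ ξ ∈ W, (D ^ i) ξ = a := by
  classical
  have hWp : ∀ j, ∀ X ∈ W, (D ^ j) X ∈ W := by
    intro j
    induction j with
    | zero => intro X hX; simpa using hX
    | succ j ih => intro X hX; rw [pow_succ', Module.End.mul_apply]; exact hW _ (ih X hX)
  have hex : ∃ j, (D ^ j) z = 0 := ⟨N, by rw [hN]; rfl⟩
  have hi : i < Nat.find hex := by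
    by_contra! hle
    apply hzi
    rw [← Nat.sub_add_cancel hle, pow_add, Module.End.mul_apply, Nat.find_spec hex, map_zero]
  obtain ⟨t, ht⟩ : ∃ t, Nat.find hex = i + t + 1 := ⟨Nat.find hex - i - 1, by omega⟩
  have h0 : (D ^ (i + t)) z ≠ 0 := Nat.find_min hex (by omega)
  have h1 : D ((D ^ (i + t)) z) = 0 := by
    rw [← Module.End.mul_apply, ← pow_succ', ← ht]
    exact Nat.find_spec hex
  obtain ⟨c, hc⟩ := ha _ (hWp _ _ hz) h1
  have hc0 : c ≠ 0 := fun h => h0 (by rw [hc, h, zero_smul])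
  refine ⟨c⁻¹ • (D ^ t) z, W.smul_mem _ (hWp _ _ hz), ?_⟩
  rw [map_smul, ← Module.End.mul_apply, ← pow_add, hc, smul_smul, inv_mul_cancel₀ hc0, one_smul]

namespace IsUnipotentCore

open Module

variable {p : ℕ} [hp : Fact p.Prime] {G M : Type*} [Group G] [AddCommGroup M]
    [Module (ZMod p) M] {ρ : Representation (ZMod p) G M} {n : ℕ} {x : G}
    {e : Module.End (ZMod p) M} {σ : Module.End (ZMod p) M →ₗ[ZMod p] Module.End (ZMod p) M}

theorem rep_apply_inv_apply (g : G) (m : M) : ρ g (ρ g⁻¹ m) = m := by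
  rw [← Module.End.mul_apply, ← map_mul, mul_inv_cancel, map_one]; rfl

theorem rep_inv_apply_apply (g : G) (m : M) : ρ g⁻¹ (ρ g m) = m := by
  rw [← Module.End.mul_apply, ← map_mul, inv_mul_cancel, map_one]; rfl

theorem exists_conjRep_pow_ne (h : IsUnipotentCore ρ n x e σ) {j : ℕ} (hj0 : 0 < j) (hj : j < n) :
    ∃ g, ∀ c : ZMod p, conjRep ρ g (e ^ j) ≠ c • e ^ j := by
  by_contra! hall
  rcases h.irreducible (LinearMap.ker (e ^ j)) (by
    intro g m hm
    rw [LinearMap.mem_ker] at hm ⊢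
    obtain ⟨c, hc⟩ := hall g⁻¹
    have := LinearMap.congr_fun hc m
    rw [conjRep_apply, inv_inv, LinearMap.smul_apply, hm, smul_zero, Module.End.mul_apply,
      Module.End.mul_apply] at this
    have h2 := congrArg (ρ g) this
    rwa [rep_apply_inv_apply, map_zero] at h2) with hbot | htop
  · obtain ⟨v, hv⟩ := h.jordan.exists_cyclic
    apply hv
    rw [← Submodule.mem_bot (ZMod p), ← hbot, LinearMap.mem_ker, ← Module.End.mul_apply, ← pow_add,
      h.jordan.pow_apply_eq_zero (by omega)]
  · exact h.jordan.pow_ne_zero hj (LinearMap.ker_eq_top.1 htop)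

theorem adOp_pow_prime (h : IsUnipotentCore ρ n x e σ) : adOp p e ^ p = 0 :=
  _root_.adOp_pow_prime h.two_mul_eq h.jordan.pow_eq_zero

theorem trace_mul_adOp (X Y : End (ZMod p) M) :
    LinearMap.trace (ZMod p) M (X * adOp p e Y) =
      -LinearMap.trace (ZMod p) M (adOp p e X * Y) := by
  simp only [adOp_apply, mul_sub, sub_mul, map_sub]
  have := LinearMap.trace_mul_comm (ZMod p) (X * Y) e
  simp only [mul_assoc] at this ⊢
  rw [this]; ring

theorem conjRep_commutator (g : G) (X Y : End (ZMod p) M) :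
    conjRep ρ g (X * Y - Y * X) =
      conjRep ρ g X * conjRep ρ g Y - conjRep ρ g Y * conjRep ρ g X := by
  rw [map_sub, conjRep_mul, conjRep_mul]

/-- Powers `e ^ (n - 1)` cannot normalise the subspace generated by `e ^ 2`. -/
theorem not_pow_pred_normalizes (h : IsUnipotentCore ρ n x e σ)
    {U : Submodule (ZMod p) (End (ZMod p) M)} (hU : ∀ g, ∀ X ∈ U, conjRep ρ g X ∈ U)
    (hU2 : e ^ 2 ∈ U) (hUe : ∀ y ∈ U, Commute y e → ∃ c : ZMod p, y = c • e ^ 2) :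
    ¬ ∀ z ∈ U, e ^ (n - 1) * z - z * e ^ (n - 1) ∈ U := by
  intro hnorm
  have h6 := h.six_le
  have en : e ^ (n - 1) * e = 0 := by
    rw [← pow_succ, show n - 1 + 1 = n by omega, h.jordan.pow_eq_zero]
  have en' : e * e ^ (n - 1) = 0 := by
    rw [← pow_succ', show n - 1 + 1 = n by omega, h.jordan.pow_eq_zero]
  have key : ∀ i, ∀ z ∈ U, (adOp p e ^ i) z = 0 → e ^ (n - 1) * z - z * e ^ (n - 1) = 0 := by
    intro i
    induction i with
    | zero =>
      intro z _ hz
      have : z = 0 := by simpa using hz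
      rw [this]; simp
    | succ i ih =>
      intro z hz hzi
      have hDz : adOp p e z ∈ U := by rw [adOp_apply]; exact h.adOp_mem hU hz
      have h1 := ih _ hDz (by rw [← Module.End.mul_apply, ← pow_succ]; exact hzi)
      obtain ⟨c, hc⟩ := hUe _ (hnorm z hz) (by
        rw [adOp_apply] at h1
        have h3 : e * (e ^ (n - 1) * z - z * e ^ (n - 1)) -
            (e ^ (n - 1) * z - z * e ^ (n - 1)) * e =
            (e ^ (n - 1) * (e * z - z * e) - (e * z - z * e) * e ^ (n - 1)) := by
          have h4 : e * (e ^ (n - 1) * z) = e ^ (n - 1) * (e * z) := by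
            rw [← mul_assoc, ← mul_assoc, en, en']
          have h5 : z * e ^ (n - 1) * e = z * e * e ^ (n - 1) := by
            rw [mul_assoc, mul_assoc, en, en']
          rw [mul_sub, sub_mul, h4, h5]
          noncomm_ring
        rw [h1] at h3
        exact (sub_eq_zero.1 h3).symm)
      have h2 := congrArg (fun X => e * X * e) hc
      have h3 : e * (e ^ (n - 1) * z - z * e ^ (n - 1)) * e = 0 := by
        rw [mul_sub, ← mul_assoc, en', sub_mul, zero_mul, zero_mul, ← mul_assoc, mul_assoc _ _ e, en,
          mul_zero, sub_zero]
      have h4 : e * (c • e ^ 2) * e = c • e ^ 4 := by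
        rw [mul_smul_comm, smul_mul_assoc, ← pow_succ', ← pow_succ]
      simp only [h3, h4] at h2
      rw [hc, (smul_eq_zero.1 h2.symm).resolve_right (h.jordan.pow_ne_zero (by omega)), zero_smul]
  obtain ⟨v, hv⟩ := h.jordan.exists_cyclic
  let W : Submodule (ZMod p) M :=
    { carrier := {m | ∀ g, (e ^ 2) (ρ g m) = 0}
      add_mem' := fun ha hb g => by rw [map_add, map_add, ha g, hb g, add_zero]
      zero_mem' := fun g => by rw [map_zero, map_zero]
      smul_mem' := fun c m hm g => by rw [map_smul, map_smul, hm g, smul_zero] }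
  have hw : (e ^ (n - 1)) v ∈ W := by
    intro g
    have hzU := hU g⁻¹ _ hU2
    have hcomm := key p _ hzU (by rw [h.adOp_pow_prime]; rfl)
    have hnil : conjRep ρ g⁻¹ (e ^ 2) ^ n = 0 := by
      rw [← conjRep_pow, ← pow_mul, pow_eq_zero_of_le (by omega) h.jordan.pow_eq_zero, map_zero]
    set z := conjRep ρ g⁻¹ (e ^ 2) with hz
    have h1 : e (z ((e ^ (n - 1)) v)) = 0 := by
      rw [← Module.End.mul_apply z, ← sub_eq_zero.1 hcomm, ← Module.End.mul_apply, ← mul_assoc, en',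
        zero_mul, LinearMap.zero_apply]
    obtain ⟨c, hc⟩ := h.jordan.exists_smul_of_apply_eq_zero hv h1
    have h2 : ∀ i, (z ^ i) ((e ^ (n - 1)) v) = c ^ i • (e ^ (n - 1)) v := by
      intro i
      induction i with
      | zero => simp
      | succ i ih => rw [pow_succ', Module.End.mul_apply, ih, map_smul, hc, smul_smul, pow_succ]
    have h3 := h2 n
    rw [hnil, LinearMap.zero_apply] at h3
    have h4 : c = 0 := eq_zero_of_pow_eq_zero ((smul_eq_zero.1 h3.symm).resolve_right hv)
    rw [h4, zero_smul, hz, conjRep_apply, inv_inv, Module.End.mul_apply, Module.End.mul_apply] at hc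
    have h5 := congrArg (ρ g) hc
    rwa [rep_apply_inv_apply, map_zero] at h5
  rcases h.irreducible W (by
    intro g m hm g'
    rw [← Module.End.mul_apply (ρ g'), ← map_mul]
    exact hm _) with hbot | htop
  · rw [hbot, Submodule.mem_bot] at hw
    exact hv hw
  · refine h.jordan.pow_ne_zero (i := 2) (by omega) (LinearMap.ext fun m => ?_)
    have hm : m ∈ W := by rw [htop]; trivial
    have := hm 1
    rwa [map_one] at this

/-- A stable Lie algebra of skew operators in which the centraliser of `e` is one-dimensional. -/
theorem exists_lie (h : IsUnipotentCore ρ n x e σ) [Finite G] :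
    ∃ Λ : Submodule (ZMod p) (End (ZMod p) M), (∀ g, ∀ X ∈ Λ, conjRep ρ g X ∈ Λ) ∧ e ∈ Λ ∧
      (∀ X ∈ Λ, ∀ Y ∈ Λ, X * Y - Y * X ∈ Λ) ∧
      ∀ y ∈ Λ, Commute y e → ∃ c : ZMod p, y = c • e := by
  obtain ⟨U, hU, hU2, hUe⟩ := h.exists_square_submodule
  have h6 := h.six_le
  let Λ : Submodule (ZMod p) (End (ZMod p) M) :=
    { carrier := {X | σ X = -X ∧ ∀ z ∈ U, X * z - z * X ∈ U}
      add_mem' := fun {a b} ha hb => ⟨by rw [map_add, ha.1, hb.1, neg_add], fun z hz => by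
        have := U.add_mem (ha.2 z hz) (hb.2 z hz)
        convert this using 1
        noncomm_ring⟩
      zero_mem' := ⟨by simp, fun z _ => by simp⟩
      smul_mem' := fun c a ha => ⟨by rw [map_smul, ha.1, smul_neg], fun z hz => by
        rw [smul_mul_assoc, mul_smul_comm, ← smul_sub]
        exact U.smul_mem c (ha.2 z hz)⟩ }
  have hmem : ∀ X, X ∈ Λ ↔ σ X = -X ∧ ∀ z ∈ U, X * z - z * X ∈ U := fun X => Iff.rfl
  have heΛ : e ∈ Λ := ⟨h.σ_e, fun z hz => h.adOp_mem hU hz⟩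
  refine ⟨Λ, ?_, heΛ, ?_, ?_⟩
  · intro g X hX
    rw [hmem] at hX ⊢
    refine ⟨by rw [h.σ_conjRep, hX.1, map_neg], fun z hz => ?_⟩
    have h1 := hU g _ (hX.2 _ (hU g⁻¹ z hz))
    rw [conjRep_commutator, ← Module.End.mul_apply (conjRep ρ g) (conjRep ρ g⁻¹), ← map_mul,
      mul_inv_cancel, map_one] at h1
    exact h1
  · intro X hX Y hY
    rw [hmem] at hX hY ⊢
    refine ⟨?_, fun z hz => ?_⟩
    · rw [map_sub, h.σ_mul, h.σ_mul, hX.1, hY.1]; noncomm_ring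
    · have h1 := U.sub_mem (hX.2 _ (hY.2 z hz)) (hY.2 _ (hX.2 z hz))
      convert h1 using 1
      noncomm_ring
  · intro y hy hcomm
    have hyΛ := hy
    rw [hmem] at hy
    obtain ⟨c, hc⟩ := h.jordan.exists_eq_of_commute hcomm
    have heven : ∀ j < n, Even j → c j = 0 := by
      intro j hj hje
      have h1 : ∑ i ∈ Finset.range n, (c i * ((-1) ^ i + 1)) • e ^ i = 0 := by
        have h2 := eq_neg_iff_add_eq_zero.1 hy.1
        rw [hc, map_sum, ← Finset.sum_add_distrib] at h2
        rw [← h2]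
        refine Finset.sum_congr rfl fun i _ => ?_
        rw [map_smul, h.σ_pow, mul_add, mul_one, add_smul, mul_smul]
        congr 2
        rcases Nat.even_or_odd i with hi | hi
        · simp [hi.neg_one_pow]
        · simp [hi.neg_one_pow]
      have h3 := h.jordan.sum_pow_eq_zero h1 hj
      rw [hje.neg_one_pow, one_add_one_eq_two] at h3
      exact (mul_eq_zero.1 h3).resolve_right h.two_ne_zero
    obtain ⟨z, hz, hz1⟩ : ∃ z ∈ U, e * z - z * e = e ^ 2 := by
      obtain ⟨g, hg⟩ := h.exists_conjRep_pow_ne (j := 2) (by norm_num) (by omega)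
      have hker : ∀ y ∈ U, adOp p e y = 0 → ∃ c : ZMod p, y = c • e ^ 2 := by
        intro y hy h0
        rw [adOp_apply] at h0
        exact hUe y hy (sub_eq_zero.1 h0).symm
      obtain ⟨ξ, hξ, hξ1⟩ := exists_pow_apply_eq_of_ker (adOp p e) h.adOp_pow_prime U
        (fun X hX => by rw [adOp_apply]; exact h.adOp_mem hU hX) hker (i := 1) (hU g _ hU2) (by
          rw [pow_one]
          intro h0
          obtain ⟨c, hc⟩ := hker _ (hU g _ hU2) h0
          exact hg c hc)
      exact ⟨ξ, hξ, by rw [← hξ1, pow_one, adOp_apply]⟩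
    have hej : ∀ j : ℕ, e ^ j * z - z * e ^ j = (j : ZMod p) • e ^ (j + 1) := by
      intro j
      induction j with
      | zero => simp
      | succ j ih =>
        have : e ^ (j + 1) * z - z * e ^ (j + 1) =
            e ^ j * (e * z - z * e) + (e ^ j * z - z * e ^ j) * e := by
          rw [pow_succ]; noncomm_ring
        rw [this, hz1, ih, ← pow_add, smul_mul_assoc, ← pow_succ]
        push_cast
        rw [add_smul, one_smul, add_comm]
    have hbr : y * z - z * y = ∑ j ∈ Finset.range n, (c j * j) • e ^ (j + 1) := by
      rw [hc, Finset.sum_mul, Finset.mul_sum, ← Finset.sum_sub_distrib]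
      refine Finset.sum_congr rfl fun j _ => ?_
      rw [smul_mul_assoc, mul_smul_comm, ← smul_sub, hej, smul_smul]
    obtain ⟨d, hd⟩ := hUe _ (hy.2 z hz) (by
      rw [hbr]
      exact Commute.sum_left _ _ _ fun i _ => ((Commute.refl e).pow_left _).smul_left _)
    have hmid : ∀ j, 2 ≤ j → j + 1 < n → c j = 0 := by
      intro j hj2 hjn
      have h1 : ∑ i ∈ Finset.range n, (if i = 0 then 0 else
          c (i - 1) * ((i - 1 : ℕ) : ZMod p) - if i = 2 then d else 0) • e ^ i = 0 := by
        obtain ⟨N, rfl⟩ : ∃ N, n = N + 1 := ⟨n - 1, by omega⟩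
        rw [Finset.sum_range_succ']
        simp only [Nat.add_sub_cancel, Nat.add_eq_zero_iff, one_ne_zero, and_false, if_false,
          if_true, zero_smul, add_zero, sub_smul, Finset.sum_sub_distrib, ite_smul]
        rw [sub_eq_zero]
        have h2 := hbr.symm.trans hd
        rw [Finset.sum_range_succ, h.jordan.pow_eq_zero, smul_zero, add_zero] at h2
        rw [h2, Finset.sum_eq_single 1]
        · simp
        · intro i _ hi
          rw [if_neg (by omega)]
        · intro hh; exact absurd (Finset.mem_range.2 (by omega)) hh
      have h3 := h.jordan.sum_pow_eq_zero h1 hjn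
      simp only [Nat.add_sub_cancel, Nat.add_eq_zero_iff, one_ne_zero, and_false, if_false,
        show j + 1 ≠ 2 by omega, sub_zero] at h3
      exact (mul_eq_zero.1 h3).resolve_right
        (ZMod.natCast_ne_zero_of_lt (by omega) (by have := h.le_p; omega))
    have hy' : y = c 1 • e + c (n - 1) • e ^ (n - 1) := by
      rw [hc, ← Finset.sum_subset (s₁ := {1, n - 1})]
      · rw [Finset.sum_pair (by omega), pow_one]
      · intro i hi
        simp only [Finset.mem_insert, Finset.mem_singleton] at hi
        rw [Finset.mem_range]; omega
      · intro i hi hi'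
        simp only [Finset.mem_insert, Finset.mem_singleton, not_or] at hi'
        rw [Finset.mem_range] at hi
        have : c i = 0 := by
          rcases Nat.eq_zero_or_pos i with rfl | h0
          · exact heven 0 hi (by simp)
          · exact hmid i (by omega) (by omega)
        rw [this, zero_smul]
    have hlast : c (n - 1) = 0 := by
      by_contra hne
      apply h.not_pow_pred_normalizes hU hU2 hUe
      have h1 : e ^ (n - 1) ∈ Λ := by
        have h2 := Λ.smul_mem (c (n - 1))⁻¹ (Λ.sub_mem hyΛ (Λ.smul_mem (c 1) heΛ))
        rw [hy', add_sub_cancel_left, smul_smul, inv_mul_cancel₀ hne, one_smul] at h2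
        exact h2
      exact ((hmem _).1 h1).2
    exact ⟨c 1, by rw [hy', hlast, zero_smul, add_zero]⟩

end IsUnipotentCore

namespace IsUnipotentCore

open Module

variable {p : ℕ} [hp : Fact p.Prime] {G M : Type*} [Group G] [AddCommGroup M]
    [Module (ZMod p) M] {ρ : Representation (ZMod p) G M} {n : ℕ} {x : G}
    {e : Module.End (ZMod p) M} {σ : Module.End (ZMod p) M →ₗ[ZMod p] Module.End (ZMod p) M}

theorem natCast_n_ne_zero (h : IsUnipotentCore ρ n x e σ) : (n : ZMod p) ≠ 0 :=
  ZMod.natCast_ne_zero_of_lt (by have := h.six_le; omega)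
    (by have := h.two_mul_eq; have := h.six_le; omega)

theorem apply_eq_zero_of_commute (h : IsUnipotentCore ρ n x e σ) {q : End (ZMod p) M}
    (hq : Commute q e) (htr : LinearMap.trace (ZMod p) M q = 0) {m : M} (hm : e m = 0) :
    q m = 0 := by
  have := h.jordan.finiteDimensional
  obtain ⟨c, rfl⟩ := h.jordan.exists_eq_of_commute hq
  obtain ⟨N, hN⟩ : ∃ N, n = N + 1 := ⟨n - 1, by have := h.six_le; omega⟩
  have hc : c 0 = 0 := by
    rw [map_sum, hN, Finset.sum_range_succ', Finset.sum_eq_zero, zero_add, map_smul, pow_zero,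
      LinearMap.trace_one, h.jordan.finrank_eq, smul_eq_mul] at htr
    · exact (mul_eq_zero.1 htr).resolve_right h.natCast_n_ne_zero
    · intro i _
      rw [map_smul, (LinearMap.isNilpotent_trace_of_isNilpotent
        (⟨n, by rw [← pow_mul, pow_eq_zero_of_le (by nlinarith) h.jordan.pow_eq_zero]⟩ :
          IsNilpotent (e ^ (i + 1)))).eq_zero, smul_zero]
  rw [LinearMap.sum_apply, hN, Finset.sum_range_succ', hc, Finset.sum_eq_zero, zero_smul, zero_add,
    LinearMap.zero_apply]
  intro i _
  rw [LinearMap.smul_apply, pow_succ, Module.End.mul_apply, hm, map_zero, smul_zero]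

/-- The three-dimensional stable Lie algebra through `e` is spanned by an `sl₂`-triple. -/
theorem exists_triple (h : IsUnipotentCore ρ n x e σ) [Finite G] :
    ∃ f H : End (ZMod p) M, e * f - f * e = H ∧ H * e - e * H = (2 : ZMod p) • e ∧
      H * f - f * H = -(2 : ZMod p) • f ∧ (∀ m, e m = 0 → H m = ((n : ZMod p) - 1) • m) ∧
      LinearMap.trace (ZMod p) M (f * e) ≠ 0 ∧
      (∀ g, ∃ α β γ : ZMod p, conjRep ρ g e = α • e + β • H + γ • f) ∧
      (∀ g, ∃ α β γ : ZMod p, conjRep ρ g f = α • e + β • H + γ • f) := by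
  obtain ⟨Λ, hΛ, heΛ, hbr, hcen⟩ := h.exists_lie
  obtain ⟨f₀, h₀, t1, t2, t3, t4, t5, -⟩ := h.jordan.exists_lowering
  have h2 := h.two_ne_zero
  have h22 : (4 : ZMod p) ≠ 0 := by
    intro h4; exact mul_ne_zero h2 h2 (by linear_combination h4)
  set D := adOp p e with hD
  have De : D e = 0 := by simp [hD]
  have D1 : D f₀ = h₀ := by rw [hD, adOp_apply, t1]
  have D2 : D h₀ = -(2 : ZMod p) • e := by rw [hD, adOp_apply, t2]
  have hDΛ : ∀ X ∈ Λ, D X ∈ Λ := fun X hX => by rw [hD, adOp_apply]; exact h.adOp_mem hΛ hX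
  have hker : ∀ y ∈ Λ, D y = 0 → ∃ c : ZMod p, y = c • e := by
    intro y hy h0
    rw [hD, adOp_apply] at h0
    exact hcen y hy (sub_eq_zero.1 h0).symm
  have htr0 : LinearMap.trace (ZMod p) M (f₀ * e) ≠ 0 := by
    rw [t5]; exact sum_weights_ne_zero h.eleven_le h.two_mul_eq
  have hT : ∀ X Y, LinearMap.trace (ZMod p) M (X * D Y) = -LinearMap.trace (ZMod p) M (D X * Y) :=
    trace_mul_adOp
  have hD3 : ∀ z ∈ Λ, D (D (D z)) = 0 := by
    intro z hz
    by_contra hne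
    obtain ⟨ξ, -, hξ⟩ := exists_pow_apply_eq_of_ker D h.adOp_pow_prime Λ hDΛ hker (i := 3) hz
      (by simpa [pow_succ] using hne)
    apply htr0
    have hξ' : D (D (D ξ)) = e := by simpa [pow_succ] using hξ
    rw [← hξ', hT, hT, hT, D1, D2, map_smul, De]
    simp
  obtain ⟨g₀, hg₀⟩ := h.exists_conjRep_pow_ne (j := 1) (by norm_num) (by have := h.six_le; omega)
  rw [pow_one] at hg₀
  have hD2 : ∃ z ∈ Λ, D (D z) ≠ 0 := by
    by_contra! hall
    obtain ⟨z, hz, hzi⟩ := exists_pow_apply_eq_of_ker D h.adOp_pow_prime Λ hDΛ hker (i := 1)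
      (hΛ g₀ _ heΛ) (by
        rw [pow_one]
        intro h0
        obtain ⟨c, hc⟩ := hker _ (hΛ g₀ _ heΛ) h0
        exact hg₀ c hc)
    rw [pow_one] at hzi
    have hspan : ∀ X ∈ Λ, ∃ c d : ZMod p, X = c • z + d • e := by
      intro X hX
      obtain ⟨c, hc⟩ := hker _ (hDΛ X hX) (hall X hX)
      obtain ⟨d, hd⟩ := hker _ (Λ.sub_mem hX (Λ.smul_mem c hz)) (by
        rw [map_sub, map_smul, hzi, hc, sub_self])
      exact ⟨c, d, by rw [← hd]; abel⟩
    have hze : e * z - z * e = e := by rw [← adOp_apply (p := p)]; exact hzi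
    obtain ⟨a, b, hab⟩ := hspan _ (hΛ g₀ _ heΛ)
    obtain ⟨a', b', hab'⟩ := hspan _ (hΛ g₀ _ hz)
    apply hg₀ (b * a' - a * b')
    have h1 := conjRep_commutator (ρ := ρ) g₀ e z
    rw [hze] at h1
    rw [h1, hab, hab']
    have h3 : (a • z + b • e) * (a' • z + b' • e) - (a' • z + b' • e) * (a • z + b • e) =
        (b * a' - a * b') • (e * z - z * e) := by
      simp only [add_mul, mul_add, smul_mul_assoc, mul_smul_comm]
      module
    rw [h3, hze]
  obtain ⟨z, hz, hz2⟩ := hD2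
  obtain ⟨ξ, hξ, hξ2⟩ := exists_pow_apply_eq_of_ker D h.adOp_pow_prime Λ hDΛ hker (i := 2) hz
    (by simpa [pow_succ] using hz2)
  replace hξ2 : D (D ξ) = e := by simpa [pow_succ] using hξ2
  have hspan : ∀ X ∈ Λ, ∃ c d b : ZMod p, X = c • ξ + d • D ξ + b • e := by
    intro X hX
    obtain ⟨c, hc⟩ := hker _ (hDΛ _ (hDΛ X hX)) (hD3 X hX)
    obtain ⟨d, hd⟩ := hker _ (hDΛ _ (Λ.sub_mem hX (Λ.smul_mem c hξ))) (by
      rw [map_sub, map_smul, map_sub, map_smul, hξ2, hc, sub_self])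
    obtain ⟨b, hb⟩ := hker (X - c • ξ - d • D ξ)
      (Λ.sub_mem (Λ.sub_mem hX (Λ.smul_mem c hξ)) (Λ.smul_mem d (hDΛ _ hξ))) (by
        rw [map_sub, hd, map_smul, hξ2, sub_self])
    exact ⟨c, d, b, by rw [← hb]; abel⟩
  set f' := -(2 : ZMod p) • ξ with hf'
  set H := D f' with hH
  have hf'Λ : f' ∈ Λ := Λ.smul_mem _ hξ
  have hHΛ : H ∈ Λ := hDΛ _ hf'Λ
  have hDH : D H = -(2 : ZMod p) • e := by rw [hH, hf', map_smul, map_smul, hξ2]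
  obtain ⟨α, hα⟩ := hker (H * f' - f' * H + (2 : ZMod p) • f')
    (Λ.add_mem (hbr _ hHΛ _ hf'Λ) (Λ.smul_mem _ hf'Λ)) (by
      have h3 : D (H * f' - f' * H) = -(2 : ZMod p) • D f' := by
        have h4 : e * f' - f' * e = H := by rw [← adOp_apply (p := p)]
        rw [map_sub, hD, adOp_mul, adOp_mul, ← hD, ← hH, hDH]
        conv_rhs => rw [← h4]
        simp only [smul_mul_assoc, mul_smul_comm]
        module
      rw [map_add, h3, ← hH, map_smul, ← hH, neg_smul, neg_add_cancel])
  have hHe : H * e - e * H = (2 : ZMod p) • e := by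
    rw [← neg_sub, ← adOp_apply (p := p), ← hD, hDH, neg_smul, neg_neg]
  set f := f' - (α / 4) • e with hf
  have hDf : D f = H := by rw [hf, map_sub, ← hH, map_smul, De, smul_zero, sub_zero]
  refine ⟨f, H, by rw [← hDf, hD, adOp_apply], hHe, ?_, ?_, ?_, ?_, ?_⟩
  · have h3 : H * f - f * H = (H * f' - f' * H + (2 : ZMod p) • f') - (2 : ZMod p) • f' -
        (α / 4) • (H * e - e * H) := by
      rw [hf]
      simp only [mul_sub, sub_mul, smul_mul_assoc, mul_smul_comm]
      module
    have h4 : α = α / 4 * 4 := by field_simp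
    rw [h3, hα, hHe, hf]
    nth_rw 1 [h4]
    module
  · intro m hm
    rw [← t4 m hm, ← sub_eq_zero, ← LinearMap.sub_apply]
    refine h.apply_eq_zero_of_commute ?_ ?_ hm
    · have h3 : D (H - h₀) = 0 := by rw [map_sub, hDH, D2, sub_self]
      rw [hD, adOp_apply] at h3
      exact (sub_eq_zero.1 h3).symm
    · rw [map_sub, ← hDf, ← t1, hD, adOp_apply, map_sub, map_sub, LinearMap.trace_mul_comm,
        sub_self, LinearMap.trace_mul_comm, sub_self, sub_self]
  · have h3 : LinearMap.trace (ZMod p) M (f * D (D f₀)) =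
        LinearMap.trace (ZMod p) M (D (D f) * f₀) := by rw [hT, hT, neg_neg]
    rw [D1, D2, hDf, hDH, mul_smul_comm, smul_mul_assoc, map_smul, map_smul] at h3
    rw [smul_right_injective _ (neg_ne_zero.2 h2) h3, LinearMap.trace_mul_comm]
    exact htr0
  all_goals
    have key : ∀ X ∈ Λ, ∃ α β γ : ZMod p, X = α • e + β • H + γ • f := by
      intro X hX
      obtain ⟨c, d, b, rfl⟩ := hspan X hX
      have h5 : ξ = (-(2 : ZMod p)⁻¹) • f' := by
        rw [hf', smul_smul, neg_mul_neg, inv_mul_cancel₀ h2, one_smul]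
      have h6 : D ξ = (-(2 : ZMod p)⁻¹) • H := by
        rw [hH, hf', map_smul, smul_smul, neg_mul_neg, inv_mul_cancel₀ h2, one_smul]
      refine ⟨b + c * (-(2 : ZMod p)⁻¹) * (α / 4), d * (-(2 : ZMod p)⁻¹),
        c * (-(2 : ZMod p)⁻¹), ?_⟩
      rw [h6, hf]
      nth_rw 1 [h5]
      module
    intro g
    apply key
    apply hΛ
  · exact heΛ
  · exact Λ.sub_mem hf'Λ (Λ.smul_mem _ heΛ)

end IsUnipotentCore

section WeightCurve

open Module

variable {p : ℕ} [hp : Fact p.Prime] {M : Type*} [AddCommGroup M] [Module (ZMod p) M] {n : ℕ}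

/-- The rational normal curve of highest weight vectors attached to a weight basis `z`. -/
def weightCurve (n : ℕ) (z : ℕ → M) (X Y : ZMod p) : M :=
  ∑ i ∈ Finset.range n, (X ^ (n - 1 - i) * Y ^ i) • z i

theorem pow_apply_of_succ {N : End (ZMod p) M} {z : ℕ → M}
    (hN : ∀ i, N (z i) = ((i : ZMod p) + 1) • z (i + 1)) (i j : ℕ) :
    (N ^ j) (z i) = ((j.factorial : ZMod p) * ((i + j).choose i : ZMod p)) • z (i + j) := by
  induction j with
  | zero => simp
  | succ j ih =>
    rw [pow_succ', Module.End.mul_apply, ih, map_smul, hN, smul_smul, ← add_assoc]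
    congr 1
    have h1 := Nat.add_choose_mul_factorial_mul_factorial i j
    have h2 := Nat.add_choose_mul_factorial_mul_factorial i (j + 1)
    have h3 : (j.factorial * (i + j).choose i) * (i + j + 1) =
        (j + 1).factorial * (i + (j + 1)).choose i := by
      have h4 : (i + (j + 1)).factorial = (i + j + 1) * (i + j).factorial := by
        rw [← add_assoc, Nat.factorial_succ]
      have h5 := Nat.factorial_pos i
      refine Nat.eq_of_mul_eq_mul_right h5 ?_
      rw [← Nat.choose_symm_add] at h1
      rw [h4, ← h1] at h2
      rw [← Nat.choose_symm_add] at h2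
      linarith [h2]
    rw [← add_assoc] at h3
    exact_mod_cast congrArg (Nat.cast : ℕ → ZMod p) h3

theorem texp_smul_apply_of_succ {N : End (ZMod p) M} {z : ℕ → M} (hn : n ≤ p)
    (hN : ∀ i, N (z i) = ((i : ZMod p) + 1) • z (i + 1)) (hz : ∀ i, n ≤ i → z i = 0) (c : ZMod p)
    (i : ℕ) : texp (p := p) (c • N) (z i) =
      ∑ m ∈ Finset.range n, ((m.choose i : ZMod p) * c ^ (m - i)) • z m := by
  have h1 : texp (p := p) (c • N) (z i) =
      ∑ j ∈ Finset.range p, (((i + j).choose i : ZMod p) * c ^ j) • z (i + j) := by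
    rw [texp, LinearMap.sum_apply]
    refine Finset.sum_congr rfl fun j hj => ?_
    rw [LinearMap.smul_apply, smul_pow, LinearMap.smul_apply, pow_apply_of_succ hN, smul_smul,
      smul_smul]
    congr 1
    have := factorial_cast_ne_zero (p := p) (Finset.mem_range.1 hj)
    field_simp
  have h2 : ∑ m ∈ Finset.range n, ((m.choose i : ZMod p) * c ^ (m - i)) • z m =
      ∑ m ∈ Finset.range (i + p), ((m.choose i : ZMod p) * c ^ (m - i)) • z m := by
    refine Finset.sum_subset (Finset.range_mono (by omega)) fun m _ hm => ?_
    rw [hz m (by simpa using hm), smul_zero]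
  have h3 : ∑ m ∈ Finset.range i, ((m.choose i : ZMod p) * c ^ (m - i)) • z m = 0 := by
    refine Finset.sum_eq_zero fun m hm => ?_
    rw [Nat.choose_eq_zero_of_lt (Finset.mem_range.1 hm)]; simp
  rw [h1, h2, Finset.sum_range_add, h3, zero_add]
  refine Finset.sum_congr rfl fun j _ => ?_
  rw [Nat.add_sub_cancel_left]

theorem texp_smul_weightCurve {N : End (ZMod p) M} {z : ℕ → M} (hn : n ≤ p)
    (hN : ∀ i, N (z i) = ((i : ZMod p) + 1) • z (i + 1)) (hz : ∀ i, n ≤ i → z i = 0)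
    (c X Y : ZMod p) :
    texp (p := p) (c • N) (weightCurve n z X Y) = weightCurve n z X (Y + c * X) := by
  rw [weightCurve, map_sum]
  simp only [map_smul, texp_smul_apply_of_succ hn hN hz, Finset.smul_sum, smul_smul]
  rw [Finset.sum_comm, weightCurve]
  refine Finset.sum_congr rfl fun m hm => ?_
  rw [← Finset.sum_smul, add_pow, Finset.mul_sum]
  congr 1
  rw [Finset.mem_range] at hm
  symm
  refine Finset.sum_subset_zero_on_sdiff (Finset.range_mono (by omega)) ?_ ?_
  · intro i hi
    simp only [Finset.mem_sdiff, Finset.mem_range] at hi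
    rw [Nat.choose_eq_zero_of_lt (by omega)]; simp
  · intro i hi
    rw [Finset.mem_range] at hi
    rw [mul_pow, show n - 1 - i = (n - 1 - m) + (m - i) by omega, pow_add]
    ring

theorem weightCurve_reflect (z : ℕ → M) (X Y : ZMod p) :
    weightCurve n (fun j => if j < n then z (n - 1 - j) else 0) Y X = weightCurve n z X Y := by
  rw [weightCurve, weightCurve, ← Finset.sum_range_reflect]
  refine Finset.sum_congr rfl fun i hi => ?_
  rw [Finset.mem_range] at hi
  rw [if_pos (by omega), show n - 1 - (n - 1 - i) = i by omega, mul_comm]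

theorem texp_smul_weightCurve_left {N : End (ZMod p) M} {z : ℕ → M} (hn : n ≤ p)
    (h0 : N (z 0) = 0) (hN : ∀ i, N (z (i + 1)) = ((n : ZMod p) - 1 - i) • z i) (c X Y : ZMod p) :
    texp (p := p) (c • N) (weightCurve n z X Y) = weightCurve n z (X + c * Y) Y := by
  rw [← weightCurve_reflect z X Y, texp_smul_weightCurve hn _ _, weightCurve_reflect]
  · intro i
    by_cases h1 : i + 1 < n
    · rw [if_pos (by omega), if_pos h1, show n - 1 - i = (n - 1 - (i + 1)) + 1 by omega, hN]
      congr 1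
      rw [show n - 1 - (i + 1) = n - (i + 2) by omega, Nat.cast_sub (by omega)]
      push_cast; ring
    · rw [if_neg h1, smul_zero]
      by_cases h2 : i < n
      · rw [if_pos h2, show n - 1 - i = 0 by omega, h0]
      · rw [if_neg h2, map_zero]
  · intro i hi
    rw [if_neg (by omega)]

theorem weightCurve_one_zero (hn : 0 < n) (z : ℕ → M) :
    weightCurve n z (1 : ZMod p) 0 = z 0 := by
  rw [weightCurve, Finset.sum_eq_single 0]
  · simp
  · intro i _ hi; simp [hi]
  · intro h; exact absurd (Finset.mem_range.2 hn) h

theorem weightCurve_zero_one (hn : 0 < n) (z : ℕ → M) :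
    weightCurve n z (0 : ZMod p) 1 = z (n - 1) := by
  rw [weightCurve, Finset.sum_eq_single (n - 1)]
  · simp
  · intro i hi hi'
    rw [Finset.mem_range] at hi
    rw [zero_pow (by omega)]; simp
  · intro h; exact absurd (Finset.mem_range.2 (by omega)) h

theorem weightCurve_coeff {z : ℕ → M} (hz : LinearIndependent (ZMod p) fun i : Fin n => z i)
    {X Y X' Y' : ZMod p} (h : weightCurve n z X Y = weightCurve n z X' Y') {i : ℕ} (hi : i < n) :
    X ^ (n - 1 - i) * Y ^ i = X' ^ (n - 1 - i) * Y' ^ i := by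
  rw [weightCurve, weightCurve, ← Fin.sum_univ_eq_sum_range
    (fun i => (X ^ (n - 1 - i) * Y ^ i) • z i), ← Fin.sum_univ_eq_sum_range
    (fun i => (X' ^ (n - 1 - i) * Y' ^ i) • z i)] at h
  exact congrFun (linearIndependent_iff_injective_fintypeLinearCombination.1 hz
    (a₁ := fun i : Fin n => X ^ (n - 1 - (i : ℕ)) * Y ^ (i : ℕ))
    (a₂ := fun i : Fin n => X' ^ (n - 1 - (i : ℕ)) * Y' ^ (i : ℕ)) h) ⟨i, hi⟩

theorem eq_one_of_weightCurve {z : ℕ → M} (hn : 4 ≤ n) (heven : Even n)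
    (hz : LinearIndependent (ZMod p) fun i : Fin n => z i)
    {s : Matrix.SpecialLinearGroup (Fin 2) (ZMod p)}
    (h : ∀ X Y, weightCurve n z X Y =
      weightCurve n z (s 0 0 * X + s 0 1 * Y) (s 1 0 * X + s 1 1 * Y)) : s = 1 := by
  have h1 := fun i (hi : i < n) => weightCurve_coeff hz (h 1 0) hi
  have h2 := fun i (hi : i < n) => weightCurve_coeff hz (h 0 1) hi
  have h3 := fun i (hi : i < n) => weightCurve_coeff hz (h 1 1) hi
  simp only [mul_one, mul_zero, add_zero, zero_add] at h1 h2 h3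
  have a1 := h1 0 (by omega)
  have a2 := h1 1 (by omega)
  have b1 := h2 (n - 1) (by omega)
  have b2 := h2 (n - 2) (by omega)
  simp only [Nat.sub_zero, one_pow, pow_zero, mul_one, pow_one, mul_zero, Nat.sub_self,
    one_mul] at a1 a2 b1 b2
  rw [show n - 1 - (n - 2) = 1 by omega, pow_one, pow_one] at b2
  have ha0 : s 0 0 ≠ 0 := by
    intro h0; rw [h0, zero_pow (by omega)] at a1; exact one_ne_zero a1
  have hd0 : s 1 1 ≠ 0 := by
    intro h0; rw [h0, zero_pow (by omega)] at b1; exact one_ne_zero b1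
  have hc : s 1 0 = 0 := (mul_eq_zero.1 a2.symm).resolve_left (pow_ne_zero _ ha0)
  have hb : s 0 1 = 0 := (mul_eq_zero.1 b2.symm).resolve_right (pow_ne_zero _ hd0)
  have c1 := h3 1 (by omega)
  rw [hc, hb, zero_add, add_zero, one_pow, one_pow, pow_one, one_mul] at c1
  have hdet := s.det_coe
  rw [Matrix.det_fin_two, hb, zero_mul, sub_zero] at hdet
  have hn1 : s 0 0 ^ (n - 1) = s 0 0 ^ (n - 1 - 1) * s 0 0 := by
    rw [← pow_succ]; congr 1; omega
  have hda : s 1 1 = s 0 0 := by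
    apply mul_left_cancel₀ (pow_ne_zero (n - 1 - 1) ha0)
    rw [← hn1, ← c1, ← a1]
  have ha1 : s 0 0 = 1 := by
    obtain ⟨m, hm⟩ := heven
    rw [hda] at hdet
    have h5 : s 0 0 ^ (n - 1) = (s 0 0 * s 0 0) ^ (m - 1) * s 0 0 := by
      rw [← pow_two, ← pow_mul, ← pow_succ]; congr 1; omega
    rw [hdet, one_pow, one_mul] at h5
    rw [← h5, ← a1]
  ext i j
  fin_cases i <;> fin_cases j
  · simpa using ha1
  · simpa using hb
  · simpa using hc
  · simpa [hda] using ha1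

end WeightCurve

open Module in
/-- An `sl₂`-triple acting on an `n`-dimensional space with `e` a single Jordan block. -/
structure IsWeightTriple {p : ℕ} [Fact p.Prime] {M : Type*} [AddCommGroup M] [Module (ZMod p) M]
    (n : ℕ) (e f H : End (ZMod p) M) : Prop where
  six_le : 6 ≤ n
  two_mul_eq : 2 * n = p + 1
  jordan : IsJordanBlock n e
  ef : e * f - f * e = H
  He : H * e - e * H = (2 : ZMod p) • e
  Hf : H * f - f * H = -(2 : ZMod p) • f
  weight : ∀ m, e m = 0 → H m = ((n : ZMod p) - 1) • m
  trace_ne : LinearMap.trace (ZMod p) M (f * e) ≠ 0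

namespace IsWeightTriple

open Module

variable {p : ℕ} [hp : Fact p.Prime] {M : Type*} [AddCommGroup M] [Module (ZMod p) M] {n : ℕ}
  {e f H : End (ZMod p) M}

theorem two_ne_zero (t : IsWeightTriple n e f H) : (2 : ZMod p) ≠ 0 := by
  have := ZMod.natCast_ne_zero_of_lt (p := p) (m := 2) (by norm_num)
    (by have := t.six_le; have := t.two_mul_eq; omega)
  simpa using this

theorem trace_sq (t : IsWeightTriple n e f H) (α β γ : ZMod p) :
    LinearMap.trace (ZMod p) M ((α • e + β • H + γ • f) * (α • e + β • H + γ • f)) =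
      2 * (β ^ 2 + α * γ) * LinearMap.trace (ZMod p) M (f * e) := by
  have h2 := t.two_ne_zero
  set T := LinearMap.trace (ZMod p) M with hT
  have hc : ∀ X Y, T (X * Y) = T (Y * X) := fun X Y => LinearMap.trace_mul_comm _ _ _
  have ee : T (e * e) = 0 := by
    have h1 : T ((H * e - e * H) * e) = 0 := by
      rw [sub_mul, map_sub, hc (H * e), hc (e * H), ← mul_assoc, hc (e * H) e, ← mul_assoc,
        sub_self]
    rw [t.He, smul_mul_assoc, map_smul] at h1
    exact (smul_eq_zero.1 h1).resolve_left h2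
  have ff : T (f * f) = 0 := by
    have h1 : T ((H * f - f * H) * f) = 0 := by
      rw [sub_mul, map_sub, hc (H * f), hc (f * H), ← mul_assoc, hc (f * H) f, ← mul_assoc,
        sub_self]
    rw [t.Hf, smul_mul_assoc, map_smul] at h1
    exact (smul_eq_zero.1 h1).resolve_left (neg_ne_zero.2 h2)
  have eH : T (e * H) = 0 := by
    have h1 : T ((H * e - e * H) * H) = 0 := by
      rw [sub_mul, map_sub, mul_assoc H e H, hc H, sub_self]
    rw [t.He, smul_mul_assoc, map_smul] at h1
    exact (smul_eq_zero.1 h1).resolve_left h2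
  have fH : T (f * H) = 0 := by
    have h1 : T ((H * f - f * H) * H) = 0 := by
      rw [sub_mul, map_sub, mul_assoc H f H, hc H, sub_self]
    rw [t.Hf, smul_mul_assoc, map_smul] at h1
    exact (smul_eq_zero.1 h1).resolve_left (neg_ne_zero.2 h2)
  have HH : T (H * H) = 2 * T (f * e) := by
    have h1 : T (H * (e * f - f * e)) = T ((H * e - e * H) * f) := by
      rw [mul_sub, sub_mul, map_sub, map_sub, ← mul_assoc, ← mul_assoc, hc (H * f) e, ← mul_assoc]
    rw [t.ef, t.He, smul_mul_assoc, map_smul, hc e f] at h1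
    exact h1
  simp only [add_mul, mul_add, smul_mul_assoc, mul_smul_comm, map_add, map_smul, ee, ff, eH, fH,
    HH, hc H e, hc H f, hc e f, smul_eq_mul]
  ring

theorem coeff_of_pow_eq_zero (t : IsWeightTriple n e f H) {α β γ : ZMod p} {i : ℕ}
    (h : (α • e + β • H + γ • f) ^ i = 0) : β ^ 2 + α * γ = 0 := by
  have h1 := t.trace_sq α β γ
  rw [(LinearMap.isNilpotent_trace_of_isNilpotent (⟨i, by rw [← pow_two, ← pow_mul, mul_comm,
    pow_mul, h, zero_pow _root_.two_ne_zero]⟩ : IsNilpotent ((α • e + β • H + γ • f) *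
      (α • e + β • H + γ • f)))).eq_zero] at h1
  exact (mul_eq_zero.1 ((mul_eq_zero.1 h1.symm).resolve_right t.trace_ne)).resolve_left
    t.two_ne_zero

theorem texp_conj_f (t : IsWeightTriple n e f H) (s : ZMod p) :
    texp (p := p) (s • e) * f * texp (p := p) (-(s • e)) = f + s • H - s ^ 2 • e := by
  have h2 := t.two_ne_zero
  rw [← texp_smul_adOp t.two_mul_eq t.jordan.pow_eq_zero, texp, LinearMap.sum_apply]
  have D0 : adOp p e e = 0 := by simp
  have D1 : adOp p e f = H := by rw [adOp_apply, t.ef]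
  have D2 : adOp p e H = -(2 : ZMod p) • e := by rw [adOp_apply, ← neg_sub, t.He, neg_smul]
  have D3 : ∀ j, (adOp p e ^ (j + 3)) f = 0 := by
    intro j
    rw [pow_add, Module.End.mul_apply, pow_succ, pow_two, Module.End.mul_apply,
      Module.End.mul_apply, D1, D2, map_smul, D0, smul_zero, map_zero]
  rw [← Finset.sum_subset (s₁ := Finset.range 3)]
  · have f1 : ((Nat.factorial 2 : ℕ) : ZMod p) = 2 := by norm_num [Nat.factorial]
    simp only [Finset.sum_range_succ, Finset.sum_range_zero, smul_pow, LinearMap.smul_apply,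
      pow_zero, pow_one, pow_two (adOp p e), Module.End.mul_apply, D1, D2, zero_add,
      Nat.factorial_zero, Nat.factorial_one, f1, Module.End.one_apply, Nat.cast_one, inv_one,
      smul_smul]
    rw [sub_eq_add_neg, ← neg_smul, one_mul, one_smul, one_mul]
    congr 2
    linear_combination (-(s ^ 2)) * (inv_mul_cancel₀ h2)
  · exact Finset.range_mono (by have := t.six_le; have := t.two_mul_eq; omega)
  · intro j _ hj
    rw [Finset.mem_range, not_lt] at hj
    rw [smul_pow, LinearMap.smul_apply, LinearMap.smul_apply, show j = (j - 3) + 3 by omega, D3,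
      smul_zero, smul_zero]

/-- A nilpotent element of the triple is a multiple of `e` or a conjugate of a multiple of `f`. -/
theorem eq_or_eq_of_pow_eq_zero (t : IsWeightTriple n e f H) {α β γ : ZMod p} {i : ℕ}
    (h : (α • e + β • H + γ • f) ^ i = 0) :
    α • e + β • H + γ • f = α • e ∨ γ ≠ 0 ∧ ∃ s : ZMod p, α • e + β • H + γ • f =
      γ • (texp (p := p) (s • e) * f * texp (p := p) (-(s • e))) := by
  have h1 := t.coeff_of_pow_eq_zero h
  rcases eq_or_ne γ 0 with rfl | hγ
  · left
    rw [mul_zero, add_zero] at h1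
    rw [eq_zero_of_pow_eq_zero h1, zero_smul, zero_smul, add_zero, add_zero]
  · right
    obtain ⟨r, rfl⟩ : ∃ r, β = γ * r := ⟨β / γ, by field_simp⟩
    have h3 : α = -(γ * r ^ 2) := mul_left_cancel₀ hγ (by linear_combination h1)
    refine ⟨hγ, r, ?_⟩
    rw [t.texp_conj_f, h3]
    module

theorem exists_weights (t : IsWeightTriple n e f H) : ∃ z : ℕ → M, e (z 0) = 0 ∧
    (∀ i, e (z (i + 1)) = ((n : ZMod p) - 1 - i) • z i) ∧
    (∀ i, f (z i) = ((i : ZMod p) + 1) • z (i + 1)) ∧ (∀ i, n ≤ i → z i = 0) ∧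
    LinearIndependent (ZMod p) (fun i : Fin n => z i) := by
  have h6 := t.six_le
  have hnp := t.two_mul_eq
  obtain ⟨v, hv⟩ := t.jordan.exists_cyclic
  set w := (e ^ (n - 1)) v with hw
  have hew : e w = 0 := by
    rw [hw, ← Module.End.mul_apply, ← pow_succ', show n - 1 + 1 = n by omega, t.jordan.pow_eq_zero]
    rfl
  have fs : ∀ i, (f ^ (i + 1)) w = f ((f ^ i) w) := fun i => by
    rw [pow_succ', Module.End.mul_apply]
  have hH : ∀ i : ℕ, H ((f ^ i) w) = ((n : ZMod p) - 1 - 2 * i) • (f ^ i) w := by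
    intro i
    induction i with
    | zero => simpa using t.weight w hew
    | succ i ih =>
      have h1 := LinearMap.congr_fun t.Hf ((f ^ i) w)
      rw [LinearMap.sub_apply, Module.End.mul_apply, Module.End.mul_apply, ih,
        LinearMap.smul_apply, ← fs, map_smul, ← fs, sub_eq_iff_eq_add, ← add_smul] at h1
      rw [h1]
      congr 1; push_cast; ring
  have hE : ∀ i : ℕ, e ((f ^ (i + 1)) w) = (((i : ZMod p) + 1) * (n - 1 - i)) • (f ^ i) w := by
    intro i
    induction i with
    | zero =>
      have h1 := LinearMap.congr_fun t.ef w
      rw [LinearMap.sub_apply, Module.End.mul_apply, Module.End.mul_apply, hew, map_zero,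
        sub_zero, t.weight w hew] at h1
      simpa using h1
    | succ i ih =>
      have h1 := LinearMap.congr_fun t.ef ((f ^ (i + 1)) w)
      rw [LinearMap.sub_apply, Module.End.mul_apply, Module.End.mul_apply, ih, map_smul, ← fs,
        ← fs, hH, sub_eq_iff_eq_add, ← add_smul] at h1
      rw [h1]
      congr 1; push_cast; ring
  have hfn : (f ^ n) w = 0 := by
    have h1 : e ((f ^ n) w) = 0 := by
      have := hE (n - 1)
      rw [show n - 1 + 1 = n by omega, Nat.cast_sub (by omega)] at this
      rw [this]; simp
    have h2 := t.weight _ h1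
    rw [hH, ← sub_eq_zero, ← sub_smul] at h2
    refine (smul_eq_zero.1 h2).resolve_left ?_
    have h3 := ZMod.natCast_ne_zero_of_lt (p := p) (m := n) (by omega) (by omega)
    intro h4
    exact mul_ne_zero t.two_ne_zero h3 (by linear_combination -h4)
  let z : ℕ → M := fun i => if i < n then ((i.factorial : ZMod p)⁻¹) • (f ^ i) w else 0
  have hz : ∀ i, i < n → z i = ((i.factorial : ZMod p)⁻¹) • (f ^ i) w := fun i hi => if_pos hi
  have hz' : ∀ i, n ≤ i → z i = 0 := fun i hi => if_neg (by omega)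
  have hfac : ∀ i, i < n → (i.factorial : ZMod p) ≠ 0 := fun i hi =>
    factorial_cast_ne_zero (by omega)
  have hz1 : ∀ i, e (z (i + 1)) = ((n : ZMod p) - 1 - i) • z i := by
    intro i
    rcases lt_trichotomy (i + 1) n with hi | hi | hi
    · rw [hz _ hi, hz i (by omega), map_smul, hE, smul_smul, smul_smul]
      congr 1
      have h1 := hfac _ hi
      have h2 := hfac i (by omega)
      rw [Nat.factorial_succ] at h1 ⊢
      push_cast at h1 ⊢
      have h3 := (mul_ne_zero_iff.1 h1).1
      field_simp
    · rw [hz' (i + 1) (by omega), map_zero, ← hi]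
      push_cast
      rw [add_sub_cancel_right, sub_self, zero_smul]
    · rw [hz' (i + 1) (by omega), hz' i (by omega), map_zero, smul_zero]
  have hz0 : z 0 = w := by rw [hz 0 (by omega)]; simp
  have hne : ∀ i, i < n → z i ≠ 0 := by
    intro i
    induction i with
    | zero => intro _; rw [hz0]; exact hv
    | succ i ih =>
      intro hi h0
      have h1 := hz1 i
      rw [h0, map_zero] at h1
      refine (smul_ne_zero ?_ (ih (by omega))) h1.symm
      have := ZMod.natCast_ne_zero_of_lt (p := p) (m := n - (i + 1)) (by omega) (by omega)
      rw [Nat.cast_sub (by omega)] at this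
      push_cast at this
      intro h2; apply this; linear_combination h2
  refine ⟨z, by rw [hz0, hew], hz1, ?_, hz', ?_⟩
  · intro i
    rcases lt_trichotomy (i + 1) n with hi | hi | hi
    · rw [hz _ hi, hz i (by omega), map_smul, ← fs, smul_smul]
      congr 1
      have h1 := hfac _ hi
      have h2 := hfac i (by omega)
      rw [Nat.factorial_succ] at h1 ⊢
      push_cast at h1 ⊢
      have h3 := (mul_ne_zero_iff.1 h1).1
      field_simp
    · rw [hz' (i + 1) (by omega), hz i (by omega), map_smul, ← fs, hi, hfn, smul_zero, smul_zero]
    · rw [hz' (i + 1) (by omega), hz' i (by omega), map_zero, smul_zero]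
  · refine Module.End.eigenvectors_linearIndependent' H
      (fun i : Fin n => (n : ZMod p) - 1 - 2 * (i : ℕ)) ?_ _ ?_
    · intro i j hij
      have h1 : ((i : ℕ) : ZMod p) = (j : ℕ) := by
        apply mul_left_cancel₀ t.two_ne_zero
        linear_combination -hij
      rw [ZMod.natCast_eq_natCast_iff', Nat.mod_eq_of_lt (by omega),
        Nat.mod_eq_of_lt (by omega)] at h1
      exact Fin.ext h1
    · intro i
      refine ⟨?_, hne i i.2⟩
      rw [Module.End.mem_eigenspace_iff, hz i i.2, map_smul, hH, smul_comm]

end IsWeightTriple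

section TransvectionGeneration

open Matrix

theorem Matrix.SpecialLinearGroup.mem_of_transvections {F : Type*} [Field F]
    (S : Subgroup (Matrix.SpecialLinearGroup (Fin 2) F))
    (hU : ∀ c : F, (⟨!![1, c; 0, 1], by simp⟩ : Matrix.SpecialLinearGroup (Fin 2) F) ∈ S)
    (hL : ∀ c : F, (⟨!![1, 0; c, 1], by simp⟩ : Matrix.SpecialLinearGroup (Fin 2) F) ∈ S)
    (s : Matrix.SpecialLinearGroup (Fin 2) F) : s ∈ S := by
  have hmul : ∀ (s t : Matrix.SpecialLinearGroup (Fin 2) F) (i j : Fin 2),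
      (s * t) i j = s i 0 * t 0 j + s i 1 * t 1 j := by
    intro s t i j
    rw [Matrix.SpecialLinearGroup.coe_mul, mul_apply, Fin.sum_univ_two]
  obtain ⟨u, hu⟩ : ∃ u : F → Matrix.SpecialLinearGroup (Fin 2) F,
    u = fun c => ⟨!![1, c; 0, 1], by simp⟩ := ⟨_, rfl⟩
  obtain ⟨l, hl⟩ : ∃ l : F → Matrix.SpecialLinearGroup (Fin 2) F,
    l = fun c => ⟨!![1, 0; c, 1], by simp⟩ := ⟨_, rfl⟩
  have hU' : ∀ c, u c ∈ S := by rw [hu]; exact hU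
  have hL' : ∀ c, l c ∈ S := by rw [hl]; exact hL
  have key : ∀ s : Matrix.SpecialLinearGroup (Fin 2) F, s 1 0 ≠ 0 → s ∈ S := by
    intro s hc
    have hdet := s.det_coe
    rw [det_fin_two] at hdet
    have : s = u ((s 0 0 - 1) / s 1 0) * l (s 1 0) * u ((s 1 1 - 1) / s 1 0) := by
      apply Matrix.SpecialLinearGroup.ext
      intro i j
      simp only [hmul]
      fin_cases i <;> fin_cases j <;> simp [hu, hl] <;> field_simp <;>
        first | ring1 | linear_combination -hdet
    rw [this]
    exact S.mul_mem (S.mul_mem (hU' _) (hL' _)) (hU' _)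
  by_cases hc : s 1 0 = 0
  · have hdet := s.det_coe
    rw [det_fin_two, hc, mul_zero, sub_zero] at hdet
    refine (S.mul_mem_cancel_left (hL' 1)).1 (key _ ?_)
    rw [hmul, hc]
    simpa [hl] using left_ne_zero_of_mul_eq_one hdet
  · exact key s hc

end TransvectionGeneration

namespace IsUnipotentCore

open Module Matrix

variable {p : ℕ} [hp : Fact p.Prime] {G M : Type*} [Group G] [AddCommGroup M]
    [Module (ZMod p) M] {ρ : Representation (ZMod p) G M} {n : ℕ} {x : G}
    {e f H : Module.End (ZMod p) M}
    {σ : Module.End (ZMod p) M →ₗ[ZMod p] Module.End (ZMod p) M} {z : ℕ → M}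

theorem texp_mul_texp_neg (h : IsUnipotentCore ρ n x e σ) (s : ZMod p) (X : End (ZMod p) M) :
    texp (p := p) (s • e) * X * texp (p := p) (-(s • e)) = conjRep ρ (x ^ s.val) X := by
  rw [h.texp_smul, h.texp_neg_smul, conjRep_apply]

theorem conjRep_mul_apply (g g' : G) (X : End (ZMod p) M) :
    conjRep ρ (g * g') X = conjRep ρ g (conjRep ρ g' X) := by
  rw [map_mul]; rfl

theorem conjRep_inv_conjRep (g : G) (X : End (ZMod p) M) :
    conjRep ρ g⁻¹ (conjRep ρ g X) = X := by
  rw [← conjRep_mul_apply, inv_mul_cancel, map_one]; rfl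

theorem conjRep_rep_apply (g : G) (X : End (ZMod p) M) (m : M) :
    conjRep ρ g X (ρ g m) = ρ g (X m) := by
  rw [conjRep_apply, Module.End.mul_apply, Module.End.mul_apply, rep_inv_apply_apply]

theorem conjRep_texp (g : G) (X : End (ZMod p) M) :
    conjRep ρ g (texp (p := p) X) = texp (p := p) (conjRep ρ g X) := by
  simp only [texp, map_sum, map_smul, conjRep_pow]

theorem exists_f_eq (h : IsUnipotentCore ρ n x e σ) (t : IsWeightTriple n e f H)
    (he : ∀ g, ∃ α β γ : ZMod p, conjRep ρ g e = α • e + β • H + γ • f) :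
    ∃ (g : G) (c : ZMod p), c ≠ 0 ∧ f = c • conjRep ρ g e := by
  obtain ⟨g, hg⟩ := h.exists_conjRep_pow_ne (j := 1) (by norm_num) (by have := h.six_le; omega)
  rw [pow_one] at hg
  obtain ⟨α, β, γ, hX⟩ := he g
  have hn : (α • e + β • H + γ • f) ^ n = 0 := by
    rw [← hX, ← conjRep_pow, h.jordan.pow_eq_zero, map_zero]
  rcases t.eq_or_eq_of_pow_eq_zero hn with h1 | ⟨hγ, s, h1⟩
  · exact absurd (hX.trans h1) (hg α)
  · rw [h.texp_mul_texp_neg, ← hX] at h1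
    refine ⟨(x ^ s.val)⁻¹ * g, γ⁻¹, inv_ne_zero hγ, ?_⟩
    rw [conjRep_mul_apply, h1, map_smul, conjRep_inv_conjRep, smul_smul, inv_mul_cancel₀ hγ,
      one_smul]

theorem exists_rep_eq_texp (h : IsUnipotentCore ρ n x e σ) {g : G} {a : ZMod p}
    (hf : f = a • conjRep ρ g e) (c : ZMod p) : ∃ u, ρ u = texp (p := p) (c • f) := by
  refine ⟨g * x ^ (c * a).val * g⁻¹, ?_⟩
  rw [hf, smul_smul, ← map_smul, ← conjRep_texp, h.texp_smul, conjRep_apply, map_mul, map_mul]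

theorem exists_smul_weight_zero (h : IsUnipotentCore ρ n x e σ) (h0 : z 0 ≠ 0)
    (hez : e (z 0) = 0) {m : M} (hm : e m = 0) : ∃ c : ZMod p, m = c • z 0 := by
  obtain ⟨v, hv⟩ := h.jordan.exists_cyclic
  obtain ⟨a, ha⟩ := h.jordan.exists_smul_of_apply_eq_zero hv hez
  obtain ⟨b, hb⟩ := h.jordan.exists_smul_of_apply_eq_zero hv hm
  have ha0 : a ≠ 0 := by rintro rfl; rw [zero_smul] at ha; exact h0 ha
  exact ⟨b / a, by rw [hb, ha, smul_smul, div_mul_cancel₀ _ ha0]⟩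

theorem exists_smul_weight_last (h : IsUnipotentCore ρ n x e σ) (h0 : z 0 ≠ 0)
    (hez : e (z 0) = 0) {g : G} {a : ZMod p} (ha : a ≠ 0) (hf : f = a • conjRep ρ g e)
    (hl : z (n - 1) ≠ 0) (hfl : f (z (n - 1)) = 0) {m : M} (hm : f m = 0) :
    ∃ c : ZMod p, m = c • z (n - 1) := by
  have key : ∀ m, f m = 0 → ∃ c : ZMod p, m = c • ρ g (z 0) := by
    intro m hm
    rw [hf, LinearMap.smul_apply] at hm
    have h1 := (smul_eq_zero.1 hm).resolve_left ha
    rw [← rep_apply_inv_apply (ρ := ρ) g m, conjRep_rep_apply] at h1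
    have h2 := congrArg (ρ g⁻¹) h1
    rw [rep_inv_apply_apply, map_zero] at h2
    obtain ⟨c, hc⟩ := h.exists_smul_weight_zero h0 hez h2
    exact ⟨c, by rw [← map_smul, ← hc, rep_apply_inv_apply]⟩
  obtain ⟨b, hb⟩ := key _ hfl
  obtain ⟨c, hc⟩ := key _ hm
  have hb0 : b ≠ 0 := by rintro rfl; rw [zero_smul] at hb; exact hl hb
  exact ⟨c / b, by rw [hb, smul_smul, div_mul_cancel₀ _ hb0, hc]⟩

/-- The correspondence between `G` and `SL₂` given by compatibility with the weight curve. -/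
def correspondence (ρ : Representation (ZMod p) G M) (n : ℕ) (z : ℕ → M) :
    Subgroup (G × Matrix.SpecialLinearGroup (Fin 2) (ZMod p)) where
  carrier := {q | ∀ v : Fin 2 → ZMod p, ρ q.1 (weightCurve n z (v 0) (v 1)) =
    weightCurve n z (((q.2 : Matrix (Fin 2) (Fin 2) (ZMod p)) *ᵥ v) 0)
      (((q.2 : Matrix (Fin 2) (Fin 2) (ZMod p)) *ᵥ v) 1)}
  mul_mem' := by
    intro q r hq hr v
    rw [Prod.fst_mul, Prod.snd_mul, map_mul, Module.End.mul_apply, hr v, hq,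
      Matrix.SpecialLinearGroup.coe_mul, mulVec_mulVec]
  one_mem' := by intro v; simp
  inv_mem' := by
    intro q hq v
    have h1 := hq (((q.2⁻¹ : Matrix.SpecialLinearGroup (Fin 2) (ZMod p)) :
      Matrix (Fin 2) (Fin 2) (ZMod p)) *ᵥ v)
    rw [mulVec_mulVec, ← Matrix.SpecialLinearGroup.coe_mul, mul_inv_cancel,
      Matrix.SpecialLinearGroup.coe_one,
      one_mulVec] at h1
    rw [Prod.fst_inv, Prod.snd_inv, ← h1, rep_inv_apply_apply]

theorem mem_correspondence {g : G} {s : Matrix.SpecialLinearGroup (Fin 2) (ZMod p)} :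
    (g, s) ∈ correspondence ρ n z ↔ ∀ X Y, ρ g (weightCurve n z X Y) =
      weightCurve n z (s 0 0 * X + s 0 1 * Y) (s 1 0 * X + s 1 1 * Y) := by
  constructor
  · intro h X Y
    have := h ![X, Y]
    simpa [mulVec, dotProduct, Fin.sum_univ_two] using this
  · intro h v
    have := h (v 0) (v 1)
    simpa [mulVec, dotProduct, Fin.sum_univ_two] using this

end IsUnipotentCore

/-- An `𝔰𝔩₂`-triple in the span of the conjugates of the nilpotent element `e`, together with a
basis of weight vectors. -/
structure IsWeightCore {p : ℕ} [Fact p.Prime] {G M : Type*} [Group G] [AddCommGroup M]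
    [Module (ZMod p) M] (ρ : Representation (ZMod p) G M) (n : ℕ) (x : G)
    (e f H : Module.End (ZMod p) M)
    (σ : Module.End (ZMod p) M →ₗ[ZMod p] Module.End (ZMod p) M) (z : ℕ → M) : Prop where
  core : IsUnipotentCore ρ n x e σ
  triple : IsWeightTriple n e f H
  ez : e (z 0) = 0
  ez_succ : ∀ i, e (z (i + 1)) = ((n : ZMod p) - 1 - i) • z i
  fz : ∀ i, f (z i) = ((i : ZMod p) + 1) • z (i + 1)
  z_eq_zero : ∀ i, n ≤ i → z i = 0
  indep : LinearIndependent (ZMod p) (fun i : Fin n => z i)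
  conj_e : ∀ g, ∃ α β γ : ZMod p, conjRep ρ g e = α • e + β • H + γ • f
  conj_f : ∀ g, ∃ α β γ : ZMod p, conjRep ρ g f = α • e + β • H + γ • f

namespace IsWeightCore

open Module Matrix IsUnipotentCore

variable {p : ℕ} [hp : Fact p.Prime] {G M : Type*} [Group G] [AddCommGroup M]
    [Module (ZMod p) M] {ρ : Representation (ZMod p) G M} {n : ℕ} {x : G}
    {e f H : Module.End (ZMod p) M}
    {σ : Module.End (ZMod p) M →ₗ[ZMod p] Module.End (ZMod p) M} {z : ℕ → M}

theorem z_ne_zero (h : IsWeightCore ρ n x e f H σ z) {i : ℕ} (hi : i < n) : z i ≠ 0 :=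
  h.indep.ne_zero (⟨i, hi⟩ : Fin n)

theorem n_pos (h : IsWeightCore ρ n x e f H σ z) : 0 < n := by
  have := h.core.six_le; omega

theorem conj_f_apply_ne (h : IsWeightCore ρ n x e f H σ z) : f (z 0) ≠ 0 := by
  rw [h.fz 0]
  simpa using h.z_ne_zero (i := 1) (by have := h.core.six_le; omega)

theorem rep_pow_x (h : IsWeightCore ρ n x e f H σ z) (c X Y : ZMod p) :
    ρ (x ^ c.val) (weightCurve n z X Y) = weightCurve n z (X + c * Y) Y := by
  rw [← h.core.texp_smul, texp_smul_weightCurve_left h.core.le_p h.ez h.ez_succ]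

theorem rep_pow_x_z (h : IsWeightCore ρ n x e f H σ z) (c : ZMod p) :
    ρ (x ^ c.val) (z 0) = z 0 := by
  have := h.rep_pow_x c 1 0
  rwa [mul_zero, add_zero, weightCurve_one_zero h.n_pos] at this

theorem rep_pow_x_inv_z (h : IsWeightCore ρ n x e f H σ z) (c : ZMod p) :
    ρ (x ^ c.val)⁻¹ (z 0) = z 0 := by
  conv_lhs => rw [← h.rep_pow_x_z c]
  rw [rep_inv_apply_apply]

theorem exists_mem_snd (h : IsWeightCore ρ n x e f H σ z)
    (s : Matrix.SpecialLinearGroup (Fin 2) (ZMod p)) : ∃ g, (g, s) ∈ correspondence ρ n z := by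
  obtain ⟨g, a, -, hf⟩ := h.core.exists_f_eq h.triple h.conj_e
  have := Matrix.SpecialLinearGroup.mem_of_transvections
    ((correspondence ρ n z).map (MonoidHom.snd _ _)) ?_ ?_ s
  · obtain ⟨⟨g, t⟩, hg, rfl⟩ := this
    exact ⟨g, hg⟩
  · intro c
    refine ⟨(x ^ c.val, _), mem_correspondence.2 fun X Y => ?_, rfl⟩
    rw [h.rep_pow_x]
    simp
  · intro c
    obtain ⟨u, hu⟩ := h.core.exists_rep_eq_texp hf c
    refine ⟨(u, _), mem_correspondence.2 fun X Y => ?_, rfl⟩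
    rw [hu, texp_smul_weightCurve h.core.le_p h.fz h.z_eq_zero]
    simp [add_comm]

theorem conjRep_pow_eq_zero (h : IsWeightCore ρ n x e f H σ z) (g : G) :
    conjRep ρ g e ^ n = 0 := by
  rw [← conjRep_pow, h.core.jordan.pow_eq_zero, map_zero]

theorem conjRep_f_pow_eq_zero (h : IsWeightCore ρ n x e f H σ z) (g : G) :
    conjRep ρ g f ^ n = 0 := by
  obtain ⟨k, a, -, hf⟩ := h.core.exists_f_eq h.triple h.conj_e
  rw [hf, map_smul, ← conjRep_mul_apply, smul_pow, h.conjRep_pow_eq_zero, smul_zero]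

theorem conjRep_ne_zero {g : G} {X : End (ZMod p) M} (hX : X ≠ 0) : conjRep ρ g X ≠ 0 := by
  intro h0
  apply hX
  rw [← conjRep_inv_conjRep (ρ := ρ) g X, h0, map_zero]

theorem e_ne_zero (h : IsWeightCore ρ n x e f H σ z) : e ≠ 0 := by
  have := h.core.jordan.pow_ne_zero (i := 1) (by have := h.core.six_le; omega)
  rwa [pow_one] at this

theorem conj_e_cases (h : IsWeightCore ρ n x e f H σ z) (g : G) :
    (∃ α : ZMod p, α ≠ 0 ∧ conjRep ρ g e = α • e) ∨
      ∃ γ s : ZMod p, γ ≠ 0 ∧ conjRep ρ g e = γ • conjRep ρ (x ^ s.val) f := by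
  obtain ⟨α, β, γ, hX⟩ := h.conj_e g
  have hn := h.conjRep_pow_eq_zero g
  rw [hX] at hn
  rcases h.triple.eq_or_eq_of_pow_eq_zero hn with h1 | ⟨hγ, s, h1⟩
  · refine Or.inl ⟨α, ?_, hX.trans h1⟩
    rintro rfl
    exact conjRep_ne_zero h.e_ne_zero (hX.trans (h1.trans (zero_smul _ _)))
  · rw [h.core.texp_mul_texp_neg] at h1
    exact Or.inr ⟨γ, s, hγ, hX.trans h1⟩

theorem conjRep_apply_eq (g : G) (X : End (ZMod p) M) (m : M) :
    conjRep ρ g X m = ρ g (X (ρ g⁻¹ m)) := by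
  rw [conjRep_apply]; rfl

theorem rep_eq_zero {g : G} {m : M} (hm : ρ g m = 0) : m = 0 := by
  rw [← rep_inv_apply_apply (ρ := ρ) g m, hm, map_zero]

theorem exists_smul_z (h : IsWeightCore ρ n x e f H σ z) (g : G) :
    ∃ k s, (k, s) ∈ correspondence ρ n z ∧ ∃ μ : ZMod p, ρ (k⁻¹ * g) (z 0) = μ • z 0 := by
  suffices hs : ∃ (s : Matrix.SpecialLinearGroup (Fin 2) (ZMod p)) (μ : ZMod p),
      ρ g (z 0) = μ • weightCurve n z (s 0 0) (s 1 0) by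
    obtain ⟨s, μ, hs⟩ := hs
    obtain ⟨k, hk⟩ := h.exists_mem_snd s
    refine ⟨k, s, hk, μ, ?_⟩
    have h1 := mem_correspondence.1 hk 1 0
    rw [weightCurve_one_zero h.n_pos] at h1
    simp only [mul_one, mul_zero, add_zero] at h1
    rw [map_mul, Module.End.mul_apply, hs, ← h1, map_smul, rep_inv_apply_apply]
  have h0 : conjRep ρ g e (ρ g (z 0)) = 0 := by rw [conjRep_rep_apply, h.ez, map_zero]
  rcases h.conj_e_cases g with ⟨α, hα, h1⟩ | ⟨γ, s, hγ, h1⟩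
  · rw [h1, LinearMap.smul_apply] at h0
    obtain ⟨c, hc⟩ := h.core.exists_smul_weight_zero (h.z_ne_zero h.n_pos) h.ez
      ((smul_eq_zero.1 h0).resolve_left hα)
    refine ⟨1, c, ?_⟩
    rw [hc]
    congr 1
    simp [weightCurve_one_zero h.n_pos]
  · rw [h1, LinearMap.smul_apply, conjRep_apply_eq] at h0
    have h2 := rep_eq_zero ((smul_eq_zero.1 h0).resolve_left hγ)
    obtain ⟨k, a, ha, hf⟩ := h.core.exists_f_eq h.triple h.conj_e
    obtain ⟨c, hc⟩ := h.core.exists_smul_weight_last (h.z_ne_zero h.n_pos) h.ez ha hf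
      (h.z_ne_zero (Nat.sub_lt h.n_pos one_pos)) (by
        rw [h.fz, Nat.sub_add_cancel h.n_pos, h.z_eq_zero n le_rfl, smul_zero]) h2
    refine ⟨⟨!![s, -1; 1, 0], by simp⟩, c, ?_⟩
    rw [← rep_apply_inv_apply (ρ := ρ) (x ^ s.val) (ρ g (z 0)), hc, map_smul,
      ← weightCurve_zero_one (p := p) h.n_pos z, h.rep_pow_x]
    simp

theorem exists_normalized (h : IsWeightCore ρ n x e f H σ z) {g : G} {μ : ZMod p}
    (hg : ρ g (z 0) = μ • z 0) :
    ∃ s γ : ZMod p, ρ ((x ^ s.val)⁻¹ * g) (z 0) = μ • z 0 ∧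
      conjRep ρ ((x ^ s.val)⁻¹ * g) f = γ • f := by
  have hμ : μ ≠ 0 := by
    rintro rfl
    rw [zero_smul] at hg
    exact h.z_ne_zero h.n_pos (rep_eq_zero hg)
  obtain ⟨α, hα, he⟩ : ∃ α : ZMod p, α ≠ 0 ∧ conjRep ρ g e = α • e := by
    rcases h.conj_e_cases g with h1 | ⟨γ, s, hγ, h1⟩
    · exact h1
    · exfalso
      have h0 : conjRep ρ g e (ρ g (z 0)) = 0 := by rw [conjRep_rep_apply, h.ez, map_zero]
      rw [h1, LinearMap.smul_apply, conjRep_apply_eq, hg, map_smul, h.rep_pow_x_inv_z, map_smul,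
        map_smul] at h0
      exact h.conj_f_apply_ne (rep_eq_zero
        ((smul_eq_zero.1 ((smul_eq_zero.1 h0).resolve_left hγ)).resolve_left hμ))
  obtain ⟨α', β', γ, hX⟩ := h.conj_f g
  have hn := h.conjRep_f_pow_eq_zero g
  rw [hX] at hn
  rcases h.triple.eq_or_eq_of_pow_eq_zero hn with h1 | ⟨hγ, s, h1⟩
  · exfalso
    have h2 : conjRep ρ g (α • f - α' • e) = 0 := by
      rw [map_sub, map_smul, map_smul, he, hX.trans h1, smul_comm, sub_self]
    have h3 : α • f - α' • e = 0 := by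
      by_contra h3
      exact conjRep_ne_zero h3 h2
    have h4 := LinearMap.congr_fun h3 (z 0)
    rw [LinearMap.sub_apply, LinearMap.smul_apply, LinearMap.smul_apply, h.ez, smul_zero, sub_zero,
      LinearMap.zero_apply] at h4
    exact h.conj_f_apply_ne ((smul_eq_zero.1 h4).resolve_left hα)
  · rw [h.core.texp_mul_texp_neg] at h1
    refine ⟨s, γ, ?_, ?_⟩
    · rw [map_mul, Module.End.mul_apply, hg, map_smul, h.rep_pow_x_inv_z]
    · rw [conjRep_mul_apply, hX.trans h1, map_smul, conjRep_inv_conjRep]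

theorem rep_z (h : IsWeightCore ρ n x e f H σ z) {g : G} {μ γ : ZMod p}
    (hg : ρ g (z 0) = μ • z 0) (hf : conjRep ρ g f = γ • f) (i : ℕ) :
    ρ g (z i) = (μ * γ ^ i) • z i := by
  induction i with
  | zero => simpa using hg
  | succ i ih =>
    rcases lt_or_ge (i + 1) n with hi | hi
    · have h1 := conjRep_rep_apply (ρ := ρ) g f (z i)
      rw [hf, h.fz, ih, LinearMap.smul_apply, map_smul, h.fz, map_smul] at h1
      have h2 : ((i : ZMod p) + 1) ≠ 0 := by
        exact_mod_cast ZMod.natCast_ne_zero_of_lt (Nat.succ_ne_zero i) (hi.trans_le h.core.le_p)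
      apply smul_right_injective M h2
      dsimp only
      rw [← h1]
      module
    · rw [h.z_eq_zero _ hi, map_zero, smul_zero]

theorem form_ne_zero (h : IsWeightCore ρ n x e f H σ z) {B : M →ₗ[ZMod p] M →ₗ[ZMod p] ZMod p}
    (hB : ∀ X a b, B (σ X a) b = B a (X b)) (hnd : ∀ a, (∀ b, B a b = 0) → a = 0) :
    B (z 0) (z (n - 1)) ≠ 0 := by
  intro h0
  apply h.z_ne_zero h.n_pos
  apply hnd
  intro b
  have := h.core.jordan.finiteDimensional
  have hspan : Submodule.span (ZMod p) (Set.range fun i : Fin n => z i) = ⊤ := by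
    apply h.indep.span_eq_top_of_card_eq_finrank'
    rw [Fintype.card_fin, h.core.jordan.finrank_eq]
  have hb : b ∈ Submodule.span (ZMod p) (Set.range fun i : Fin n => z i) := by
    rw [hspan]; trivial
  have h1 : ∀ i, i + 1 < n → B (z 0) (z i) = 0 := by
    intro i hi
    have h2 := h.ez_succ i
    have h3 : B (e (z 0)) (z (i + 1)) = 0 := by rw [h.ez, map_zero, LinearMap.zero_apply]
    have h4 : B (z 0) (e (z (i + 1))) = 0 := by
      rw [← hB, h.core.σ_e, LinearMap.neg_apply, map_neg, LinearMap.neg_apply, h3, neg_zero]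
    rw [h2, map_smul, smul_eq_mul] at h4
    refine (mul_eq_zero.1 h4).resolve_left ?_
    have h5 : ((n - 1 - i : ℕ) : ZMod p) ≠ 0 :=
      ZMod.natCast_ne_zero_of_lt (by omega) (by have := h.core.le_p; omega)
    rwa [Nat.cast_sub (by omega), Nat.cast_sub (by omega), Nat.cast_one] at h5
  induction hb using Submodule.span_induction with
  | mem b hb =>
    obtain ⟨i, rfl⟩ := hb
    rcases eq_or_ne (i : ℕ) (n - 1) with hi | hi
    · simpa only [hi] using h0
    · exact h1 i (by have := i.2; omega)
  | zero => rw [map_zero]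
  | add a b _ _ ha hb => rw [map_add, ha, hb, add_zero]
  | smul c a _ ha => rw [map_smul, ha, smul_zero]

theorem exists_mem_of_diagonal (h : IsWeightCore ρ n x e f H σ z)
    {B : M →ₗ[ZMod p] M →ₗ[ZMod p] ZMod p}
    (hB : ∀ X a b, B (σ X a) b = B a (X b)) (hnd : ∀ a, (∀ b, B a b = 0) → a = 0)
    {g : G} {μ γ : ZMod p} (hg : ρ g (z 0) = μ • z 0) (hf : conjRep ρ g f = γ • f) :
    ∃ s, (g, s) ∈ correspondence ρ n z := by
  have h0 := h.form_ne_zero hB hnd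
  have hn6 := h.core.six_le
  have hp2 := h.core.two_mul_eq
  have hrel : μ ^ 2 * γ ^ (n - 1) = 1 := by
    have h1 : B (ρ g (z 0)) (ρ g (z (n - 1))) = B (z 0) (z (n - 1)) := by
      rw [← hB, h.core.σ_rep, rep_inv_apply_apply]
    rw [h.rep_z hg hf, h.rep_z hg hf, map_smul, map_smul, LinearMap.smul_apply, smul_eq_mul,
      smul_eq_mul] at h1
    apply mul_right_cancel₀ h0
    rw [one_mul]
    linear_combination h1
  have hμ : μ ≠ 0 := by
    rintro rfl
    simp at hrel
  have hγ : γ ≠ 0 := by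
    rintro rfl
    rw [zero_pow (by omega), mul_zero] at hrel
    exact zero_ne_one hrel
  have hpow : ∀ a : ZMod p, a ≠ 0 → (a ^ 2) ^ (n - 1) = 1 := by
    intro a ha
    rw [← pow_mul, show 2 * (n - 1) = p - 1 by omega]
    exact ZMod.pow_card_sub_one_eq_one ha
  have hγ1 : γ ^ (n - 1) = 1 := by
    have h1 := hpow γ hγ
    rw [← pow_mul, mul_comm, pow_mul] at h1
    refine (by simpa using h1 : γ ^ (n - 1) = 1 ∨ γ ^ (n - 1) = -1).resolve_right fun h2 => ?_
    have h3 : μ ^ 2 = -1 := by linear_combination (-1 : ZMod p) * hrel + μ ^ 2 * h2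
    have h4 := hpow μ hμ
    obtain ⟨k, hk⟩ := h.core.even
    rw [h3, Odd.neg_one_pow ⟨k - 1, by omega⟩] at h4
    exact h.triple.two_ne_zero (by linear_combination -h4)
  have hμ1 : μ ^ 2 = 1 := by rwa [hγ1, mul_one] at hrel
  obtain ⟨k, hk⟩ := h.core.even
  set d := μ * (γ ^ k)⁻¹ with hd
  have hd0 : d ≠ 0 := mul_ne_zero hμ (inv_ne_zero (pow_ne_zero _ hγ))
  have hγn : γ ^ n = γ := by
    conv_lhs => rw [show n = n - 1 + 1 by omega, pow_succ, hγ1, one_mul]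
  have hd2 : d ^ 2 * γ = 1 := by
    rw [hd, mul_pow, hμ1, one_mul, inv_pow, ← pow_mul, mul_two, ← hk, hγn, inv_mul_cancel₀ hγ]
  have hdn : d ^ (n - 1) = μ := by
    have h1 : μ ^ (n - 1) = μ := by
      rw [show n - 1 = 2 * (k - 1) + 1 by omega, pow_succ, pow_mul, hμ1, one_pow, one_mul]
    rw [hd, mul_pow, h1, inv_pow, ← pow_mul, mul_comm k, pow_mul, hγ1, one_pow, inv_one, mul_one]
  refine ⟨⟨!![d, 0; 0, d⁻¹], by simp [hd0]⟩, mem_correspondence.2 fun X Y => ?_⟩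
  simp only [weightCurve, map_sum, map_smul, h.rep_z hg hf, smul_smul]
  refine Finset.sum_congr rfl fun i hi => ?_
  rw [Finset.mem_range] at hi
  congr 1
  have h2 : μ * γ ^ i = d ^ (n - 1 - i) * d⁻¹ ^ i := by
    have hγd : γ = d⁻¹ ^ 2 := by
      rw [inv_pow]
      exact eq_inv_of_mul_eq_one_right hd2
    have h3 : d ^ (n - 1) = d ^ (n - 1 - i) * d ^ i := by rw [← pow_add]; congr 1; omega
    rw [← hdn, h3, hγd, ← pow_mul, two_mul, pow_add, mul_assoc, ← mul_assoc (d ^ i), ← mul_pow,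
      mul_inv_cancel₀ hd0, one_pow, one_mul]
  simp
  rw [mul_pow, mul_pow]
  linear_combination X ^ (n - 1 - i) * Y ^ i * h2

theorem exists_mem_fst (h : IsWeightCore ρ n x e f H σ z)
    {B : M →ₗ[ZMod p] M →ₗ[ZMod p] ZMod p}
    (hB : ∀ X a b, B (σ X a) b = B a (X b)) (hnd : ∀ a, (∀ b, B a b = 0) → a = 0)
    (g : G) : ∃ s, (g, s) ∈ correspondence ρ n z := by
  obtain ⟨k, s, hk, μ, hμ⟩ := h.exists_smul_z g
  obtain ⟨c, γ, h1, h2⟩ := h.exists_normalized hμ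
  obtain ⟨t, ht⟩ := h.exists_mem_of_diagonal hB hnd h1 h2
  obtain ⟨u, h3⟩ : ∃ u, (x ^ c.val, u) ∈ correspondence ρ n z := by
    refine ⟨⟨!![1, c; 0, 1], by simp⟩, mem_correspondence.2 fun X Y => ?_⟩
    rw [h.rep_pow_x]
    simp
  have h4 := mul_mem hk (mul_mem h3 ht)
  rw [Prod.mk_mul_mk, Prod.mk_mul_mk, mul_inv_cancel_left, mul_inv_cancel_left] at h4
  exact ⟨_, h4⟩

theorem nonempty_mulEquiv (h : IsWeightCore ρ n x e f H σ z)
    {B : M →ₗ[ZMod p] M →ₗ[ZMod p] ZMod p}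
    (hB : ∀ X a b, B (σ X a) b = B a (X b)) (hnd : ∀ a, (∀ b, B a b = 0) → a = 0) :
    Nonempty (G ≃* Matrix.SpecialLinearGroup (Fin 2) (ZMod p)) := by
  set K := correspondence ρ n z with hK
  have hn := h.core.six_le
  have h1 : Function.Bijective ((MonoidHom.fst G _).comp K.subtype) := by
    constructor
    · rw [injective_iff_map_eq_one]
      rintro ⟨⟨g, s⟩, hgs⟩ hg
      obtain rfl : g = 1 := hg
      have h2 : s = 1 := by
        refine eq_one_of_weightCurve (n := n) (by omega) h.core.even h.indep fun X Y => ?_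
        rw [← mem_correspondence.1 hgs X Y, map_one]; rfl
      subst h2
      rfl
    · intro g
      obtain ⟨s, hs⟩ := h.exists_mem_fst hB hnd g
      exact ⟨⟨(g, s), hs⟩, rfl⟩
  have h2 : Function.Bijective ((MonoidHom.snd G _).comp K.subtype) := by
    constructor
    · rw [injective_iff_map_eq_one]
      rintro ⟨⟨g, s⟩, hgs⟩ hs
      obtain rfl : s = 1 := hs
      have h3 : g = 1 := by
        apply h.core.injective
        rw [map_one]
        have hfix : ∀ X Y : ZMod p, ρ g (weightCurve n z X Y) = weightCurve n z X Y := by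
          intro X Y
          rw [mem_correspondence.1 hgs X Y]
          simp
        set W := Submodule.span (ZMod p)
          (Set.range fun q : ZMod p × ZMod p => weightCurve n z q.1 q.2) with hW
        have hWtop : W = ⊤ := by
          refine (h.core.irreducible W ?_).resolve_left ?_
          · intro g' m hm
            obtain ⟨s, hs⟩ := h.exists_mem_fst hB hnd g'
            induction hm using Submodule.span_induction with
            | mem m hm =>
              obtain ⟨q, rfl⟩ := hm
              rw [mem_correspondence.1 hs]
              exact Submodule.subset_span ⟨(_, _), rfl⟩
            | zero => rw [map_zero]; exact W.zero_mem
            | add a b _ _ ha hb => rw [map_add]; exact W.add_mem ha hb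
            | smul c a _ ha => rw [map_smul]; exact W.smul_mem c ha
          · intro hbot
            apply h.z_ne_zero h.n_pos
            rw [← Submodule.mem_bot (ZMod p), ← hbot, ← weightCurve_one_zero (p := p) h.n_pos z]
            exact Submodule.subset_span ⟨(1, 0), rfl⟩
        ext m
        have hm : m ∈ W := by rw [hWtop]; trivial
        induction hm using Submodule.span_induction with
        | mem m hm =>
          obtain ⟨q, rfl⟩ := hm
          exact hfix _ _
        | zero => rw [map_zero, map_zero]
        | add a b _ _ ha hb => rw [map_add, map_add, ha, hb]
        | smul c a _ ha => rw [map_smul, map_smul, ha]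
      subst h3
      rfl
    · intro s
      obtain ⟨g, hg⟩ := h.exists_mem_snd s
      exact ⟨⟨(g, s), hg⟩, rfl⟩
  exact ⟨(MulEquiv.ofBijective _ h1).symm.trans (MulEquiv.ofBijective _ h2)⟩

end IsWeightCore

section Recognition

open Module Matrix

variable {p : ℕ} [hp : Fact p.Prime] {G M : Type*} [Group G] [AddCommGroup M]
    [Module (ZMod p) M] {ρ : Representation (ZMod p) G M} {n : ℕ} {x : G}
    {B : M →ₗ[ZMod p] M →ₗ[ZMod p] ZMod p}

/-- A finite group with Sylow `p`-subgroups of order at most `p` acting faithfully, irreducibly and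
with an invariant form in dimension `(p + 1) / 2`, such that some element acts as a single
unipotent Jordan block, is `SL₂(p)`. -/
theorem nonempty_mulEquiv_of_isJordanBlock [Finite G] (hp11 : 11 ≤ p) (hn : 2 * n = p + 1)
    (heven : Even n) (hinj : Function.Injective ρ)
    (hirr : ∀ W : Submodule (ZMod p) M, (∀ g, ∀ m ∈ W, ρ g m ∈ W) → W = ⊥ ∨ W = ⊤)
    (hcard : ¬ p ^ 2 ∣ Nat.card G) (hx : IsJordanBlock n (ρ x - 1))
    (hB : ∀ g a b, B (ρ g a) (ρ g b) = B a b) {ε : ZMod p} (hε : ε ^ 2 = 1)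
    (hBε : ∀ a b, B a b = ε * B b a) (hB0 : B ≠ 0) :
    Nonempty (G ≃* Matrix.SpecialLinearGroup (Fin 2) (ZMod p)) := by
  have hfin := hx.finiteDimensional
  have hinv : ∀ g a b, B (ρ g a) b = B a (ρ g⁻¹ b) := by
    intro g a b
    rw [← hB g⁻¹, IsUnipotentCore.rep_inv_apply_apply]
  have hker : LinearMap.ker B = ⊥ := by
    refine (hirr _ ?_).resolve_right fun h => hB0 (LinearMap.ker_eq_top.1 h)
    intro g m hm
    rw [LinearMap.mem_ker] at hm ⊢
    ext b
    rw [hinv, hm, LinearMap.zero_apply, LinearMap.zero_apply]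
  have hnd : ∀ a, (∀ b, B a b = 0) → a = 0 := by
    intro a ha
    rw [← Submodule.mem_bot (ZMod p), ← hker, LinearMap.mem_ker]
    exact LinearMap.ext ha
  set D : M ≃ₗ[ZMod p] Dual (ZMod p) M :=
    LinearEquiv.ofInjectiveOfFinrankEq B (LinearMap.ker_eq_bot.1 hker)
      (Subspace.dual_finrank_eq).symm with hD
  have hDB : ∀ a b, D a b = B a b := fun a b => rfl
  set σ : End (ZMod p) M →ₗ[ZMod p] End (ZMod p) M :=
    { toFun := fun X => (D.symm : Dual (ZMod p) M →ₗ[ZMod p] M) ∘ₗ X.dualMap ∘ₗ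
        (D : M →ₗ[ZMod p] Dual (ZMod p) M)
      map_add' := by intro X Y; ext m; simp [LinearMap.dualMap_def, map_add]
      map_smul' := by intro c X; ext m; simp [LinearMap.dualMap_def] } with hσ
  have hσB : ∀ X a b, B (σ X a) b = B a (X b) := by
    intro X a b
    rw [← hDB, hσ]
    simp [hDB]
  have huniq : ∀ X Y : End (ZMod p) M, (∀ a b, B (X a) b = B a (Y b)) → σ Y = X := by
    intro X Y h
    ext a
    rw [← sub_eq_zero]
    apply hnd
    intro b
    rw [map_sub, LinearMap.sub_apply, hσB, h, sub_self]
  obtain ⟨e, he, hex⟩ := hx.exists_texp_eq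
  have hep : e ^ p = 0 := pow_eq_zero_of_le (by omega) he.pow_eq_zero
  have hxp : x ^ p = 1 := hinj (by rw [map_pow, ← hex, texp_pow_prime hep, map_one])
  have hσρ : ∀ g, σ (ρ g) = ρ g⁻¹ := by
    intro g
    refine huniq _ _ fun a b => ?_
    rw [hinv, inv_inv]
  have hneg : ∀ s : ZMod p, σ (texp (p := p) (s • e)) = texp (p := p) ((-s) • e) := by
    intro s
    rw [texp_smul hep, texp_smul hep, hex, ← map_pow, ← map_pow, hσρ]
    congr 1
    rw [inv_eq_iff_mul_eq_one, ← pow_add]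
    obtain ⟨k, hk⟩ : p ∣ s.val + (-s).val := by
      rw [← ZMod.natCast_eq_zero_iff]
      push_cast
      rw [ZMod.natCast_zmod_val, ZMod.natCast_zmod_val, add_neg_cancel]
    rw [hk, pow_mul, hxp, one_pow]
  have hσe : σ e = -e := by
    have h1 := sum_inv_smul_texp_smul (p := p) (by omega) e
    have h2 : σ (-e) = - -e := by
      rw [← h1, map_sum, ← Finset.sum_neg_distrib,
        ← Equiv.sum_comp (Equiv.neg (ZMod p))]
      refine Finset.sum_congr rfl fun s _ => ?_
      rw [map_smul, Equiv.neg_apply, hneg, neg_neg, inv_neg, neg_smul]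
    rw [map_neg, neg_inj] at h2
    exact h2
  have hcore : IsUnipotentCore ρ n x e σ :=
    { eleven_le := hp11
      two_mul_eq := hn
      even := heven
      injective := hinj
      irreducible := hirr
      card := hcard
      jordan := he
      texp_eq := hex
      σ_mul := fun X Y => huniq _ _ fun a b => by
        rw [Module.End.mul_apply, hσB, hσB, Module.End.mul_apply]
      σ_σ := fun X => huniq _ _ fun a b => by
        rw [hBε, ← hσB, hBε, ← mul_assoc, ← sq, hε, one_mul]
      σ_rep := hσρ
      σ_e := hσe }
  obtain ⟨f, H, h1, h2, h3, h4, h5, h6, h7⟩ := hcore.exists_triple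
  have ht : IsWeightTriple n e f H := ⟨hcore.six_le, hn, he, h1, h2, h3, h4, h5⟩
  obtain ⟨z, z1, z2, z3, z4, z5⟩ := ht.exists_weights
  exact IsWeightCore.nonempty_mulEquiv ⟨hcore, ht, z1, z2, z3, z4, z5, h6, h7⟩ hσB hnd

end Recognition

section Lattice

open Module

variable {V : Type*} [AddCommGroup V] [Module ℚ V]

theorem exists_trace_eq_intCast (L : Submodule ℤ V) [L.IsLattice ℚ] {φ : End ℚ V}
    (hφ : ∀ v ∈ L, φ v ∈ L) : ∃ z : ℤ, LinearMap.trace ℚ V φ = z := by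
  classical
  let b := Free.chooseBasis ℤ L
  let b' : Basis _ ℚ V := b.extendOfIsLattice ℚ
  let ψ : L →ₗ[ℤ] L := (φ.restrictScalars ℤ).restrict hφ
  refine ⟨∑ i, b.repr (ψ (b i)) i, ?_⟩
  rw [LinearMap.trace_eq_matrix_trace ℚ b', Matrix.trace, Int.cast_sum]
  refine Finset.sum_congr rfl fun i _ => ?_
  rw [Matrix.diag_apply, LinearMap.toMatrix_apply]
  have h1 : φ (b' i) = ∑ j, (b.repr (ψ (b i)) j : ℚ) • b' j := by
    have h2 : ((ψ (b i) : L) : V) = φ (b' i) := by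
      rw [Basis.extendOfIsLattice_apply]; rfl
    rw [← h2]
    conv_lhs => rw [← b.sum_repr (ψ (b i))]
    rw [Submodule.coe_sum]
    refine Finset.sum_congr rfl fun j _ => ?_
    rw [Basis.extendOfIsLattice_apply, Submodule.coe_smul, Int.cast_smul_eq_zsmul]
  rw [h1, Basis.repr_sum_self]

end Lattice

section ThetaRep

open Module

/-- A rational representation with a commuting square root `θ` of `-p`, whose commutant contains
only scalar selfadjoint elements for the invariant form `F`. -/
structure IsThetaRep {G V : Type*} [Group G] [AddCommGroup V] [Module ℚ V] (p : ℕ)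
    (ρ : Representation ℚ G V) (θ : End ℚ V) (F : V →ₗ[ℚ] V →ₗ[ℚ] ℚ) : Prop where
  finrank_eq : finrank ℚ V = p + 1
  injective : Function.Injective ρ
  sq : θ * θ = -((p : ℚ) • 1)
  comm : ∀ g, θ * ρ g = ρ g * θ
  symm : ∀ v w, F v w = F w v
  form_pos : ∀ v, v ≠ 0 → 0 < F v v
  inv : ∀ g v w, F (ρ g v) (ρ g w) = F v w
  skew : ∀ v w, F (θ v) w = -F v (θ w)
  scalar : ∀ φ : End ℚ V, (∀ g, φ * ρ g = ρ g * φ) → (∀ v w, F (φ v) w = F v (φ w)) →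
    ∃ a : ℚ, φ = a • 1
  card : ¬ p ^ 2 ∣ Nat.card G
  finrank_ker : ∀ x : G, x ^ p = 1 → x ≠ 1 → finrank ℚ (LinearMap.ker (ρ x - 1)) = 2

/-- A full lattice stable under the group and under `θ`. -/
structure IsStableLattice {G V : Type*} [Group G] [AddCommGroup V] [Module ℚ V]
    (ρ : Representation ℚ G V) (θ : End ℚ V) (L : Submodule ℤ V) : Prop where
  isLattice : L.IsLattice ℚ
  rep_mem : ∀ g, ∀ v ∈ L, ρ g v ∈ L
  theta_mem : ∀ v ∈ L, θ v ∈ L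

/-- The projection onto the fixed space of an element of order `p`. -/
noncomputable def fixedProj {G V : Type*} [Group G] [AddCommGroup V] [Module ℚ V] (p : ℕ)
    (ρ : Representation ℚ G V) (x : G) : End ℚ V :=
  (p : ℚ)⁻¹ • ∑ i ∈ Finset.range p, ρ (x ^ i)

variable {G V : Type*} [Group G] [AddCommGroup V] [Module ℚ V] {p : ℕ}
  {ρ : Representation ℚ G V} {x : G}

theorem fixedProj_apply (v : V) :
    fixedProj p ρ x v = (p : ℚ)⁻¹ • ∑ i ∈ Finset.range p, ρ (x ^ i) v := by
  rw [fixedProj, LinearMap.smul_apply, LinearMap.sum_apply]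

theorem rep_mul_fixedProj (hx : x ^ p = 1) : ρ x * fixedProj p ρ x = fixedProj p ρ x := by
  have h := Finset.sum_range_succ (fun i => ρ (x ^ i)) p
  rw [Finset.sum_range_succ', hx, pow_zero, add_right_cancel_iff] at h
  rw [fixedProj, mul_smul_comm, Finset.mul_sum, ← h]
  simp only [← map_mul, pow_succ']

theorem fixedProj_mul_rep (hx : x ^ p = 1) : fixedProj p ρ x * ρ x = fixedProj p ρ x := by
  have h := Finset.sum_range_succ (fun i => ρ (x ^ i)) p
  rw [Finset.sum_range_succ', hx, pow_zero, add_right_cancel_iff] at h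
  rw [fixedProj, smul_mul_assoc, Finset.sum_mul, ← h]
  simp only [← map_mul, pow_succ]

theorem mul_pow_rep_eq {X : End ℚ V} (hX : X * ρ x = X) (i : ℕ) : X * ρ (x ^ i) = X := by
  induction i with
  | zero => rw [pow_zero, map_one, mul_one]
  | succ i ih => rw [pow_succ, map_mul, ← mul_assoc, ih, hX]

theorem mul_fixedProj_eq (hp : p ≠ 0) {X : End ℚ V} (hX : X * ρ x = X) :
    X * fixedProj p ρ x = X := by
  rw [fixedProj, mul_smul_comm, Finset.mul_sum, Finset.sum_congr rfl fun i _ => mul_pow_rep_eq hX i,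
    Finset.sum_const, Finset.card_range, ← Nat.cast_smul_eq_nsmul ℚ, smul_smul,
    inv_mul_cancel₀ (by exact_mod_cast hp), one_smul]

theorem fixedProj_apply_of_mem_ker (hp : p ≠ 0) {v : V} (hv : ρ x v = v) :
    fixedProj p ρ x v = v := by
  have h : ∀ i : ℕ, ρ (x ^ i) v = v := by
    intro i
    induction i with
    | zero => rw [pow_zero, map_one]; rfl
    | succ i ih => rw [pow_succ, map_mul, Module.End.mul_apply, hv, ih]
  rw [fixedProj_apply, Finset.sum_congr rfl fun i _ => h i, Finset.sum_const, Finset.card_range,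
    ← Nat.cast_smul_eq_nsmul ℚ, smul_smul, inv_mul_cancel₀ (by exact_mod_cast hp), one_smul]

theorem isProj_fixedProj (hp : p ≠ 0) (hx : x ^ p = 1) :
    LinearMap.IsProj (LinearMap.ker (ρ x - 1)) (fixedProj p ρ x) where
  map_mem v := by
    rw [LinearMap.mem_ker, LinearMap.sub_apply, ← Module.End.mul_apply, rep_mul_fixedProj hx]
    exact sub_self _
  map_id v hv := fixedProj_apply_of_mem_ker hp (sub_eq_zero.1 (LinearMap.mem_ker.1 hv))

namespace IsThetaRep

variable {θ : End ℚ V} {F : V →ₗ[ℚ] V →ₗ[ℚ] ℚ}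

theorem rep_apply_inv_apply (g : G) (v : V) : ρ g (ρ g⁻¹ v) = v := by
  rw [← Module.End.mul_apply, ← map_mul, mul_inv_cancel, map_one]; rfl

theorem form_rep_left (h : IsThetaRep p ρ θ F) (g : G) (v w : V) :
    F (ρ g v) w = F v (ρ g⁻¹ w) := by
  rw [← h.inv g v (ρ g⁻¹ w), rep_apply_inv_apply]

theorem form_fixedProj_left (h : IsThetaRep p ρ θ F) (hp : p ≠ 0) (hx : x ^ p = 1) (v w : V) :
    F (fixedProj p ρ x v) w = F v (fixedProj p ρ x w) := by
  have key : ∀ v w, F (fixedProj p ρ x v) (fixedProj p ρ x w) = F (fixedProj p ρ x v) w := by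
    intro v w
    have h1 : ∀ i, F (fixedProj p ρ x v) (ρ (x ^ i) w) = F (fixedProj p ρ x v) w := by
      intro i
      have h2 : ρ (x ^ i) (fixedProj p ρ x v) = fixedProj p ρ x v := by
        induction i with
        | zero => rw [pow_zero, map_one]; rfl
        | succ i ih =>
          rw [pow_succ, map_mul, Module.End.mul_apply, ← Module.End.mul_apply (ρ x),
            rep_mul_fixedProj hx, ih]
      conv_lhs => rw [← h2]
      rw [h.inv]
    rw [fixedProj_apply w, map_smul, map_sum, Finset.sum_congr rfl fun i _ => h1 i,
      Finset.sum_const, Finset.card_range, ← Nat.cast_smul_eq_nsmul ℚ, smul_smul,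
      inv_mul_cancel₀ (by exact_mod_cast hp), one_smul]
  rw [← key, h.symm, h.symm v, key]

theorem finiteDimensional (h : IsThetaRep p ρ θ F) : FiniteDimensional ℚ V :=
  FiniteDimensional.of_finrank_pos (by rw [h.finrank_eq]; omega)

theorem trace_fixedProj (h : IsThetaRep p ρ θ F) (hp : p ≠ 0) (hx : x ^ p = 1) (hx1 : x ≠ 1) :
    LinearMap.trace ℚ V (fixedProj p ρ x) = 2 := by
  have := h.finiteDimensional
  rw [(isProj_fixedProj hp hx).trace, h.finrank_ker x hx hx1]
  norm_num

/-- No stable lattice is preserved by the projection onto the fixed space of an element of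
order `p`. -/
theorem exists_fixedProj_notMem [Finite G] [Fact p.Prime] (h : IsThetaRep p ρ θ F)
    (hp2 : 2 < p) {L : Submodule ℤ V}
    (hL : IsStableLattice ρ θ L) (hx : x ^ p = 1) (hx1 : x ≠ 1) :
    ∃ v ∈ L, fixedProj p ρ x v ∉ L := by
  classical
  by_contra! hcon
  have hp := (Fact.out : p.Prime)
  have hp0 := hp.ne_zero
  have := h.finiteDimensional
  have := hL.isLattice
  have := Fintype.ofFinite (G ⧸ Subgroup.zpowers x)
  obtain ⟨P, hP⟩ : ∃ P, P = fixedProj p ρ x := ⟨_, rfl⟩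
  have hPx : P * ρ x = P := by rw [hP, fixedProj_mul_rep hx]
  have hxP : ρ x * P = P := by rw [hP, rep_mul_fixedProj hx]
  obtain ⟨Φ, hΦ⟩ : ∃ Φ : G → End ℚ V, ∀ g, Φ g = ρ g * P * ρ g⁻¹ := ⟨_, fun _ => rfl⟩
  have hΦmul : ∀ g k, Φ (g * k) = ρ g * Φ k * ρ g⁻¹ := by
    intro g k
    rw [hΦ, hΦ, _root_.mul_inv_rev, map_mul, map_mul]
    simp only [mul_assoc]
  have hxiP : ∀ i : ℕ, ρ (x ^ i) * P = P := by
    intro i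
    induction i with
    | zero => rw [pow_zero, map_one, one_mul]
    | succ i ih => rw [pow_succ, map_mul, mul_assoc, hxP, ih]
  have hPxi : ∀ i : ℕ, P * ρ (x ^ i)⁻¹ = P := by
    intro i
    conv_lhs => rw [← mul_pow_rep_eq hPx i]
    rw [mul_assoc, ← map_mul, mul_inv_cancel, map_one, mul_one]
  have hΦx : ∀ g i, Φ (g * x ^ i) = Φ g := by
    intro g i
    rw [hΦmul, hΦ (x ^ i), hxiP, hPxi, ← hΦ]
  have htrΦ : ∀ g, LinearMap.trace ℚ V (Φ g) = 2 := by
    intro g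
    rw [hΦ, LinearMap.trace_mul_comm, ← mul_assoc, ← map_mul, inv_mul_cancel, map_one, one_mul, hP,
      h.trace_fixedProj hp0 hx hx1]
  obtain ⟨τ, hτ⟩ : ∃ τ, τ = ∑ q : G ⧸ Subgroup.zpowers x, Φ q.out := ⟨_, rfl⟩
  obtain ⟨a, ha⟩ := h.scalar τ (by
    intro g
    have h1 : ρ g * τ * ρ g⁻¹ = τ := by
      rw [hτ, Finset.mul_sum, Finset.sum_mul, ← sum_cosets_mul_left Φ hΦx g]
      exact Finset.sum_congr rfl fun q _ => (hΦmul _ _).symm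
    conv_lhs => rw [← h1]
    rw [mul_assoc, ← map_mul, inv_mul_cancel, map_one, mul_one]) (by
    intro v w
    rw [hτ, LinearMap.sum_apply, LinearMap.sum_apply, map_sum, map_sum, LinearMap.sum_apply]
    refine Finset.sum_congr rfl fun q _ => ?_
    rw [hΦ, Module.End.mul_apply, Module.End.mul_apply, Module.End.mul_apply, Module.End.mul_apply,
      h.form_rep_left, hP, h.form_fixedProj_left hp0 hx, h.form_rep_left, inv_inv])
  have htr1 : (p + 1 : ℚ) * a = 2 * Fintype.card (G ⧸ Subgroup.zpowers x) := by
    have h1 := congrArg (LinearMap.trace ℚ V) hτ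
    rw [map_sum, Finset.sum_congr rfl fun q _ => htrΦ _, ha, map_smul, LinearMap.trace_one,
      h.finrank_eq, Finset.sum_const, Finset.card_univ] at h1
    simp only [smul_eq_mul, nsmul_eq_mul] at h1
    push_cast at h1
    linarith
  have hz : ∀ g, ∃ z : ℤ, LinearMap.trace ℚ V (P * Φ g) = z := by
    intro g
    refine exists_trace_eq_intCast L fun v hv => ?_
    rw [hΦ, hP, Module.End.mul_apply, Module.End.mul_apply, Module.End.mul_apply]
    exact hcon _ (hL.rep_mem _ _ (hcon _ (hL.rep_mem _ _ hv)))
  choose z hz using hz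
  have htr2 : (∑ q : G ⧸ Subgroup.zpowers x, (z q.out : ℚ)) = 2 * a := by
    have h1 := congrArg (fun X => LinearMap.trace ℚ V (P * X)) hτ
    simp only [Finset.mul_sum, map_sum] at h1
    rw [Finset.sum_congr rfl fun q _ => hz _, ha, mul_smul_comm, mul_one, map_smul, hP,
      h.trace_fixedProj hp0 hx hx1, smul_eq_mul] at h1
    linarith
  have hzx : ∀ i g, z (x ^ i * g) = z g := by
    intro i g
    have h1 : (z (x ^ i * g) : ℚ) = z g := by
      have h2 : ρ (x ^ i)⁻¹ * P = P := by
        conv_lhs => rw [← hxiP i]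
        rw [← mul_assoc, ← map_mul, inv_mul_cancel, map_one, one_mul]
      rw [← hz, ← hz, hΦmul, ← mul_assoc, ← mul_assoc, mul_pow_rep_eq hPx, LinearMap.trace_mul_comm,
        ← mul_assoc, h2]
    exact_mod_cast h1
  obtain ⟨S, hS1, hS2, hS3⟩ := sum_cosets_eq_sum_fixed hx (fun g => (z g : ZMod p)) (by
      intro g i
      have h1 : (z (g * x ^ i) : ℚ) = z g := by rw [← hz, ← hz, hΦx]
      have h2 : z (g * x ^ i) = z g := by exact_mod_cast h1
      simp only [h2]) (by
      intro g _
      simp only [hzx, Finset.sum_const, Finset.card_range, nsmul_eq_mul, CharP.cast_eq_zero,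
        zero_mul])
  have hzS : ∀ q ∈ S, z q.out = 2 := by
    intro q hq
    obtain ⟨b, hb⟩ := hS2 q hq
    have h1 : Φ q.out * ρ x = Φ q.out := by
      have h2 : q.out⁻¹ * x = x ^ b * q.out⁻¹ := by rw [← hb]; group
      rw [hΦ, mul_assoc, ← map_mul, h2, map_mul, ← mul_assoc, mul_assoc (ρ q.out) P,
        mul_pow_rep_eq hPx]
    have h3 : (z q.out : ℚ) = 2 := by
      rw [← hz, LinearMap.trace_mul_comm, hP, mul_fixedProj_eq hp0 h1, htrΦ]
    exact_mod_cast h3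
  have hS4 : ∑ q ∈ S, (z q.out : ZMod p) = ∑ q ∈ S, ((2 : ℤ) : ZMod p) :=
    Finset.sum_congr rfl fun q hq => by rw [hzS q hq]
  rw [hS4, Finset.sum_const, nsmul_eq_mul, hS1] at hS3
  have hN := card_quotient_zpowers_cast_ne_zero (orderOf_eq_prime hx hx1) h.card
  have h4 : ((p : ℤ) + 1) * ∑ q : G ⧸ Subgroup.zpowers x, z q.out
      = 4 * (Fintype.card (G ⧸ Subgroup.zpowers x) : ℤ) := by
    have : (((p : ℤ) + 1) * ∑ q : G ⧸ Subgroup.zpowers x, z q.out : ℚ)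
      = 4 * (Fintype.card (G ⧸ Subgroup.zpowers x) : ℤ) := by
      push_cast
      rw [htr2]
      linear_combination 2 * htr1
    exact_mod_cast this
  have h5 := congrArg (Int.cast : ℤ → ZMod p) h4
  push_cast at h5
  rw [hS3, CharP.cast_eq_zero, zero_add, one_mul, Nat.card_eq_fintype_card] at h5
  rw [Nat.card_eq_fintype_card] at hN
  have h6 : (2 : ZMod p) * Fintype.card (G ⧸ Subgroup.zpowers x) = 0 := by
    push_cast at h5 ⊢
    linear_combination -h5
  rcases mul_eq_zero.1 h6 with h7 | h7
  · have : ((2 : ℕ) : ZMod p) = 0 := by exact_mod_cast h7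
    rw [ZMod.natCast_eq_zero_iff] at this
    exact absurd (Nat.le_of_dvd two_pos this) (by omega)
  · exact hN h7

end IsThetaRep

end ThetaRep

section CyclotomicIdentity

open Polynomial

theorem X_pow_prime_sub_one_dvd (p : ℕ) [hp : Fact p.Prime] :
    (X ^ p - 1 : ℤ[X]) ∣
      C (p : ℤ) - ∑ i ∈ Finset.range p, X ^ i - ∏ j ∈ Finset.range (p - 1), (1 - X ^ (j + 1)) := by
  have hp1 := hp.out.one_lt
  rw [← map_dvd_map (Int.castRingHom ℚ) Int.cast_injective (by
    simpa using monic_X_pow_sub_C (1 : ℤ) hp.out.ne_zero)]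
  simp only [Polynomial.map_sub, Polynomial.map_pow, map_X, Polynomial.map_one,
    Polynomial.map_sum, Polynomial.map_prod, eq_intCast, Int.cast_natCast]
  rw [← cyclotomic_prime_mul_X_sub_one ℚ p, ← cyclotomic_one]
  refine (cyclotomic.isCoprime_rat hp1.ne').mul_dvd ?_ ?_
  · have hζ := Complex.isPrimitiveRoot_exp p hp.out.ne_zero
    rw [cyclotomic_eq_minpoly_rat hζ hp.out.pos]
    refine minpoly.dvd ℚ _ ?_
    have h1 := hζ.geom_sum_eq_zero hp1
    rw [show p = (p - 1) + 1 by omega] at hζ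
    have h2 := hζ.prod_one_sub_pow_eq_order
    have h3 : ((p - 1 : ℕ) : ℂ) + 1 = p := by
      rw [Nat.cast_sub hp1.le]; simp
    rw [h3, show (p - 1) + 1 = p by omega] at h2
    simp only [map_sub, map_sum, map_prod, map_pow, map_one, aeval_X]
    rw [h1, h2]
    simp
  · rw [cyclotomic_one, ← C_1, dvd_iff_isRoot, IsRoot.def]
    simp [eval_finsetSum, eval_prod]
    omega

theorem exists_sub_geom_sum_eq (p : ℕ) [hp : Fact p.Prime] (hp2 : 2 < p) :
    ∃ η κ : ℤ[X], C (p : ℤ) - ∑ i ∈ Finset.range p, X ^ i =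
      (X - 1) ^ (p - 1) * η + (X ^ p - 1) * κ ∧ ¬ (p : ℤ) ∣ η.eval 1 := by
  obtain ⟨κ, hκ⟩ := X_pow_prime_sub_one_dvd p
  refine ⟨∏ j ∈ Finset.range (p - 1), ∑ i ∈ Finset.range (j + 1), X ^ i, κ, ?_, ?_⟩
  · rw [← hκ, ← Finset.card_range (p - 1), ← Finset.prod_const, Finset.card_range,
      ← Finset.prod_mul_distrib]
    have h1 : ∏ j ∈ Finset.range (p - 1), ((X - 1) * ∑ i ∈ Finset.range (j + 1), X ^ i)
        = ∏ j ∈ Finset.range (p - 1), (1 - X ^ (j + 1) : ℤ[X]) := by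
      have h2 : ∀ j : ℕ, ((X - 1) * ∑ i ∈ Finset.range (j + 1), X ^ i : ℤ[X])
          = (-1) * (1 - X ^ (j + 1)) := by
        intro j
        rw [mul_geom_sum]; ring
      rw [Finset.prod_congr rfl fun j _ => h2 j, Finset.prod_mul_distrib, Finset.prod_const,
        Finset.card_range, (hp.out.even_sub_one (by omega)).neg_one_pow, one_mul]
    rw [h1]
    ring
  · rw [eval_prod]
    simp only [eval_finsetSum, eval_pow, eval_X, one_pow, Finset.sum_const, Finset.card_range,
      nsmul_eq_mul, mul_one]
    rw [Prime.dvd_finsetProd_iff (Nat.prime_iff_prime_int.1 hp.out)]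
    rintro ⟨j, hj, h⟩
    have := Finset.mem_range.1 hj
    have h2 := Nat.le_of_dvd (by omega) (Int.natCast_dvd_natCast.1 h)
    omega

end CyclotomicIdentity

section ThetaRep

open Module Polynomial

variable {G V : Type*} [Group G] [AddCommGroup V] [Module ℚ V] {p : ℕ}
  {ρ : Representation ℚ G V} {x : G} {θ : End ℚ V} {F : V →ₗ[ℚ] V →ₗ[ℚ] ℚ}
  {L : Submodule ℤ V}

theorem IsStableLattice.aeval_mem (hL : IsStableLattice ρ θ L) (P : ℤ[X]) {v : V} (hv : v ∈ L) :
    aeval (ρ x) P v ∈ L := by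
  induction P using Polynomial.induction_on with
  | C a =>
    rw [aeval_C, algebraMap_int_eq, eq_intCast, Module.End.intCast_apply]
    exact L.smul_mem a hv
  | add P Q hP hQ =>
    rw [map_add, LinearMap.add_apply]
    exact L.add_mem hP hQ
  | monomial n a h =>
    rw [pow_succ', ← mul_assoc, mul_comm (C a) X, mul_assoc, map_mul, Module.End.mul_apply, aeval_X]
    exact hL.rep_mem _ _ h

theorem exists_sub_fixedProj_eq [hp : Fact p.Prime] (hp2 : 2 < p) (hx : x ^ p = 1) :
    ∃ η : ℤ[X], (p : ℚ) • (1 - fixedProj p ρ x) = (ρ x - 1) ^ (p - 1) * aeval (ρ x) η ∧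
      ¬ (p : ℤ) ∣ η.eval 1 := by
  obtain ⟨η, κ, h, h1⟩ := exists_sub_geom_sum_eq p hp2
  refine ⟨η, ?_, h1⟩
  have h2 := congrArg (aeval (ρ x)) h
  simp only [map_sub, map_add, map_mul, map_pow, map_one, aeval_X, map_sum] at h2
  rw [← map_pow ρ x p, hx, map_one, sub_self, zero_mul, add_zero] at h2
  rw [← h2, fixedProj, smul_sub, smul_smul, mul_inv_cancel₀ (by exact_mod_cast hp.out.ne_zero),
    one_smul]
  simp only [map_pow]
  congr 1
  ext v
  simp [Nat.cast_smul_eq_nsmul]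

namespace IsThetaRep

theorem theta_theta (h : IsThetaRep p ρ θ F) (v : V) : θ (θ v) = -((p : ℚ) • v) := by
  rw [← Module.End.mul_apply, h.sq]; rfl

theorem theta_sub_one_pow (h : IsThetaRep p ρ θ F) (g : G) (i : ℕ) (v : V) :
    θ (((ρ g - 1) ^ i) v) = ((ρ g - 1) ^ i) (θ v) := by
  have : Commute θ ((ρ g - 1) ^ i) :=
    ((show Commute θ (ρ g) from h.comm g).sub_right (Commute.one_right _)).pow_right i
  rw [← Module.End.mul_apply, this.eq]; rfl

theorem exists_pow_notMem [Finite G] [hp : Fact p.Prime] (h : IsThetaRep p ρ θ F) (hp2 : 2 < p)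
    {n : ℕ} (hn : 2 * n = p + 1) (hL : IsStableLattice ρ θ L) (hx : x ^ p = 1) (hx1 : x ≠ 1) :
    ∃ v ∈ L, ∀ a ∈ L, ((ρ x - 1) ^ (n - 1)) v ≠ θ a := by
  by_contra! hcon
  obtain ⟨v, hv, hπ⟩ := h.exists_fixedProj_notMem hp2 hL hx hx1
  apply hπ
  obtain ⟨a, ha, h1⟩ := hcon v hv
  obtain ⟨b, hb, h2⟩ := hcon a ha
  obtain ⟨η, h3, -⟩ := exists_sub_fixedProj_eq (ρ := ρ) hp2 hx
  have h4 : ((ρ x - 1) ^ (p - 1)) v = -((p : ℚ) • b) := by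
    rw [show p - 1 = (n - 1) + (n - 1) by omega, pow_add, Module.End.mul_apply, h1,
      ← h.theta_sub_one_pow, h2, h.theta_theta]
  have hc : Commute ((ρ x - 1) ^ (p - 1)) (aeval (ρ x) η) := by
    have : (ρ x - 1) ^ (p - 1) = aeval (ρ x) ((X - 1) ^ (p - 1) : ℤ[X]) := by simp
    rw [this]
    rw [Commute, SemiconjBy, ← map_mul, mul_comm, map_mul]
  have h5 := LinearMap.congr_fun h3 v
  rw [hc.eq] at h5
  rw [LinearMap.smul_apply, LinearMap.sub_apply, Module.End.mul_apply, h4, map_neg, map_smul,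
    ← smul_neg] at h5
  have h6 := smul_right_injective V (show (p : ℚ) ≠ 0 by exact_mod_cast hp.out.ne_zero) h5
  have h7 : fixedProj p ρ x v = v + aeval (ρ x) η b := by
    rw [Module.End.one_apply] at h6
    rw [← sub_eq_zero]
    rw [← sub_eq_zero] at h6
    rw [← neg_eq_zero, ← h6]
    abel
  rw [h7]
  exact L.add_mem hv (hL.aeval_mem _ hb)

end IsThetaRep

end ThetaRep

section Reduction

open Module Polynomial

/-- `M`, with its action `ρ'`, is the reduction of the lattice `L` modulo `θ`, by means of the
map `q`. -/
structure IsThetaReduction {G V M : Type*} [Group G] [AddCommGroup V] [Module ℚ V] {p : ℕ}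
    [AddCommGroup M] [Module (ZMod p) M] (ρ : Representation ℚ G V) (θ : End ℚ V)
    (L : Submodule ℤ V) (ρ' : Representation (ZMod p) G M) (q : L →+ M) : Prop where
  surjective : Function.Surjective q
  eq_zero_iff : ∀ a, q a = 0 ↔ ∃ b ∈ L, (a : V) = θ b
  rep_apply : ∀ g (a b : L), (b : V) = ρ g a → ρ' g (q a) = q b

theorem exists_map_of_preserves {V M : Type*} [AddCommGroup V] [Module ℚ V] {p : ℕ}
    [AddCommGroup M] [Module (ZMod p) M] {θ : End ℚ V} {L : Submodule ℤ V} {q : L →+ M}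
    (hq : Function.Surjective q) (hq0 : ∀ a, q a = 0 ↔ ∃ b ∈ L, (a : V) = θ b)
    {φ : End ℚ V} (hφ : ∀ v ∈ L, φ v ∈ L) (hφθ : φ * θ = θ * φ) :
    ∃ φ' : End (ZMod p) M, ∀ a b : L, (b : V) = φ a → φ' (q a) = q b := by
  let ψ : L →+ L := ((φ.restrictScalars ℤ).restrict hφ).toAddMonoidHom
  have hker : q.ker ≤ (q.comp ψ).ker := by
    intro a ha
    obtain ⟨b, hb, hab⟩ := (hq0 a).1 ha
    refine (hq0 (ψ a)).2 ⟨φ b, hφ b hb, ?_⟩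
    change φ a = _
    rw [hab, ← Module.End.mul_apply, hφθ]; rfl
  refine ⟨AddMonoidHom.toZModLinearMap p (q.liftOfSurjective hq ⟨q.comp ψ, hker⟩), ?_⟩
  intro a b hab
  have : b = ψ a := Subtype.ext hab
  rw [this]
  exact AddMonoidHom.liftOfRightInverse_comp_apply q (Function.surjInv hq)
    (Function.rightInverse_surjInv hq) ⟨q.comp ψ, hker⟩ a

universe u

variable {G : Type*} {V : Type u} [Group G] [AddCommGroup V] [Module ℚ V] {p : ℕ}
  {ρ : Representation ℚ G V} {x : G} {θ : End ℚ V} {F : V →ₗ[ℚ] V →ₗ[ℚ] ℚ}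
  {L : Submodule ℤ V}

theorem IsThetaRep.exists_quotient [hp : Fact p.Prime] (h : IsThetaRep p ρ θ F)
    {n : ℕ} (hn : 2 * n = p + 1) (hL : IsStableLattice ρ θ L) :
    ∃ (M : Type u) (_ : AddCommGroup M) (_ : Module (ZMod p) M) (q : L →+ M),
      Function.Surjective q ∧ (∀ a, q a = 0 ↔ ∃ b ∈ L, (a : V) = θ b) ∧
      finrank (ZMod p) M = n := by
  have := hL.isLattice
  have := h.finiteDimensional
  let t : L →ₗ[ℤ] L := (θ.restrictScalars ℤ).restrict hL.theta_mem
  have ht : ∀ a, ((t a : L) : V) = θ a := fun a => rfl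
  have htt : t * t = (-(p : ℤ)) • 1 := by
    ext a
    change θ (θ a) = _
    rw [h.theta_theta]
    simp [Nat.cast_smul_eq_nsmul]
  have hpt : ∀ a : L, (p : ℤ) • a ∈ LinearMap.range t := by
    intro a
    refine ⟨-t a, ?_⟩
    rw [map_neg, ← Module.End.mul_apply, htt]
    simp
  have htinj : Function.Injective t := by
    intro a b hab
    have h1 := congrArg t hab
    rw [← Module.End.mul_apply, ← Module.End.mul_apply, htt] at h1
    simp only [LinearMap.smul_apply, Module.End.one_apply] at h1
    exact smul_right_injective L (neg_ne_zero.2 (by exact_mod_cast hp.out.ne_zero)) h1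
  have hdet : (LinearMap.det t).natAbs = p ^ n := by
    have h1 := congrArg LinearMap.det htt
    rw [map_mul, LinearMap.det_smul, map_one, mul_one] at h1
    have h2 := congrArg Int.natAbs h1
    have h3 : finrank ℤ L = p + 1 := by
      rw [← h.finrank_eq, finrank, finrank, Submodule.IsLattice.rank' ℚ L]
    rw [Int.natAbs_mul, Int.natAbs_pow, Int.natAbs_neg, Int.natAbs_natCast, h3, ← hn, mul_comm 2,
      pow_mul] at h2
    rw [← pow_two] at h2
    exact Nat.pow_left_injective two_ne_zero h2
  have hcard : Nat.card (L ⧸ LinearMap.range t) = p ^ n := by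
    rw [← hdet, ← Submodule.natAbs_det_equiv _ (LinearEquiv.ofInjective t htinj)]
    rfl
  let : Module (ZMod p) (L ⧸ LinearMap.range t) := AddCommGroup.zmodModule (by
    intro m
    obtain ⟨a, rfl⟩ := Submodule.mkQ_surjective _ m
    rw [← map_nsmul, Submodule.mkQ_apply, Submodule.Quotient.mk_eq_zero, ← natCast_zsmul]
    exact hpt a)
  let q : L →+ L ⧸ LinearMap.range t := (LinearMap.range t).mkQ.toAddMonoidHom
  have hq : Function.Surjective q := Submodule.mkQ_surjective _
  have hq0 : ∀ a, q a = 0 ↔ ∃ b ∈ L, (a : V) = θ b := by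
    intro a
    change Submodule.Quotient.mk a = 0 ↔ _
    rw [Submodule.Quotient.mk_eq_zero, LinearMap.mem_range]
    constructor
    · rintro ⟨b, rfl⟩
      exact ⟨b, b.2, rfl⟩
    · rintro ⟨b, hb, hab⟩
      exact ⟨⟨b, hb⟩, Subtype.ext hab.symm⟩
  refine ⟨_, _, inferInstance, q, hq, hq0, ?_⟩
  have hfin : Finite (L ⧸ LinearMap.range t) :=
    Nat.finite_of_card_ne_zero (by rw [hcard]; exact pow_ne_zero _ hp.out.ne_zero)
  have := Fintype.ofFinite (L ⧸ LinearMap.range t)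
  have h1 := Module.card_eq_pow_finrank (K := ZMod p) (V := L ⧸ LinearMap.range t)
  rw [← Nat.card_eq_fintype_card, hcard, ZMod.card] at h1
  exact (Nat.pow_right_injective hp.out.two_le h1).symm

theorem IsThetaRep.exists_reduction [hp : Fact p.Prime] (h : IsThetaRep p ρ θ F)
    {n : ℕ} (hn : 2 * n = p + 1) (hL : IsStableLattice ρ θ L) :
    ∃ (M : Type u) (_ : AddCommGroup M) (_ : Module (ZMod p) M) (ρ' : Representation (ZMod p) G M)
      (q : L →+ M), IsThetaReduction ρ θ L ρ' q ∧ finrank (ZMod p) M = n := by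
  obtain ⟨M, _, _, q, hq, hq0, hn⟩ := h.exists_quotient hn hL
  have hex : ∀ g : G, ∃ φ' : End (ZMod p) M,
      ∀ a b : L, (b : V) = ρ g a → φ' (q a) = q b := fun g =>
    exists_map_of_preserves hq hq0 (hL.rep_mem g) (h.comm g).symm
  choose r hr using hex
  let ρ' : Representation (ZMod p) G M :=
    { toFun := r
      map_one' := by
        ext m
        obtain ⟨a, rfl⟩ := hq m
        rw [hr 1 a a (by rw [map_one]; rfl)]; rfl
      map_mul' := by
        intro g k
        ext m
        obtain ⟨a, rfl⟩ := hq m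
        rw [Module.End.mul_apply, hr k a ⟨ρ k a, hL.rep_mem k a a.2⟩ rfl,
          hr g _ ⟨ρ g (ρ k a), hL.rep_mem g _ (hL.rep_mem k a a.2)⟩ rfl]
        exact hr _ _ _ (by rw [map_mul]; rfl) }
  exact ⟨M, _, _, ρ', q, ⟨hq, hq0, hr⟩, hn⟩

end Reduction

section Polynomial

open Polynomial

theorem aeval_int_apply_of_apply_eq {k M : Type*} [Field k] [AddCommGroup M] [Module k M]
    {T : Module.End k M} {w : M} (hw : T w = w) (P : ℤ[X]) :
    aeval T P w = ((P.eval 1 : ℤ) : k) • w := by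
  induction P using Polynomial.induction_on with
  | C a =>
    rw [aeval_C, algebraMap_int_eq, eq_intCast, Module.End.intCast_apply, eval_C,
      Int.cast_smul_eq_zsmul]
  | add P Q hP hQ =>
    rw [map_add, LinearMap.add_apply, hP, hQ, eval_add, Int.cast_add, add_smul]
  | monomial n a h =>
    rw [pow_succ', ← mul_assoc, mul_comm (C a) X, mul_assoc, map_mul, Module.End.mul_apply, aeval_X,
      h, map_smul, hw, eval_mul (p := X), eval_X, one_mul]

end Polynomial

section Reduction

open Module Polynomial

variable {G V M : Type*} [Group G] [AddCommGroup V] [Module ℚ V] {p : ℕ}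
  {ρ : Representation ℚ G V} {x : G} {θ : End ℚ V} {F : V →ₗ[ℚ] V →ₗ[ℚ] ℚ}
  {L : Submodule ℤ V} [AddCommGroup M] [Module (ZMod p) M] {ρ' : Representation (ZMod p) G M}
  {q : L →+ M}

namespace IsThetaReduction

theorem aeval_apply (hr : IsThetaReduction ρ θ L ρ' q) (hL : IsStableLattice ρ θ L) (P : ℤ[X])
    (a b : L) (hb : (b : V) = aeval (ρ x) P a) : aeval (ρ' x) P (q a) = q b := by
  induction P using Polynomial.induction_on generalizing b with
  | C c =>
    rw [aeval_C, algebraMap_int_eq, eq_intCast, Module.End.intCast_apply] at hb ⊢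
    rw [← map_zsmul]
    exact congrArg q (Subtype.ext hb.symm)
  | add P Q hP hQ =>
    rw [map_add, LinearMap.add_apply, hP ⟨_, hL.aeval_mem P a.2⟩ rfl,
      hQ ⟨_, hL.aeval_mem Q a.2⟩ rfl, ← map_add]
    exact congrArg q (Subtype.ext (by rw [hb, map_add]; rfl))
  | monomial n c h =>
    rw [pow_succ', ← mul_assoc, mul_comm (C c) X, mul_assoc, map_mul, Module.End.mul_apply,
      aeval_X] at hb ⊢
    rw [h ⟨_, hL.aeval_mem _ a.2⟩ rfl]
    exact hr.rep_apply _ _ _ hb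

theorem sub_one_pow_apply (hr : IsThetaReduction ρ θ L ρ' q) (hL : IsStableLattice ρ θ L) (i : ℕ)
    (a b : L) (hb : (b : V) = ((ρ x - 1) ^ i) a) : ((ρ' x - 1) ^ i) (q a) = q b := by
  have := hr.aeval_apply (x := x) hL ((X - 1) ^ i) a b (by simpa using hb)
  simpa using this

end IsThetaReduction

theorem IsStableLattice.sub_one_pow_mem (hL : IsStableLattice ρ θ L) (x : G) (i : ℕ) {v : V}
    (hv : v ∈ L) : ((ρ x - 1) ^ i) v ∈ L := by
  have := hL.aeval_mem (x := x) ((X - 1) ^ i) hv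
  simpa using this

theorem sub_one_pow_prime_eq_zero [hp : Fact p.Prime] (hx : x ^ p = 1) : (ρ' x - 1) ^ p = 0 := by
  have h := congrArg (aeval (ρ' x)) (sub_pow_char (X : (ZMod p)[X]) 1 (p := p))
  simp only [map_sub, map_pow, map_one, aeval_X, one_pow] at h
  rw [h, ← map_pow, hx, map_one, sub_self]

namespace IsThetaReduction

theorem isJordanBlock [Finite G] [hp : Fact p.Prime] (h : IsThetaRep p ρ θ F) (hp2 : 2 < p)
    {n : ℕ} (hn : 2 * n = p + 1) (hL : IsStableLattice ρ θ L) (hr : IsThetaReduction ρ θ L ρ' q)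
    (hfin : finrank (ZMod p) M = n) (hx : x ^ p = 1) (hx1 : x ≠ 1) :
    IsJordanBlock n (ρ' x - 1) where
  finrank_eq := hfin
  pow_eq_zero := by
    have : FiniteDimensional (ZMod p) M := FiniteDimensional.of_finrank_pos (by omega)
    have h1 := Module.End.ker_pow_eq_ker_pow_finrank_of_le (f := ρ' x - 1) (m := p) (by omega)
    rw [sub_one_pow_prime_eq_zero hx, LinearMap.ker_zero, hfin] at h1
    exact LinearMap.ker_eq_top.1 h1.symm
  pow_pred_ne_zero := by
    intro h0
    obtain ⟨v, hv, hva⟩ := h.exists_pow_notMem hp2 hn hL hx hx1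
    have h1 := hr.sub_one_pow_apply (x := x) hL (n - 1) ⟨v, hv⟩ ⟨_, hL.sub_one_pow_mem x (n - 1) hv⟩
      rfl
    rw [h0, LinearMap.zero_apply] at h1
    obtain ⟨b, hb, hab⟩ := (hr.eq_zero_iff _).1 h1.symm
    exact hva b hb hab

end IsThetaReduction

/-- The preimage in `V` of a subgroup of the reduction. -/
def latticePreimage (q : L →+ M) (W : Submodule (ZMod p) M) : Submodule ℤ V :=
  AddSubgroup.toIntSubmodule ((W.toAddSubgroup.comap q).map L.subtype.toAddMonoidHom)

theorem mem_latticePreimage {W : Submodule (ZMod p) M} {v : V} :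
    v ∈ latticePreimage q W ↔ ∃ h : v ∈ L, q ⟨v, h⟩ ∈ W := by
  constructor
  · rintro ⟨a, ha, rfl⟩
    exact ⟨a.2, ha⟩
  · rintro ⟨h, hW⟩
    exact ⟨⟨v, h⟩, hW, rfl⟩

namespace IsThetaReduction

theorem isStableLattice_latticePreimage [hp : Fact p.Prime] (h : IsThetaRep p ρ θ F)
    (hL : IsStableLattice ρ θ L) (hr : IsThetaReduction ρ θ L ρ' q) {W : Submodule (ZMod p) M}
    (hW : ∀ g, ∀ m ∈ W, ρ' g m ∈ W) : IsStableLattice ρ θ (latticePreimage q W) := by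
  have hθ : ∀ v ∈ L, θ v ∈ latticePreimage q W := by
    intro v hv
    refine mem_latticePreimage.2 ⟨hL.theta_mem v hv, ?_⟩
    rw [(hr.eq_zero_iff _).2 ⟨v, hv, rfl⟩]
    exact W.zero_mem
  have hle : latticePreimage q W ≤ L := fun v hv => (mem_latticePreimage.1 hv).1
  have := hL.isLattice
  refine ⟨⟨this.fg.of_le hle, ?_⟩, ?_, fun v hv => hθ v (hle hv)⟩
  · rw [eq_top_iff, ← this.span_eq_top, Submodule.span_le]
    intro v hv
    have h1 : -((p : ℚ) • v) ∈ Submodule.span ℚ (latticePreimage q W : Set V) := by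
      rw [← h.theta_theta]
      exact Submodule.subset_span (hθ _ (hL.theta_mem v hv))
    have h2 := Submodule.smul_mem _ (-(p : ℚ)⁻¹) h1
    rwa [neg_smul, smul_neg, neg_neg, smul_smul,
      inv_mul_cancel₀ (by exact_mod_cast hp.out.ne_zero), one_smul] at h2
  · intro g v hv
    obtain ⟨hv, hvW⟩ := mem_latticePreimage.1 hv
    refine mem_latticePreimage.2 ⟨hL.rep_mem g v hv, ?_⟩
    rw [← hr.rep_apply g ⟨v, hv⟩ _ rfl]
    exact hW g _ hvW

theorem exists_reduced_theta_inv [hp : Fact p.Prime] (h : IsThetaRep p ρ θ F)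
    {n : ℕ} (hL : IsStableLattice ρ θ L) (hr : IsThetaReduction ρ θ L ρ' q)
    (hu : (ρ' x - 1) ^ n = 0) : ∃ δ : End ℚ V, (∀ v ∈ L, δ v ∈ L) ∧ θ * δ = (ρ x - 1) ^ n ∧
      δ * θ = θ * δ ∧ δ * (ρ x - 1) = (ρ x - 1) * δ := by
  have hp0 : (p : ℚ) ≠ 0 := by exact_mod_cast hp.out.ne_zero
  have hc : Commute θ ((ρ x - 1) ^ n) :=
    ((show Commute θ (ρ x) from h.comm x).sub_right (Commute.one_right _)).pow_right n
  have hcx : Commute θ (ρ x - 1) :=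
    (show Commute θ (ρ x) from h.comm x).sub_right (Commute.one_right _)
  have hcd : ∀ Y, Commute Y θ → Commute Y (ρ x - 1) →
      (-(p : ℚ)⁻¹) • (θ * (ρ x - 1) ^ n) * Y = Y * (-(p : ℚ)⁻¹) • (θ * (ρ x - 1) ^ n) :=
    fun Y h1 h2 => (((h1.mul_right (h2.pow_right n)).smul_right _).eq).symm
  have hθδ : θ * (-(p : ℚ)⁻¹) • (θ * (ρ x - 1) ^ n) = (ρ x - 1) ^ n := by
    rw [mul_smul_comm, ← mul_assoc, h.sq, neg_mul, smul_mul_assoc, one_mul, neg_smul, smul_neg,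
      neg_neg, smul_smul, inv_mul_cancel₀ hp0, one_smul]
  refine ⟨(-(p : ℚ)⁻¹) • (θ * (ρ x - 1) ^ n), ?_, hθδ, hcd _ (Commute.refl _) hcx,
    hcd _ hcx.symm (Commute.refl _)⟩
  intro v hv
  have h1 := hr.sub_one_pow_apply (x := x) hL n ⟨v, hv⟩ ⟨_, hL.sub_one_pow_mem x n hv⟩ rfl
  rw [hu, LinearMap.zero_apply] at h1
  obtain ⟨b, hb, hab⟩ := (hr.eq_zero_iff _).1 h1.symm
  simp only [] at hab
  rw [LinearMap.smul_apply, Module.End.mul_apply, hab, h.theta_theta, neg_smul, smul_neg, neg_neg,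
    smul_smul, inv_mul_cancel₀ hp0, one_smul]
  exact hb

theorem irreducible [Finite G] [hp : Fact p.Prime] (h : IsThetaRep p ρ θ F) (hp2 : 2 < p)
    {n : ℕ} (hn : 2 * n = p + 1) (hL : IsStableLattice ρ θ L) (hr : IsThetaReduction ρ θ L ρ' q)
    (hfin : finrank (ZMod p) M = n) (hx : x ^ p = 1) (hx1 : x ≠ 1) (W : Submodule (ZMod p) M)
    (hW : ∀ g, ∀ m ∈ W, ρ' g m ∈ W) : W = ⊥ ∨ W = ⊤ := by
  by_contra! hcon
  obtain ⟨hbot, htop⟩ := hcon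
  have hp0 : (p : ℚ) ≠ 0 := by exact_mod_cast hp.out.ne_zero
  have hJ := hr.isJordanBlock h hp2 hn hL hfin hx hx1
  obtain ⟨u, hu⟩ : ∃ u, u = ρ' x - 1 := ⟨_, rfl⟩
  rw [← hu] at hJ
  have huW : ∀ m ∈ W, u m ∈ W := by
    intro m hm
    rw [hu, LinearMap.sub_apply]
    exact W.sub_mem (hW x m hm) hm
  have hupW : ∀ i, ∀ m ∈ W, (u ^ i) m ∈ W := by
    intro i
    induction i with
    | zero => intro m hm; simpa using hm
    | succ i ih => intro m hm; rw [pow_succ', Module.End.mul_apply]; exact huW _ (ih m hm)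
  have hkill : ∀ m ∈ W, (u ^ (n - 1)) m = 0 := by
    intro m hm
    by_contra hne
    apply htop
    rw [eq_top_iff]
    intro w _
    obtain ⟨c, rfl⟩ := hJ.exists_sum_eq hne w
    exact W.sum_mem fun i _ => W.smul_mem _ (hupW i m hm)
  obtain ⟨v0, hv0⟩ := hJ.exists_cyclic
  have hker : ∀ m, u m = 0 → m ∈ W := by
    classical
    intro m hm
    obtain ⟨w, hw, hw0⟩ := (Submodule.ne_bot_iff _).1 hbot
    have hex : ∃ k, (u ^ k) w = 0 := ⟨n, by rw [hJ.pow_eq_zero]; rfl⟩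
    have hk0 : Nat.find hex ≠ 0 := by
      intro h0
      have := Nat.find_spec hex
      rw [h0] at this
      exact hw0 (by simpa using this)
    have hk1 := Nat.find_min hex (m := Nat.find hex - 1) (by omega)
    have hk2 : u ((u ^ (Nat.find hex - 1)) w) = 0 := by
      rw [← Module.End.mul_apply, ← pow_succ', show Nat.find hex - 1 + 1 = Nat.find hex by omega]
      exact Nat.find_spec hex
    obtain ⟨c, hc⟩ := hJ.exists_smul_of_apply_eq_zero hv0 hm
    obtain ⟨c', hc'⟩ := hJ.exists_smul_of_apply_eq_zero hv0 hk2
    have hc0 : c' ≠ 0 := by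
      rintro rfl
      exact hk1 (by rw [hc', zero_smul])
    have : m = (c / c') • (u ^ (Nat.find hex - 1)) w := by
      rw [hc', smul_smul, div_mul_cancel₀ _ hc0, hc]
    rw [this]
    exact W.smul_mem _ (hupW _ w hw)
  have hL' := hr.isStableLattice_latticePreimage h hL hW
  obtain ⟨v, hv, hva⟩ := h.exists_pow_notMem hp2 hn hL' hx hx1
  obtain ⟨hvL, hvW⟩ := mem_latticePreimage.1 hv
  have h1 := hr.sub_one_pow_apply (x := x) hL (n - 1) ⟨v, hvL⟩
    ⟨_, hL.sub_one_pow_mem x (n - 1) hvL⟩ rfl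
  rw [← hu, hkill _ hvW] at h1
  obtain ⟨a, ha, hab⟩ := (hr.eq_zero_iff _).1 h1.symm
  change ((ρ x - 1) ^ (n - 1)) v = θ a at hab
  refine hva a (mem_latticePreimage.2 ⟨ha, ?_⟩) hab
  obtain ⟨δ, hδL, hθδ, hδθ, hδx⟩ := hr.exists_reduced_theta_inv h (x := x) (n := n) hL
    (by rw [← hu, hJ.pow_eq_zero])
  have hθinj : Function.Injective θ := by
    intro b c hbc
    have := congrArg θ hbc
    rw [h.theta_theta, h.theta_theta, neg_inj] at this
    exact smul_right_injective V hp0 this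
  have hδv : δ v = (ρ x - 1) a := by
    apply hθinj
    rw [← Module.End.mul_apply, hθδ, show n = 1 + (n - 1) by omega, pow_add, Module.End.mul_apply,
      hab, pow_one]
    simpa using (h.theta_sub_one_pow x 1 a).symm
  obtain ⟨δ', hδ'⟩ := exists_map_of_preserves (p := p) hr.surjective hr.eq_zero_iff hδL hδθ
  have hcomm : Commute δ' u := by
    ext m
    obtain ⟨b, rfl⟩ := hr.surjective m
    have e1 := hr.sub_one_pow_apply (x := x) hL 1 b ⟨_, hL.sub_one_pow_mem x 1 b.2⟩ rfl
    have e2 := hr.sub_one_pow_apply (x := x) hL 1 ⟨δ b, hδL b b.2⟩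
      ⟨_, hL.sub_one_pow_mem x 1 (hδL b b.2)⟩ rfl
    rw [pow_one, ← hu] at e1 e2
    rw [Module.End.mul_apply, Module.End.mul_apply, hδ' b ⟨δ b, hδL b b.2⟩ rfl, e1, e2]
    refine hδ' _ _ ?_
    simp only [pow_one]
    rw [← Module.End.mul_apply, ← Module.End.mul_apply, hδx]
  obtain ⟨c, hc⟩ := hJ.exists_eq_of_commute hcomm
  obtain ⟨η, hη, hη1⟩ := exists_sub_fixedProj_eq (ρ := ρ) hp2 hx
  have hδδη : δ * δ * aeval (ρ x) η = -((ρ x - 1) ^ 2) := by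
    have e1 : (p : ℚ) • (δ * δ) = -((ρ x - 1) ^ 2 * (ρ x - 1) ^ (p - 1)) := by
      rw [← pow_add, show 2 + (p - 1) = n + n by omega, pow_add, ← hθδ]
      have : θ * δ * (θ * δ) = (θ * θ) * (δ * δ) := by
        rw [mul_assoc, ← mul_assoc δ θ δ, hδθ]; simp only [mul_assoc]
      rw [this, h.sq, neg_mul, neg_neg, smul_mul_assoc, one_mul]
    have e2 : (ρ x - 1) * fixedProj p ρ x = 0 := by
      rw [sub_mul, rep_mul_fixedProj hx, one_mul, sub_self]
    apply smul_right_injective _ hp0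
    simp only []
    rw [← smul_mul_assoc, e1, neg_mul, mul_assoc, ← hη, mul_smul_comm, mul_sub, mul_one, pow_two,
      mul_assoc (ρ x - 1) (ρ x - 1), e2, mul_zero, sub_zero, smul_neg]
  have hn1 : 1 < n := by omega
  have hδηq : ∀ m, δ' (δ' (aeval (ρ' x) η m)) = -(u ^ 2) m := by
    intro m
    obtain ⟨b, rfl⟩ := hr.surjective m
    have e2 := hr.sub_one_pow_apply (x := x) hL 2 b ⟨_, hL.sub_one_pow_mem x 2 b.2⟩ rfl
    rw [hr.aeval_apply hL η b ⟨_, hL.aeval_mem η b.2⟩ rfl, hδ' _ ⟨_, hδL _ (hL.aeval_mem η b.2)⟩ rfl,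
      hδ' _ ⟨_, hδL _ (hδL _ (hL.aeval_mem η b.2))⟩ rfl, hu, e2, ← map_neg]
    refine congrArg q (Subtype.ext ?_)
    exact LinearMap.congr_fun hδδη (b : V)
  have hc0 : c 0 = 0 := by
    have hw1 : u ((u ^ (n - 1)) v0) = 0 := by
      rw [← Module.End.mul_apply, ← pow_succ', show n - 1 + 1 = n by omega, hJ.pow_eq_zero]; rfl
    have hδw : δ' ((u ^ (n - 1)) v0) = c 0 • (u ^ (n - 1)) v0 := by
      rw [hc, LinearMap.sum_apply, Finset.sum_eq_single 0]
      · simp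
      · intro i _ hi
        rw [LinearMap.smul_apply, show i = (i - 1) + 1 by omega, pow_succ, Module.End.mul_apply, hw1,
          map_zero, smul_zero]
      · intro h0; exact absurd (Finset.mem_range.2 (by omega)) h0
    have hρw : ρ' x ((u ^ (n - 1)) v0) = (u ^ (n - 1)) v0 := by
      rw [hu, LinearMap.sub_apply, sub_eq_zero] at hw1
      rw [hu]
      exact hw1
    have e1 := hδηq ((u ^ (n - 1)) v0)
    rw [aeval_int_apply_of_apply_eq hρw, map_smul, map_smul, hδw, map_smul, hδw, pow_two,
      Module.End.mul_apply, hw1, map_zero, neg_zero, smul_smul, smul_smul] at e1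
    have e2 := (smul_eq_zero.1 e1).resolve_right hv0
    rw [mul_eq_zero, mul_eq_zero, ZMod.intCast_zmod_eq_zero_iff_dvd] at e2
    tauto
  have huq : u (q ⟨a, ha⟩) = u (∑ i ∈ Finset.range (n - 1), c (i + 1) • (u ^ i) (q ⟨v, hvL⟩)) := by
    have e1 := hr.sub_one_pow_apply (x := x) hL 1 ⟨a, ha⟩ ⟨δ v, hδL v hvL⟩ (by
      rw [pow_one]; exact hδv)
    rw [pow_one, ← hu, ← hδ' ⟨v, hvL⟩ ⟨δ v, hδL v hvL⟩ rfl, hc, LinearMap.sum_apply,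
      show n = n - 1 + 1 by omega,
      Finset.sum_range_succ', hc0, zero_smul, LinearMap.zero_apply, add_zero] at e1
    rw [e1, map_sum]
    refine Finset.sum_congr rfl fun i _ => ?_
    rw [map_smul, pow_succ', LinearMap.smul_apply, Module.End.mul_apply]
  have hfinal := hker (q ⟨a, ha⟩ - ∑ i ∈ Finset.range (n - 1), c (i + 1) • (u ^ i) (q ⟨v, hvL⟩))
    (by rw [map_sub, huq, sub_self])
  rw [← sub_add_cancel (q ⟨a, ha⟩) (∑ i ∈ Finset.range (n - 1), c (i + 1) • (u ^ i) (q ⟨v, hvL⟩))]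
  exact W.add_mem hfinal (W.sum_mem fun i _ => W.smul_mem _ (hupW i _ hvW))

end IsThetaReduction

end Reduction

section Reduction

open Module

theorem exists_pos_mul_form_eq_intCast {V : Type*} [AddCommGroup V] [Module ℚ V]
    {L : Submodule ℤ V} (hL : L.FG) (F : V →ₗ[ℚ] V →ₗ[ℚ] ℚ) :
    ∃ N : ℕ, 0 < N ∧ ∀ v ∈ L, ∀ w ∈ L, ∃ z : ℤ, N * F v w = z := by
  obtain ⟨S, rfl⟩ := hL
  refine ⟨∏ a ∈ S, ∏ b ∈ S, (F a b).den,
    Finset.prod_pos fun a _ => Finset.prod_pos fun b _ => (F a b).den_pos, ?_⟩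
  intro v hv w hw
  induction hv, hw using Submodule.span_induction₂ with
  | mem_mem a b ha hb =>
    have h1 : (F a b).den ∣ ∏ a ∈ S, ∏ b ∈ S, (F a b).den :=
      (Finset.dvd_prod_of_mem (fun b => (F a b).den) hb).trans
        (Finset.dvd_prod_of_mem (fun a => ∏ b ∈ S, (F a b).den) ha)
    obtain ⟨k, hk⟩ := h1
    refine ⟨k * (F a b).num, ?_⟩
    rw [hk]
    push_cast
    have := Rat.mul_den_eq_num (F a b)
    linear_combination (k : ℚ) * this
  | zero_left b _ => exact ⟨0, by simp⟩
  | zero_right a _ => exact ⟨0, by simp⟩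
  | add_left a b c _ _ _ h1 h2 =>
    obtain ⟨z, hz⟩ := h1
    obtain ⟨z', hz'⟩ := h2
    exact ⟨z + z', by rw [map_add, LinearMap.add_apply]; rw [Int.cast_add, ← hz, ← hz']; ring⟩
  | add_right a b c _ _ _ h1 h2 =>
    obtain ⟨z, hz⟩ := h1
    obtain ⟨z', hz'⟩ := h2
    exact ⟨z + z', by rw [map_add]; rw [Int.cast_add, ← hz, ← hz']; ring⟩
  | smul_left c a b _ _ h1 =>
    obtain ⟨z, hz⟩ := h1
    refine ⟨c * z, ?_⟩
    rw [← Int.cast_smul_eq_zsmul ℚ, map_smul, LinearMap.smul_apply, smul_eq_mul]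
    rw [Int.cast_mul, ← hz]
    ring
  | smul_right c a b _ _ h1 =>
    obtain ⟨z, hz⟩ := h1
    refine ⟨c * z, ?_⟩
    rw [← Int.cast_smul_eq_zsmul ℚ, map_smul, smul_eq_mul]
    rw [Int.cast_mul, ← hz]
    ring

/-- A form that is integral on a lattice, and divisible by `p` on a sublattice, descends to the
quotient. -/
theorem exists_form_of_dvd {V M : Type*} [AddCommGroup V] [Module ℚ V] {p : ℕ}
    {L : Submodule ℤ V} [AddCommGroup M] [Module (ZMod p) M] {q : L →+ M}
    (hq : Function.Surjective q) {H : V →ₗ[ℚ] V →ₗ[ℚ] ℚ}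
    (hHL : ∀ a ∈ L, ∀ b ∈ L, ∃ z : ℤ, H a b = z)
    (hleft : ∀ a b : L, q a = 0 → ∃ z : ℤ, H a b = p * z)
    (hright : ∀ a b : L, q b = 0 → ∃ z : ℤ, H a b = p * z) :
    ∃ B : M →ₗ[ZMod p] M →ₗ[ZMod p] ZMod p,
      ∀ (a b : L) (z : ℤ), H a b = z → B (q a) (q b) = z := by
  have hHL' : ∀ a b : L, ∃ z : ℤ, H a b = z := fun a b => hHL a a.2 b b.2
  choose f hf using hHL'
  have hfz : ∀ (a b : L) (z : ℤ), H a b = z → f a b = z := by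
    intro a b z hz
    rw [hf] at hz
    exact_mod_cast hz
  have hadd1 : ∀ a a' b, f (a + a') b = f a b + f a' b := fun a a' b => hfz _ _ _ (by
    rw [Submodule.coe_add, map_add, LinearMap.add_apply, hf, hf]; push_cast; rfl)
  have hadd2 : ∀ a b b', f a (b + b') = f a b + f a b' := fun a b b' => hfz _ _ _ (by
    rw [Submodule.coe_add, map_add, hf, hf]; push_cast; rfl)
  have hz : ∀ a b, (q a = 0 ∨ q b = 0) → ((f a b : ℤ) : ZMod p) = 0 := by
    intro a b hab
    obtain ⟨z, hz⟩ : ∃ z : ℤ, H a b = p * z := hab.elim (hleft a b) (hright a b)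
    have := hfz a b (p * z) (by push_cast; exact hz)
    rw [this]
    simp
  have hwd : ∀ a a' b b', q a = q a' → q b = q b' → ((f a b : ℤ) : ZMod p) = f a' b' := by
    intro a a' b b' h1 h2
    have e1 : f a b = f (a - a') b + f a' (b - b') + f a' b' := by
      rw [add_assoc, ← hadd2, sub_add_cancel, ← hadd1, sub_add_cancel]
    rw [e1]
    push_cast
    rw [hz (a - a') b (Or.inl (by rw [map_sub, h1, sub_self])),
      hz a' (b - b') (Or.inr (by rw [map_sub, h2, sub_self])), zero_add, zero_add]
  obtain ⟨s, hs⟩ := hq.hasRightInverse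
  let f2 : M → M →ₗ[ZMod p] ZMod p := fun m => AddMonoidHom.toZModLinearMap p
    (AddMonoidHom.mk' (fun m' => (f (s m) (s m') : ZMod p)) (by
      intro a b
      rw [← Int.cast_add, ← hadd2]
      exact hwd _ _ _ _ rfl (by rw [map_add, hs, hs, hs])))
  have hf2 : ∀ m m', f2 m m' = (f (s m) (s m') : ZMod p) := fun _ _ => rfl
  refine ⟨AddMonoidHom.toZModLinearMap p (AddMonoidHom.mk' f2 (by
    intro a b
    ext m
    rw [LinearMap.add_apply, hf2, hf2, hf2, ← Int.cast_add, ← hadd1]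
    exact hwd _ _ _ _ (by rw [map_add, hs, hs, hs]) rfl)), ?_⟩
  intro a b z hz
  change f2 (q a) (q b) = z
  rw [hf2, ← hfz a b z hz]
  exact hwd _ _ _ _ (hs _) (hs _)

universe u

variable {G : Type*} {V : Type u} {M : Type*} [Group G] [AddCommGroup V] [Module ℚ V] {p : ℕ}
  {ρ : Representation ℚ G V} {x : G} {θ : End ℚ V} {F : V →ₗ[ℚ] V →ₗ[ℚ] ℚ}
  {L : Submodule ℤ V} [AddCommGroup M] [Module (ZMod p) M] {ρ' : Representation (ZMod p) G M}
  {q : L →+ M}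

namespace IsThetaReduction

theorem injective [Finite G] [hp : Fact p.Prime] (h : IsThetaRep p ρ θ F) (hp2 : 2 < p)
    {n : ℕ} (hn : 2 * n = p + 1) (hL : IsStableLattice ρ θ L) (hr : IsThetaReduction ρ θ L ρ' q)
    (hfin : finrank (ZMod p) M = n) : Function.Injective ρ' := by
  rw [injective_iff_map_eq_one]
  by_contra! hcon
  obtain ⟨g₀, hg₀, hg₀1⟩ := hcon
  have hK : Nat.card ρ'.ker ≠ 1 := by
    intro hK
    rw [Subgroup.card_eq_one] at hK
    exact hg₀1 (by simpa [hK] using (MonoidHom.mem_ker (f := ρ')).2 hg₀)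
  obtain ⟨r, hr', hrK⟩ := Nat.exists_prime_and_dvd hK
  have := Fact.mk hr'
  obtain ⟨⟨g, hg⟩, hgr⟩ := exists_prime_orderOf_dvd_card' r hrK
  rw [Subgroup.orderOf_mk] at hgr
  rw [MonoidHom.mem_ker] at hg
  have hg1 : g ≠ 1 := by
    rintro rfl
    rw [orderOf_one] at hgr
    exact hr'.ne_one hgr.symm
  have hgr' : g ^ r = 1 := by rw [← hgr, pow_orderOf_eq_one]
  by_cases hrp : r = p
  · rw [hrp] at hgr'
    refine (hr.isJordanBlock h hp2 hn hL hfin hgr' hg1).pow_pred_ne_zero ?_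
    rw [hg, sub_self, zero_pow (by omega)]
  have hLat := hL.isLattice
  obtain ⟨N, hN, hNF⟩ := exists_pos_mul_form_eq_intCast hLat.fg F
  have hp0 : (p : ℚ) ≠ 0 := by exact_mod_cast hp.out.ne_zero
  obtain ⟨s, hs⟩ : ∃ s, s = ∑ i ∈ Finset.range r, ρ g ^ i := ⟨_, rfl⟩
  have hsθ : s * θ = θ * s := by
    rw [hs, Finset.mul_sum, Finset.sum_mul]
    exact Finset.sum_congr rfl fun i _ =>
      (((show Commute θ (ρ g) from h.comm g).pow_right i).eq).symm
  have hθinj : Function.Injective θ := by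
    intro b c hbc
    have := congrArg θ hbc
    rw [h.theta_theta, h.theta_theta, neg_inj] at this
    exact smul_right_injective V hp0 this
  have hqs : ∀ w ∈ L, s w = 0 → ∃ w' ∈ L, w = θ w' := by
    intro w hw hsw
    have hmem : ∀ i : ℕ, (ρ g ^ i) w ∈ L := by
      intro i
      rw [← map_pow]
      exact hL.rep_mem _ _ hw
    have h1 : ∑ i ∈ Finset.range r, q ⟨_, hmem i⟩ = 0 := by
      rw [← map_sum, ← map_zero q]
      refine congrArg q (Subtype.ext ?_)
      rw [Submodule.coe_sum]
      change ∑ i ∈ Finset.range r, (ρ g ^ i) w = 0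
      rw [← LinearMap.sum_apply, ← hs, hsw]
    have h2 : ∀ i, q ⟨_, hmem i⟩ = q ⟨w, hw⟩ := by
      intro i
      rw [← hr.rep_apply (g ^ i) ⟨w, hw⟩ ⟨_, hmem i⟩ (by rw [map_pow]), map_pow, hg, one_pow]
      rfl
    rw [Finset.sum_congr rfl fun i _ => h2 i, Finset.sum_const, Finset.card_range,
      ← Nat.cast_smul_eq_nsmul (ZMod p)] at h1
    have h3 : (r : ZMod p) ≠ 0 := by
      rw [Ne, ZMod.natCast_eq_zero_iff, Nat.prime_dvd_prime_iff_eq hp.out hr']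
      exact fun h => hrp h.symm
    exact (hr.eq_zero_iff _).1 ((smul_eq_zero.1 h1).resolve_left h3)
  have hdesc : ∀ k : ℕ, ∀ w ∈ L, s w = 0 → N * F w w = k → w = 0 := by
    intro k
    induction k using Nat.strong_induction_on with
    | _ k ih =>
      intro w hw hsw hk
      by_contra hw0
      have hpos := mul_pos (show (0 : ℚ) < N by exact_mod_cast hN) (h.form_pos w hw0)
      obtain ⟨w', hw', rfl⟩ := hqs w hw hsw
      have hw0' : w' ≠ 0 := by
        rintro rfl
        exact hw0 (map_zero θ)
      have hpos' := mul_pos (show (0 : ℚ) < N by exact_mod_cast hN) (h.form_pos w' hw0')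
      have hFw : F (θ w') (θ w') = p * F w' w' := by
        rw [h.skew, h.theta_theta, map_neg, map_smul, neg_neg, smul_eq_mul]
      have hsw' : s w' = 0 := by
        apply hθinj
        rw [← Module.End.mul_apply, ← hsθ, Module.End.mul_apply, hsw, map_zero]
      obtain ⟨z, hz⟩ := hNF w' hw' w' hw'
      have hz0 : 0 < z := by
        rw [hz] at hpos'
        exact_mod_cast hpos'
      lift z to ℕ using hz0.le
      refine hw0' (ih z ?_ w' hw' hsw' (by rw [hz]; rfl))
      have h4 : (k : ℚ) = p * z := by
        rw [← hk, hFw]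
        push_cast at hz
        rw [← hz]
        ring
      have h5 : k = p * z := by exact_mod_cast h4
      rw [h5]
      have : 0 < z := by exact_mod_cast hz0
      nlinarith
  refine hg1 (h.injective ?_)
  rw [map_one]
  refine LinearMap.ext_on hLat.span_eq_top ?_
  intro v hv
  change ρ g v = v
  have hmem : ρ g v - v ∈ L := L.sub_mem (hL.rep_mem g v hv) hv
  have h1 : s (ρ g v - v) = 0 := by
    have h2 := LinearMap.congr_fun (geom_sum_mul (ρ g) r) v
    rw [← hs, ← map_pow, hgr', map_one, sub_self] at h2
    exact h2
  obtain ⟨z, hz⟩ := hNF _ hmem _ hmem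
  by_contra hne
  have hpos := mul_pos (show (0 : ℚ) < N by exact_mod_cast hN) (h.form_pos _ (sub_ne_zero.2 hne))
  rw [hz] at hpos
  have hz0 : 0 < z := by exact_mod_cast hpos
  lift z to ℕ using hz0.le
  exact hne (sub_eq_zero.1 (hdesc z _ hmem h1 (by rw [hz]; rfl)))

theorem exists_invariant_form_of_integral (hr : IsThetaReduction ρ θ L ρ' q)
    (hL : IsStableLattice ρ θ L)
    {H : V →ₗ[ℚ] V →ₗ[ℚ] ℚ} (hHL : ∀ a ∈ L, ∀ b ∈ L, ∃ z : ℤ, H a b = z)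
    (hleft : ∀ a ∈ L, ∀ b ∈ L, ∃ z : ℤ, H (θ a) b = p * z)
    (hright : ∀ a ∈ L, ∀ b ∈ L, ∃ z : ℤ, H a (θ b) = p * z)
    (hinv : ∀ g v w, H (ρ g v) (ρ g w) = H v w) {ε : ℤ} (hsymm : ∀ v w, H v w = ε * H w v)
    (hne : ∃ a ∈ L, ∃ b ∈ L, ∀ z : ℤ, H a b ≠ p * z) :
    ∃ B : M →ₗ[ZMod p] M →ₗ[ZMod p] ZMod p,
      (∀ g a b, B (ρ' g a) (ρ' g b) = B a b) ∧ (∀ a b, B a b = (ε : ZMod p) * B b a) ∧ B ≠ 0 := by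
  obtain ⟨B, hB⟩ := exists_form_of_dvd (p := p) hr.surjective hHL (by
    intro a b ha
    obtain ⟨c, hc, hac⟩ := (hr.eq_zero_iff a).1 ha
    rw [hac]
    exact hleft c hc b b.2) (by
    intro a b hb
    obtain ⟨c, hc, hac⟩ := (hr.eq_zero_iff b).1 hb
    rw [hac]
    exact hright a a.2 c hc)
  refine ⟨B, ?_, ?_, ?_⟩
  · intro g m m'
    obtain ⟨a, rfl⟩ := hr.surjective m
    obtain ⟨b, rfl⟩ := hr.surjective m'
    obtain ⟨z, hz⟩ := hHL a a.2 b b.2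
    rw [hB a b z hz, hr.rep_apply g a ⟨_, hL.rep_mem g a a.2⟩ rfl,
      hr.rep_apply g b ⟨_, hL.rep_mem g b b.2⟩ rfl]
    exact hB _ _ _ (by rw [← hz, ← hinv g a])
  · intro m m'
    obtain ⟨a, rfl⟩ := hr.surjective m
    obtain ⟨b, rfl⟩ := hr.surjective m'
    obtain ⟨z, hz⟩ := hHL b b.2 a a.2
    rw [hB b a z hz, hB a b (ε * z) (by rw [hsymm, hz]; push_cast; rfl)]
    push_cast
    rfl
  · rintro rfl
    obtain ⟨a, ha, b, hb, hab⟩ := hne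
    obtain ⟨z, hz⟩ := hHL a ha b hb
    have h1 := hB ⟨a, ha⟩ ⟨b, hb⟩ z hz
    rw [LinearMap.zero_apply, LinearMap.zero_apply, eq_comm,
      ZMod.intCast_zmod_eq_zero_iff_dvd] at h1
    obtain ⟨k, rfl⟩ := h1
    exact hab k (by rw [hz]; push_cast; rfl)

theorem exists_invariant_form [hp : Fact p.Prime] (h : IsThetaRep p ρ θ F)
    (hL : IsStableLattice ρ θ L) (hr : IsThetaReduction ρ θ L ρ' q) :
    ∃ (B : M →ₗ[ZMod p] M →ₗ[ZMod p] ZMod p) (ε : ZMod p), ε ^ 2 = 1 ∧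
      (∀ g a b, B (ρ' g a) (ρ' g b) = B a b) ∧ (∀ a b, B a b = ε * B b a) ∧ B ≠ 0 := by
  classical
  have hLat := hL.isLattice
  have hp0 : (p : ℚ) ≠ 0 := by exact_mod_cast hp.out.ne_zero
  obtain ⟨N, hN, hNF⟩ := exists_pos_mul_form_eq_intCast hLat.fg F
  have hNQ : (0 : ℚ) < N := by exact_mod_cast hN
  obtain ⟨v₀, hv₀, hv₀0⟩ : ∃ v ∈ L, v ≠ 0 := by
    by_contra! hcon
    have h1 := hLat.span_eq_top
    have h2 : Submodule.span ℚ (L : Set V) = ⊥ := by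
      rw [Submodule.span_eq_bot]
      exact hcon
    have h3 := h.finrank_eq
    rw [← finrank_top ℚ V, ← h1, h2, finrank_bot] at h3
    omega
  have hex : ∃ k : ℕ, ¬ ∀ a ∈ L, ∀ b ∈ L, ∃ z : ℤ, N * F a b = p ^ k * z := by
    obtain ⟨z, hz⟩ := hNF v₀ hv₀ v₀ hv₀
    have hz0 : 0 < z := by
      have := mul_pos hNQ (h.form_pos v₀ hv₀0)
      rw [hz] at this
      exact_mod_cast this
    refine ⟨z.natAbs, fun hcon => ?_⟩
    obtain ⟨y, hy⟩ := hcon v₀ hv₀ v₀ hv₀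
    rw [hz] at hy
    have h1 : z = (p : ℤ) ^ z.natAbs * y := by exact_mod_cast hy
    have h2 := Int.le_of_dvd hz0 ⟨y, h1⟩
    have h3 : z.natAbs < p ^ z.natAbs := Nat.lt_pow_self hp.out.one_lt
    have h4 : ((z.natAbs : ℕ) : ℤ) < (p : ℤ) ^ z.natAbs := by exact_mod_cast h3
    omega
  have hk0 : Nat.find hex ≠ 0 := by
    intro h0
    have h1 := Nat.find_spec hex
    rw [h0] at h1
    refine h1 fun a ha b hb => ?_
    obtain ⟨z, hz⟩ := hNF a ha b hb
    exact ⟨z, by rw [hz, pow_zero, one_mul]⟩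
  obtain ⟨k, hk⟩ := Nat.exists_eq_succ_of_ne_zero hk0
  have hHL := not_not.1 (Nat.find_min hex (m := k) (by omega))
  have hnot := Nat.find_spec hex
  rw [hk] at hnot
  push Not at hnot
  have hpk : (p : ℚ) ^ k ≠ 0 := pow_ne_zero _ hp0
  obtain ⟨H, hH⟩ : ∃ H : V →ₗ[ℚ] V →ₗ[ℚ] ℚ, ∀ v w, H v w = N / p ^ k * F v w :=
    ⟨((N : ℚ) / p ^ k) • F, fun v w => rfl⟩
  have hHint : ∀ a ∈ L, ∀ b ∈ L, ∃ z : ℤ, H a b = z := by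
    intro a ha b hb
    obtain ⟨z, hz⟩ := hHL a ha b hb
    refine ⟨z, ?_⟩
    rw [hH]
    field_simp
    exact hz
  have hHne : ∃ a ∈ L, ∃ b ∈ L, ∀ z : ℤ, H a b ≠ p * z := by
    obtain ⟨a, ha, b, hb, hab⟩ := hnot
    refine ⟨a, ha, b, hb, fun z hz => hab z ?_⟩
    rw [hH] at hz
    field_simp at hz
    rw [hz, Nat.succ_eq_add_one, pow_succ]
  have hHinv : ∀ g v w, H (ρ g v) (ρ g w) = H v w := fun g v w => by rw [hH, hH, h.inv]
  have hHsymm : ∀ v w, H v w = H w v := fun v w => by rw [hH, hH, h.symm]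
  have hHskew : ∀ v w, H (θ v) w = -H v (θ w) := fun v w => by rw [hH, hH, h.skew]; ring
  by_cases hdvd : ∀ a ∈ L, ∀ b ∈ L, ∃ z : ℤ, H a (θ b) = p * z
  · obtain ⟨B, h1, h2, h3⟩ := hr.exists_invariant_form_of_integral hL hHint (by
      intro a ha b hb
      obtain ⟨z, hz⟩ := hdvd a ha b hb
      exact ⟨-z, by rw [hHskew, hz]; push_cast; ring⟩) hdvd hHinv (ε := 1) (by
      intro v w
      rw [hHsymm]
      simp) hHne
    exact ⟨B, _, by simp, h1, h2, h3⟩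
  · push Not at hdvd
    have hH2 : ∀ v w, H.compl₂ θ v w = H v (θ w) := fun _ _ => rfl
    have hθ : ∀ v w, H v (θ (θ w)) = -(p * H v w) := by
      intro v w
      rw [h.theta_theta, map_neg, map_smul, smul_eq_mul]
    obtain ⟨B, h1, h2, h3⟩ := hr.exists_invariant_form_of_integral hL (H := H.compl₂ θ)
      (fun a ha b hb => hHint a ha _ (hL.theta_mem b hb)) (by
      intro a ha b hb
      obtain ⟨z, hz⟩ := hHint a ha b hb
      refine ⟨z, ?_⟩
      rw [hH2, hHskew, hθ, hz, neg_neg]) (by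
      intro a ha b hb
      obtain ⟨z, hz⟩ := hHint a ha b hb
      refine ⟨-z, ?_⟩
      rw [hH2, hθ, hz]
      push_cast
      ring) (by
      intro g v w
      rw [hH2, hH2, ← Module.End.mul_apply, h.comm, Module.End.mul_apply, hHinv]) (ε := -1) (by
      intro v w
      rw [hH2, hH2, hHsymm, hHskew]
      simp) hdvd
    exact ⟨B, _, by simp, h1, h2, h3⟩

end IsThetaReduction

theorem IsThetaRep.exists_isStableLattice [Finite G] (h : IsThetaRep p ρ θ F) :
    ∃ L : Submodule ℤ V, IsStableLattice ρ θ L := by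
  have := h.finiteDimensional
  have := Fintype.ofFinite G
  let b := Module.finBasis ℚ V
  let S : Set V := Set.range (fun i : G × Fin (finrank ℚ V) => ρ i.1 (b i.2))
  let S' : Set V := Set.range (fun i : G × Fin (finrank ℚ V) => θ (ρ i.1 (b i.2)))
  refine ⟨Submodule.span ℤ (S ∪ S'), ⟨Submodule.fg_span
    ((Set.finite_range _).union (Set.finite_range _)), ?_⟩, ?_, ?_⟩
  · rw [eq_top_iff, ← b.span_eq, Submodule.span_le]
    rintro _ ⟨i, rfl⟩
    refine Submodule.subset_span (Submodule.subset_span (Or.inl ⟨(1, i), ?_⟩))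
    simp
  · intro g v hv
    induction hv using Submodule.span_induction with
    | mem v hv =>
      refine Submodule.subset_span ?_
      rcases hv with ⟨⟨k, i⟩, rfl⟩ | ⟨⟨k, i⟩, rfl⟩
      · exact Or.inl ⟨(g * k, i), by simp⟩
      · refine Or.inr ⟨(g * k, i), ?_⟩
        simp only [map_mul, Module.End.mul_apply]
        rw [← Module.End.mul_apply, h.comm, Module.End.mul_apply]
    | zero => rw [map_zero]; exact Submodule.zero_mem _
    | add a b _ _ ha hb => rw [map_add]; exact Submodule.add_mem _ ha hb
    | smul c a _ ha => rw [map_zsmul]; exact Submodule.smul_mem _ c ha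
  · intro v hv
    induction hv using Submodule.span_induction with
    | mem v hv =>
      rcases hv with ⟨⟨k, i⟩, rfl⟩ | ⟨⟨k, i⟩, rfl⟩
      · exact Submodule.subset_span (Or.inr ⟨(k, i), rfl⟩)
      · simp only []
        rw [h.theta_theta, Nat.cast_smul_eq_nsmul, ← natCast_zsmul]
        exact Submodule.neg_mem _ (Submodule.smul_mem _ _
          (Submodule.subset_span (Or.inl ⟨(k, i), rfl⟩)))
    | zero => rw [map_zero]; exact Submodule.zero_mem _
    | add a b _ _ ha hb => rw [map_add]; exact Submodule.add_mem _ ha hb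
    | smul c a _ ha => rw [map_zsmul]; exact Submodule.smul_mem _ c ha

theorem IsThetaRep.nonempty_mulEquiv [Finite G] [hp : Fact p.Prime] (h : IsThetaRep p ρ θ F)
    (hp11 : 11 ≤ p) (hp4 : p % 4 = 3) (hx : x ^ p = 1) (hx1 : x ≠ 1) :
    Nonempty (G ≃* Matrix.SpecialLinearGroup (Fin 2) (ZMod p)) := by
  obtain ⟨n, hn⟩ : ∃ n, 2 * n = p + 1 := ⟨(p + 1) / 2, by omega⟩
  obtain ⟨L, hL⟩ := h.exists_isStableLattice
  obtain ⟨M, _, _, ρ', q, hr, hfin⟩ := h.exists_reduction hn hL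
  obtain ⟨B, ε, hε, hB, hBε, hB0⟩ := hr.exists_invariant_form h hL
  exact nonempty_mulEquiv_of_isJordanBlock hp11 hn (Nat.even_iff.2 (by omega))
    (hr.injective h (by omega) hn hL hfin) (hr.irreducible h (by omega) hn hL hfin hx hx1) h.card
    (hr.isJordanBlock h (by omega) hn hL hfin hx hx1) hB hε hBε hB0

end Reduction

section Cyclic

open Module Polynomial

variable {k V : Type*} [Field k] [AddCommGroup V] [Module k V]

/-- The evaluation map of polynomials in `T` at a vector `v`. -/
noncomputable def aevalApply (T : End k V) (v : V) : k[X] →ₗ[k] V :=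
  LinearMap.applyₗ v ∘ₗ (aeval T).toLinearMap

theorem aevalApply_apply (T : End k V) (v : V) (f : k[X]) : aevalApply T v f = aeval T f v := rfl

variable {T : End k V} {P : k[X]} {v : V}

theorem apply_eq_zero_of_isCoprime {f : k[X]} (h : IsCoprime f P) (hP : aeval T P v = 0)
    (hf : aeval T f v = 0) : v = 0 := by
  obtain ⟨a, b, hab⟩ := h
  have h1 := congrArg (fun Q => aeval T Q v) hab
  simpa [hP, hf] using h1.symm

theorem dvd_of_aeval_apply_eq_zero (hirr : Irreducible P) (hP : aeval T P v = 0) (hv : v ≠ 0)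
    {f : k[X]} (hf : aeval T f v = 0) : P ∣ f := by
  by_contra hdvd
  exact hv (apply_eq_zero_of_isCoprime ((hirr.coprime_iff_not_dvd.2 hdvd).symm) hP hf)

theorem finrank_range_aevalApply (hirr : Irreducible P) (hmon : P.Monic) (hP : aeval T P v = 0)
    (hv : v ≠ 0) : finrank k (LinearMap.range (aevalApply T v)) = P.natDegree := by
  have h1 : LinearMap.range (aevalApply T v) =
      LinearMap.range ((aevalApply T v).domRestrict (degreeLT k P.natDegree)) := by
    refine le_antisymm ?_ (LinearMap.range_domRestrict_le_range _ _)
    rintro _ ⟨f, rfl⟩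
    refine ⟨⟨f %ₘ P, ?_⟩, ?_⟩
    · rw [mem_degreeLT, ← degree_eq_natDegree hmon.ne_zero]
      exact degree_modByMonic_lt _ hmon
    · rw [LinearMap.domRestrict_apply, aevalApply_apply, aevalApply_apply]
      conv_rhs => rw [← modByMonic_add_div f P]
      simp [mul_comm P, hP]
  have hinj : Function.Injective ((aevalApply T v).domRestrict (degreeLT k P.natDegree)) := by
    rw [injective_iff_map_eq_zero]
    rintro ⟨f, hf⟩ hfv
    rw [mem_degreeLT, ← degree_eq_natDegree hmon.ne_zero] at hf
    exact Subtype.ext (eq_zero_of_dvd_of_degree_lt (dvd_of_aeval_apply_eq_zero hirr hP hv hfv) hf)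
  rw [h1, LinearMap.finrank_range_of_inj hinj, (degreeLTEquiv k P.natDegree).finrank_eq,
    finrank_fintype_fun_eq_card, Fintype.card_fin]

theorem range_aevalApply_le_ker (hP : aeval T P v = 0) :
    LinearMap.range (aevalApply T v) ≤ LinearMap.ker (aeval T P) := by
  rintro _ ⟨f, rfl⟩
  rw [LinearMap.mem_ker, aevalApply_apply, ← Module.End.mul_apply, ← map_mul, mul_comm, map_mul,
    Module.End.mul_apply, hP, map_zero]

/-- If the dimension is less than twice the degree of `P`, then the kernel of `P(T)` is cyclic. -/
theorem range_aevalApply_eq_ker [FiniteDimensional k V] (hirr : Irreducible P) (hmon : P.Monic)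
    (hP : aeval T P v = 0) (hv : v ≠ 0) (hdim : finrank k V < 2 * P.natDegree) :
    LinearMap.range (aevalApply T v) = LinearMap.ker (aeval T P) := by
  refine le_antisymm (range_aevalApply_le_ker hP) fun w hw => ?_
  rw [LinearMap.mem_ker] at hw
  by_contra hwv
  have hw0 : w ≠ 0 := fun h => hwv (h ▸ Submodule.zero_mem _)
  have hdisj : Disjoint (LinearMap.range (aevalApply T v)) (LinearMap.range (aevalApply T w)) := by
    rw [Submodule.disjoint_def]
    rintro _ ⟨g, rfl⟩ ⟨f, hf⟩
    by_contra hne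
    rw [aevalApply_apply, aevalApply_apply] at hf
    by_cases hdvd : P ∣ f
    · obtain ⟨c, rfl⟩ := hdvd
      rw [mul_comm, map_mul, Module.End.mul_apply, hw, map_zero] at hf
      exact hne hf.symm
    · obtain ⟨a, b, hab⟩ := hirr.coprime_iff_not_dvd.2 hdvd
      refine hwv ⟨b * g, ?_⟩
      have h1 := congrArg (fun Q => aeval T Q w) hab
      simp only [map_add, map_mul, LinearMap.add_apply, Module.End.mul_apply, hw, hf, map_zero,
        zero_add, map_one, Module.End.one_apply] at h1
      rw [aevalApply_apply, map_mul, Module.End.mul_apply, h1]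
  have h1 := Submodule.finrank_add_finrank_le_of_disjoint hdisj
  rw [finrank_range_aevalApply hirr hmon hP hv, finrank_range_aevalApply hirr hmon hw hw0] at h1
  omega

theorem commute_aeval {χ : End k V} (hχ : Commute χ T) (f : k[X]) : Commute χ (aeval T f) := by
  induction f using Polynomial.induction_on' with
  | add f g hf hg => rw [map_add]; exact hf.add_right hg
  | monomial n a =>
    rw [aeval_monomial]
    exact (Algebra.commute_algebraMap_right a χ).mul_right (hχ.pow_right n)

theorem apply_aeval_apply {χ : End k V} (hχ : Commute χ T) (f : k[X]) (u : V) :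
    χ (aeval T f u) = aeval T f (χ u) :=
  LinearMap.congr_fun (commute_aeval hχ f).eq u

/-- Endomorphisms commuting with `T` commute with each other on a cyclic subspace. -/
theorem apply_comm_of_mem_range_aevalApply {φ ψ : End k V} (hφ : Commute φ T) (hψ : Commute ψ T)
    {w : V} (hφv : φ v ∈ LinearMap.range (aevalApply T v))
    (hψv : ψ v ∈ LinearMap.range (aevalApply T v))
    (hw : w ∈ LinearMap.range (aevalApply T v)) : φ (ψ w) = ψ (φ w) := by
  obtain ⟨f, hf⟩ := hφv
  obtain ⟨g, hg⟩ := hψv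
  obtain ⟨h, rfl⟩ := hw
  rw [aevalApply_apply] at hf hg ⊢
  rw [apply_aeval_apply hψ, ← hg, apply_aeval_apply hφ, apply_aeval_apply hφ, apply_aeval_apply hφ,
    ← hf, apply_aeval_apply hψ, apply_aeval_apply hψ, ← hg]
  congr 1
  rw [← Module.End.mul_apply, ← Module.End.mul_apply, ← map_mul, ← map_mul, mul_comm]

end Cyclic

section PrimeOrder

open Module Polynomial

variable {V : Type*} [AddCommGroup V] [Module ℚ V] {p : ℕ} [hp : Fact p.Prime] {T : End ℚ V}

theorem isCompl_ker_cyclotomic (hT : T ^ p = 1) :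
    IsCompl (LinearMap.ker (aeval T (cyclotomic p ℚ))) (LinearMap.ker (T - 1)) := by
  have hcop : IsCoprime (cyclotomic p ℚ) (X - 1 : ℚ[X]) := by
    rw [← cyclotomic_one ℚ]
    exact cyclotomic.isCoprime_rat hp.out.ne_one
  have h1 : aeval T (X - 1 : ℚ[X]) = T - 1 := by simp
  rw [← h1]
  refine ⟨disjoint_ker_aeval_of_isCoprime T hcop, ?_⟩
  rw [codisjoint_iff, sup_ker_aeval_eq_ker_aeval_mul_of_coprime T hcop,
    cyclotomic_prime_mul_X_sub_one]
  simp [hT]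

theorem exists_mem_ker_cyclotomic (hT : T ^ p = 1) (hT1 : T ≠ 1) :
    ∃ v, aeval T (cyclotomic p ℚ) v = 0 ∧ v ≠ 0 := by
  by_contra! hcon
  have h1 : LinearMap.ker (aeval T (cyclotomic p ℚ)) = ⊥ := (Submodule.eq_bot_iff _).2 hcon
  have h2 := (isCompl_ker_cyclotomic hT).sup_eq_top
  rw [h1, bot_sup_eq, LinearMap.ker_eq_top, sub_eq_zero] at h2
  exact hT1 h2

theorem range_aevalApply_eq_ker_cyclotomic (hp3 : 3 < p) (hV : finrank ℚ V = p + 1) {v : V}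
    (hv : aeval T (cyclotomic p ℚ) v = 0) (hv0 : v ≠ 0) :
    LinearMap.range (aevalApply T v) = LinearMap.ker (aeval T (cyclotomic p ℚ)) := by
  have : FiniteDimensional ℚ V := FiniteDimensional.of_finrank_pos (by omega)
  refine range_aevalApply_eq_ker (cyclotomic.irreducible_rat hp.out.pos) (cyclotomic.monic _ _) hv
    hv0 ?_
  rw [natDegree_cyclotomic, Nat.totient_prime hp.out, hV]
  omega

theorem finrank_ker_cyclotomic (hp3 : 3 < p) (hV : finrank ℚ V = p + 1) (hT : T ^ p = 1)
    (hT1 : T ≠ 1) : finrank ℚ (LinearMap.ker (aeval T (cyclotomic p ℚ))) = p - 1 := by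
  obtain ⟨v, hv, hv0⟩ := exists_mem_ker_cyclotomic hT hT1
  rw [← range_aevalApply_eq_ker_cyclotomic hp3 hV hv hv0, finrank_range_aevalApply
    (cyclotomic.irreducible_rat hp.out.pos) (cyclotomic.monic _ _) hv hv0, natDegree_cyclotomic,
    Nat.totient_prime hp.out]

theorem finrank_ker_sub_one (hp3 : 3 < p) (hV : finrank ℚ V = p + 1) (hT : T ^ p = 1)
    (hT1 : T ≠ 1) : finrank ℚ (LinearMap.ker (T - 1)) = 2 := by
  have : FiniteDimensional ℚ V := FiniteDimensional.of_finrank_pos (by omega)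
  have h1 := Submodule.finrank_add_eq_of_isCompl (isCompl_ker_cyclotomic hT)
  rw [finrank_ker_cyclotomic hp3 hV hT hT1, hV] at h1
  omega

theorem apply_mem_ker_cyclotomic {φ : End ℚ V} (hφ : Commute φ T) {v : V}
    (hv : aeval T (cyclotomic p ℚ) v = 0) : aeval T (cyclotomic p ℚ) (φ v) = 0 := by
  rw [← apply_aeval_apply hφ, hv, map_zero]

/-- Endomorphisms commuting with `T` commute with each other on the kernel of the cyclotomic
polynomial. -/
theorem apply_comm_of_mem_ker_cyclotomic (hp3 : 3 < p) (hV : finrank ℚ V = p + 1) {φ ψ : End ℚ V}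
    (hφ : Commute φ T) (hψ : Commute ψ T) {w : V} (hw : aeval T (cyclotomic p ℚ) w = 0) :
    φ (ψ w) = ψ (φ w) := by
  by_cases hw0 : w = 0
  · simp [hw0]
  have h1 := range_aevalApply_eq_ker_cyclotomic hp3 hV hw hw0
  exact apply_comm_of_mem_range_aevalApply (v := w) hφ hψ
    (by rw [h1]; exact apply_mem_ker_cyclotomic hφ hw)
    (by rw [h1]; exact apply_mem_ker_cyclotomic hψ hw) (by rw [h1]; exact hw)

end PrimeOrder

section QuadraticCyclotomic

variable {p : ℕ} [hp : Fact p.Prime] {K : Type*} [Field K] [Algebra ℚ K]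
  [IsCyclotomicExtension {p} ℚ K]

theorem exists_sq_eq_mul_cyclotomic (K) [Field K] [Algebra ℚ K]
    [IsCyclotomicExtension {p} ℚ K] (hp2 : p ≠ 2) : ∃ g : K, ∃ ε : ℤ,
    g ^ 2 = ε * p ∧ (ε = 1 ∨ ε = -1) ∧ (p % 4 ≠ 3 → ε = 1) := by
  have : CharZero K := algebraRat.charZero K
  have : NeZero p := ⟨hp.out.ne_zero⟩
  have hχ : quadraticChar (ZMod p) ≠ 1 := quadraticChar_ne_one (by rwa [ZMod.ringChar_zmod_n])
  have hne : (-1 : ZMod p) ≠ 0 := neg_ne_zero.2 one_ne_zero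
  refine ⟨gaussSum ((quadraticChar (ZMod p)).ringHomComp (Int.castRingHom K))
    (AddChar.zmodChar p (IsCyclotomicExtension.zeta_spec p ℚ K).pow_eq_one),
    quadraticChar (ZMod p) (-1), ?_, quadraticChar_dichotomy hne, ?_⟩
  · rw [gaussSum_sq ((MulChar.ringHomComp_ne_one_iff (RingHom.injective_int _)).2 hχ)
      ((quadraticChar_isQuadratic _).comp _)
      (AddChar.zmodChar_primitive_of_primitive_root p
        (IsCyclotomicExtension.zeta_spec p ℚ K)), ZMod.card]
    rfl
  · intro h
    rw [quadraticChar_one_iff_isSquare hne]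
    exact ZMod.exists_sq_eq_neg_one_iff.2 h

theorem exists_rat_sq_eq_of_sq_eq_cyclotomic (hp2 : p ≠ 2) {α : ℚ} (hα : α < 0)
    {a : K} (ha : a ^ 2 = algebraMap ℚ _ α) :
    p % 4 = 3 ∧ ∃ r : ℚ, r ^ 2 = -(α * p) := by
  have : NeZero p := ⟨hp.out.ne_zero⟩
  have hpQ : (0 : ℚ) < p := by exact_mod_cast hp.out.pos
  obtain ⟨g, ε, hg, hε, hε4⟩ := exists_sq_eq_mul_cyclotomic K hp2
  have : IsGalois ℚ K := IsCyclotomicExtension.isGalois {p} ℚ K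
  have : FiniteDimensional ℚ K := IsCyclotomicExtension.finiteDimensional {p} ℚ K
  have : IsCyclic Gal(K/ℚ) :=
    (IsCyclotomicExtension.autEquivPow K
      (Polynomial.cyclotomic.irreducible_rat hp.out.pos)).isCyclic.2 inferInstance
  obtain ⟨σ, hσ⟩ := IsCyclic.exists_generator (α := Gal(K/ℚ))
  have hfix : ∀ x : K, σ x = x → ∃ r : ℚ, algebraMap ℚ _ r = x := by
    intro x hx
    rw [← Set.mem_range, ← IntermediateField.mem_bot, IsGalois.mem_bot_iff_fixed]
    intro τ
    have h1 : Subgroup.zpowers σ ≤ MulAction.stabilizer Gal(K/ℚ) x :=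
      Subgroup.zpowers_le.2 (MulAction.mem_stabilizer_iff.2 hx)
    exact MulAction.mem_stabilizer_iff.1 (h1 (hσ τ))
  have hsq : ∀ (x : K) (c : ℚ), x ^ 2 = algebraMap ℚ _ c →
      (¬ ∃ r : ℚ, r ^ 2 = c) → σ x = -x := by
    intro x c hx hc
    have h1 : σ x ^ 2 = x ^ 2 := by rw [← map_pow, hx, AlgEquiv.commutes]
    rcases sq_eq_sq_iff_eq_or_eq_neg.1 h1 with h | h
    · obtain ⟨r, rfl⟩ := hfix x h
      rw [← map_pow] at hx
      exact absurd ⟨r, (algebraMap ℚ K).injective hx⟩ hc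
    · exact h
  have hσa : σ a = -a := hsq a α ha (by
    rintro ⟨r, hr⟩
    exact absurd (sq_nonneg r) (by rw [hr]; exact not_le.2 hα))
  have hσg : σ g = -g := hsq g (ε * p) (by rw [hg, map_mul, map_intCast, map_natCast]) (by
    rintro ⟨r, hr⟩
    rcases hε with rfl | rfl
    · rw [Int.cast_one, one_mul] at hr
      refine (Nat.Prime.irrational_sqrt hp.out) ⟨|r|, ?_⟩
      have h1 : (r : ℝ) ^ 2 = p := by exact_mod_cast hr
      rw [← h1, Real.sqrt_sq_eq_abs, Rat.cast_abs]
    · rw [Int.cast_neg, Int.cast_one] at hr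
      nlinarith [sq_nonneg r])
  obtain ⟨r, hr⟩ := hfix (a * g) (by rw [map_mul, hσa, hσg, neg_mul_neg])
  have hr2 : r ^ 2 = α * (ε * p) := by
    apply (algebraMap ℚ K).injective
    rw [map_pow, hr, mul_pow, ha, hg, map_mul, map_mul, map_intCast, map_natCast]
  have hε1 : ε = -1 := by
    refine hε.resolve_left ?_
    rintro rfl
    rw [Int.cast_one, one_mul] at hr2
    nlinarith [sq_nonneg r]
  refine ⟨?_, r, ?_⟩
  · by_contra h
    rw [hε4 h] at hε1
    norm_num at hε1
  · rw [hr2, hε1]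
    push_cast
    ring

end QuadraticCyclotomic

section SymplecticRep

open Module Polynomial

/-- A faithful irreducible rational representation of dimension `p + 1`, with an invariant positive
definite form `F` and an invariant nondegenerate alternating form `A`. -/
structure IsSymplecticRep {G V : Type*} [Group G] [AddCommGroup V] [Module ℚ V] (p : ℕ)
    (ρ : Representation ℚ G V) (F A : V →ₗ[ℚ] V →ₗ[ℚ] ℚ) : Prop where
  finrank_eq : finrank ℚ V = p + 1
  injective : Function.Injective ρ
  irreducible : ∀ W : Submodule ℚ V, (∀ g, ∀ v ∈ W, ρ g v ∈ W) → W = ⊥ ∨ W = ⊤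
  symm : ∀ v w, F v w = F w v
  form_pos : ∀ v, v ≠ 0 → 0 < F v v
  inv : ∀ g v w, F (ρ g v) (ρ g w) = F v w
  skew : ∀ v w, A v w = -A w v
  nondegenerate : ∀ v, (∀ w, A v w = 0) → v = 0
  skew_inv : ∀ g v w, A (ρ g v) (ρ g w) = A v w

namespace IsSymplecticRep

variable {G V : Type*} [Group G] [AddCommGroup V] [Module ℚ V] {p : ℕ}
  {ρ : Representation ℚ G V} {F A : V →ₗ[ℚ] V →ₗ[ℚ] ℚ} {x : G}

theorem finiteDimensional (h : IsSymplecticRep p ρ F A) : FiniteDimensional ℚ V :=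
  FiniteDimensional.of_finrank_pos (by rw [h.finrank_eq]; omega)

theorem form_ext (h : IsSymplecticRep p ρ F A) {v w : V} (hvw : ∀ u, F v u = F w u) : v = w := by
  by_contra hne
  have h1 := h.form_pos _ (sub_ne_zero.2 hne)
  rw [map_sub F v w, LinearMap.sub_apply, hvw, sub_self] at h1
  exact lt_irrefl _ h1

theorem eq_zero_of_apply_eq_zero (h : IsSymplecticRep p ρ F A) {φ : End ℚ V}
    (hφ : ∀ g, φ * ρ g = ρ g * φ) {v : V} (hv : v ≠ 0) (hφv : φ v = 0) : φ = 0 := by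
  rcases h.irreducible (LinearMap.ker φ) (by
    intro g w hw
    rw [LinearMap.mem_ker] at hw ⊢
    rw [← Module.End.mul_apply, hφ, Module.End.mul_apply, hw, map_zero]) with h1 | h1
  · exact absurd ((Submodule.mem_bot ℚ).1 (h1 ▸ LinearMap.mem_ker.2 hφv)) hv
  · exact LinearMap.ker_eq_top.1 h1

theorem map_pow_eq_one (hx : x ^ p = 1) : ρ x ^ p = 1 := by rw [← map_pow, hx, map_one]

theorem map_ne_one (h : IsSymplecticRep p ρ F A) (hx1 : x ≠ 1) : ρ x ≠ 1 :=
  fun h1 => hx1 (h.injective (h1.trans (map_one ρ).symm))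

theorem exists_theta (h : IsSymplecticRep p ρ F A) : ∃ t : End ℚ V,
    (∀ v w, F (t v) w = A v w) ∧ (∀ g, t * ρ g = ρ g * t) ∧ ∀ v w, F (t v) w = -F v (t w) := by
  have := h.finiteDimensional
  let e : V ≃ₗ[ℚ] Dual ℚ V := LinearMap.linearEquivOfInjective F
    (fun v w hvw => h.form_ext fun u => LinearMap.congr_fun hvw u) Subspace.dual_finrank_eq.symm
  have ht : ∀ v w, F ((e.symm.toLinearMap ∘ₗ A) v) w = A v w := fun v w =>
    LinearMap.congr_fun (e.apply_symm_apply (A v)) w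
  have hinv : ∀ g v, ρ g (ρ g⁻¹ v) = v := by
    intro g v
    rw [← Module.End.mul_apply, ← map_mul, mul_inv_cancel, map_one]; rfl
  refine ⟨e.symm.toLinearMap ∘ₗ A, ht, ?_, ?_⟩
  · intro g
    ext v
    refine h.form_ext fun w => ?_
    rw [Module.End.mul_apply, Module.End.mul_apply, ht, ← hinv g w, h.skew_inv, h.inv, ht]
  · intro v w
    rw [ht, h.skew, ← ht, h.symm]

section

variable [hp : Fact p.Prime] {t : End ℚ V}

theorem exists_eq_smul_one (h : IsSymplecticRep p ρ F A) (hp3 : 3 < p) (hx : x ^ p = 1)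
    (hx1 : x ≠ 1) (htA : ∀ v w, F (t v) w = A v w) (ht : ∀ g, t * ρ g = ρ g * t)
    (hts : ∀ v w, F (t v) w = -F v (t w)) {φ : End ℚ V} (hφ : ∀ g, φ * ρ g = ρ g * φ)
    (hφs : ∀ v w, F (φ v) w = F v (φ w)) : ∃ a : ℚ, φ = a • 1 := by
  have := h.finiteDimensional
  have hcomm : φ * t - t * φ = 0 := by
    obtain ⟨v, hv, hv0⟩ := exists_mem_ker_cyclotomic (map_pow_eq_one (ρ := ρ) hx)
      (h.map_ne_one hx1)
    refine h.eq_zero_of_apply_eq_zero (fun g => ?_) hv0 ?_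
    · rw [sub_mul, mul_sub, mul_assoc, ht, ← mul_assoc, hφ, mul_assoc, mul_assoc t, hφ,
        ← mul_assoc t, ht, mul_assoc]
    · rw [LinearMap.sub_apply, Module.End.mul_apply, Module.End.mul_apply, sub_eq_zero]
      exact apply_comm_of_mem_ker_cyclotomic hp3 h.finrank_eq (hφ x) (ht x) hv
  have hE := finrank_ker_sub_one hp3 h.finrank_eq (map_pow_eq_one (ρ := ρ) hx) (h.map_ne_one hx1)
  have hmem : ∀ {ψ : End ℚ V}, (∀ g, ψ * ρ g = ρ g * ψ) →
      ∀ v ∈ LinearMap.ker (ρ x - 1), ψ v ∈ LinearMap.ker (ρ x - 1) := by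
    intro ψ hψ v hv
    rw [LinearMap.mem_ker, LinearMap.sub_apply, sub_eq_zero] at hv ⊢
    rw [← Module.End.mul_apply, ← hψ, Module.End.mul_apply, hv]
    rfl
  obtain ⟨v, hv, hv0⟩ := (LinearMap.ker (ρ x - 1)).ne_bot_iff.1 (by
    intro h0
    rw [h0, finrank_bot] at hE
    exact absurd hE (by norm_num))
  have htv0 : t v ≠ 0 := by
    intro h0
    exact hv0 (h.nondegenerate v fun w => by rw [← htA, h0, map_zero, LinearMap.zero_apply])
  have horth : F (t v) v = 0 := by
    have := hts v v
    rw [h.symm v] at this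
    linarith
  have hspan : φ v ∈ Submodule.span ℚ {v, t v} := by
    have hli : LinearIndependent ℚ ![v, t v] := by
      rw [LinearIndependent.pair_iff]
      intro a b hab
      have e1 := congrArg (F v) hab
      have e2 := congrArg (F (t v)) hab
      rw [map_add, map_smul, map_smul, map_zero, h.symm v (t v), horth, smul_zero, add_zero,
        smul_eq_mul] at e1
      rw [map_add, map_smul, map_smul, map_zero, horth, smul_zero, zero_add, smul_eq_mul] at e2
      exact ⟨(mul_eq_zero.1 e1).resolve_right (h.form_pos v hv0).ne',
        (mul_eq_zero.1 e2).resolve_right (h.form_pos _ htv0).ne'⟩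
    have hle : Submodule.span ℚ {v, t v} ≤ LinearMap.ker (ρ x - 1) := by
      rw [Submodule.span_le]
      rintro _ (rfl | rfl)
      · exact hv
      · exact hmem ht v hv
    have hfr := finrank_span_eq_card hli
    rw [Matrix.range_cons, Matrix.range_cons, Matrix.range_empty, Set.union_empty,
      Set.singleton_union, Fintype.card_fin] at hfr
    rw [Submodule.eq_of_le_of_finrank_eq hle (hfr.trans hE.symm)]
    exact hmem hφ v hv
  obtain ⟨a, b, hab⟩ := Submodule.mem_span_pair.1 hspan
  have h0 : F (φ v) (t v) = 0 := by
    have e1 : φ (t v) = t (φ v) := LinearMap.congr_fun (sub_eq_zero.1 hcomm) v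
    have e2 := hφs v (t v)
    rw [e1] at e2
    have e3 := hts v (φ v)
    have e4 := h.symm (φ v) (t v)
    linarith
  have hb : b = 0 := by
    rw [← hab, map_add, map_smul, map_smul, LinearMap.add_apply, LinearMap.smul_apply,
      LinearMap.smul_apply, h.symm v, horth, smul_zero, zero_add, smul_eq_mul] at h0
    exact (mul_eq_zero.1 h0).resolve_right (h.form_pos _ htv0).ne'
  refine ⟨a, sub_eq_zero.1 (h.eq_zero_of_apply_eq_zero (fun g => ?_) hv0 ?_)⟩
  · rw [sub_mul, mul_sub, hφ, smul_mul_assoc, mul_smul_comm, one_mul, mul_one]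
  · rw [LinearMap.sub_apply, LinearMap.smul_apply, Module.End.one_apply, ← hab, hb, zero_smul,
      add_zero, sub_self]

theorem exists_theta_sq (h : IsSymplecticRep p ρ F A) (hp3 : 3 < p) (hx : x ^ p = 1)
    (hx1 : x ≠ 1) (htA : ∀ v w, F (t v) w = A v w) (ht : ∀ g, t * ρ g = ρ g * t)
    (hts : ∀ v w, F (t v) w = -F v (t w)) : ∃ α : ℚ, α < 0 ∧ t * t = α • 1 := by
  obtain ⟨α, hα⟩ := h.exists_eq_smul_one hp3 hx hx1 htA ht hts (φ := t * t)
    (fun g => by rw [mul_assoc, ht, ← mul_assoc, ht, mul_assoc])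
    (fun v w => by rw [Module.End.mul_apply, Module.End.mul_apply, hts, hts, neg_neg])
  refine ⟨α, ?_, hα⟩
  obtain ⟨v, -, hv0⟩ := exists_mem_ker_cyclotomic (map_pow_eq_one (ρ := ρ) hx) (h.map_ne_one hx1)
  have htv0 : t v ≠ 0 := by
    intro h0
    exact hv0 (h.nondegenerate v fun w => by rw [← htA, h0, map_zero, LinearMap.zero_apply])
  have h1 := h.form_pos _ htv0
  rw [hts, ← Module.End.mul_apply, hα, LinearMap.smul_apply, Module.End.one_apply, map_smul,
    smul_eq_mul] at h1
  have h2 := h.form_pos v hv0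
  by_contra hα0
  nlinarith

theorem exists_cyclotomic_sq_eq {K : Type*} [Field K] [Algebra ℚ K] {ζ : K}
    (hζ : aeval ζ (cyclotomic p ℚ) = 0)
    (h : IsSymplecticRep p ρ F A) (hp3 : 3 < p) (hx : x ^ p = 1) (hx1 : x ≠ 1)
    (ht : ∀ g, t * ρ g = ρ g * t) {α : ℚ} (hα : t * t = α • 1) :
    ∃ a : K, a ^ 2 = algebraMap ℚ K α := by
  obtain ⟨v, hv, hv0⟩ := exists_mem_ker_cyclotomic (map_pow_eq_one (ρ := ρ) hx) (h.map_ne_one hx1)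
  obtain ⟨f, hf⟩ : t v ∈ LinearMap.range (aevalApply (ρ x) v) := by
    rw [range_aevalApply_eq_ker_cyclotomic hp3 h.finrank_eq hv hv0]
    exact apply_mem_ker_cyclotomic (ht x) hv
  rw [aevalApply_apply] at hf
  have h1 : aeval (ρ x) (f ^ 2 - C α) v = 0 := by
    rw [map_sub, LinearMap.sub_apply, pow_two, map_mul, Module.End.mul_apply, hf,
      ← apply_aeval_apply (ht x), hf, ← Module.End.mul_apply, hα, aeval_C]
    simp
  obtain ⟨c, hc⟩ := dvd_of_aeval_apply_eq_zero (cyclotomic.irreducible_rat hp.out.pos) hv hv0 h1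
  refine ⟨aeval ζ f, ?_⟩
  have h2 := congrArg (aeval ζ) hc
  rw [map_mul, hζ, zero_mul, map_sub, map_pow, aeval_C, sub_eq_zero] at h2
  exact h2

end

end IsSymplecticRep

end SymplecticRep

section SymplecticRep

open Module Polynomial

namespace IsSymplecticRep

variable {G V : Type*} [Group G] [AddCommGroup V] [Module ℚ V] {p : ℕ}
  {ρ : Representation ℚ G V} {F A : V →ₗ[ℚ] V →ₗ[ℚ] ℚ} {x y : G} [hp : Fact p.Prime]

theorem pow_prime_eq_one_of_pow_sq (h : IsSymplecticRep p ρ F A) (hp3 : 3 < p)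
    (hy : y ^ p ^ 2 = 1) : y ^ p = 1 := by
  have := h.finiteDimensional
  by_contra hy1
  have hyp : (y ^ p) ^ p = 1 := by rw [← pow_mul, ← pow_two, hy]
  obtain ⟨v, hv, hv0⟩ := exists_mem_ker_cyclotomic (map_pow_eq_one (ρ := ρ) hyp)
    (h.map_ne_one hy1)
  have hv' : aeval (ρ y) (cyclotomic (p * p) ℚ) v = 0 := by
    rw [← cyclotomic_expand_eq_cyclotomic hp.out dvd_rfl, expand_aeval, ← map_pow]
    exact hv
  have hpos : 0 < p * p := Nat.mul_pos hp.out.pos hp.out.pos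
  have h1 := finrank_range_aevalApply (cyclotomic.irreducible_rat hpos) (cyclotomic.monic _ _)
    hv' hv0
  have h2 := Submodule.finrank_le (LinearMap.range (aevalApply (ρ y) v))
  rw [h1, h.finrank_eq, natDegree_cyclotomic, ← pow_two, Nat.totient_prime_pow hp.out two_pos,
    show 2 - 1 = 1 from rfl, pow_one] at h2
  have h3 : p * 3 ≤ p * (p - 1) := Nat.mul_le_mul_left _ (by omega)
  omega

theorem mem_zpowers_of_commute (h : IsSymplecticRep p ρ F A) (hp3 : 3 < p) (hx : x ^ p = 1)
    (hx1 : x ≠ 1) (hy : y ^ p = 1) (hxy : Commute x y) : y ∈ Subgroup.zpowers x := by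
  have := h.finiteDimensional
  have : NeZero p := ⟨hp.out.ne_zero⟩
  obtain ⟨v, hv, hv0⟩ := exists_mem_ker_cyclotomic (map_pow_eq_one (ρ := ρ) hx) (h.map_ne_one hx1)
  have hyx : Commute (ρ y) (ρ x) := by
    change ρ y * ρ x = ρ x * ρ y
    rw [← map_mul, ← map_mul, hxy.eq]
  have hirr := cyclotomic.irreducible_rat hp.out.pos
  have hrange := range_aevalApply_eq_ker_cyclotomic hp3 h.finrank_eq hv hv0
  obtain ⟨f, hf⟩ : ρ y v ∈ LinearMap.range (aevalApply (ρ x) v) := by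
    rw [hrange]
    exact apply_mem_ker_cyclotomic hyx hv
  rw [aevalApply_apply] at hf
  have hfp : ∀ i : ℕ, aeval (ρ x) (f ^ i) v = (ρ y ^ i) v := by
    intro i
    induction i with
    | zero => simp
    | succ i ih =>
      rw [pow_succ, map_mul, Module.End.mul_apply, hf, ← apply_aeval_apply hyx, ih, pow_succ',
        Module.End.mul_apply]
  obtain ⟨K, _, _, ζ, hζ⟩ : ∃ (K : Type) (_ : Field K) (_ : CharZero K) (ζ : K),
      IsPrimitiveRoot ζ p :=
    ⟨ℂ, inferInstance, inferInstance, _, Complex.isPrimitiveRoot_exp p hp.out.ne_zero⟩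
  have hdvd : ∀ {g : ℚ[X]}, cyclotomic p ℚ ∣ g ↔ aeval ζ g = 0 := by
    intro g
    rw [cyclotomic_eq_minpoly_rat hζ hp.out.pos, minpoly.dvd_iff]
  have h1 : aeval ζ f ^ p = 1 := by
    have h2 := hdvd.1 (dvd_of_aeval_apply_eq_zero hirr hv hv0 (f := f ^ p - 1) (by
      rw [map_sub, LinearMap.sub_apply, hfp, ← map_pow, hy]
      simp))
    rwa [map_sub, map_pow, map_one, sub_eq_zero] at h2
  obtain ⟨i, -, hi⟩ := hζ.eq_pow_of_pow_eq_one h1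
  obtain ⟨c, hc⟩ := hdvd.2 (show aeval ζ (f - X ^ i) = 0 by
    rw [map_sub, map_pow, aeval_X, hi, sub_self])
  have hyv : ρ y v = (ρ x ^ i) v := by
    have h2 := congrArg (fun Q => aeval (ρ x) Q v) hc
    simp only [map_sub, LinearMap.sub_apply, hf, map_pow, aeval_X] at h2
    rw [mul_comm, map_mul, Module.End.mul_apply, hv, map_zero, sub_eq_zero] at h2
    exact h2
  have hz : (x⁻¹ ^ i * y) = 1 := by
    by_contra hz1
    have hzp : (x⁻¹ ^ i * y) ^ p = 1 := by
      rw [((hxy.inv_left).pow_left i).mul_pow, hy, mul_one, ← pow_mul, mul_comm, pow_mul, inv_pow,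
        hx, inv_one, one_pow]
    have hzv : ρ (x⁻¹ ^ i * y) v = v := by
      rw [map_mul, Module.End.mul_apply, hyv, ← map_pow, ← Module.End.mul_apply, ← map_mul, inv_pow,
        inv_mul_cancel, map_one]
      rfl
    have hzx : Commute (ρ (x⁻¹ ^ i * y)) (ρ x) := by
      change _ * _ = _ * _
      rw [← map_mul, ← map_mul]
      exact congrArg ρ ((((Commute.refl x).inv_left).pow_left i).mul_left hxy.symm).eq
    have hle : LinearMap.ker (aeval (ρ x) (cyclotomic p ℚ)) ≤
        LinearMap.ker (ρ (x⁻¹ ^ i * y) - 1) := by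
      rw [← hrange]
      rintro _ ⟨g, rfl⟩
      rw [LinearMap.mem_ker, LinearMap.sub_apply, sub_eq_zero, aevalApply_apply,
        apply_aeval_apply hzx, hzv]
      rfl
    have h3 := Submodule.finrank_mono hle
    rw [finrank_ker_cyclotomic hp3 h.finrank_eq (map_pow_eq_one (ρ := ρ) hx) (h.map_ne_one hx1),
      finrank_ker_sub_one hp3 h.finrank_eq (map_pow_eq_one (ρ := ρ) hzp) (h.map_ne_one hz1)] at h3
    omega
  rw [inv_pow, inv_mul_eq_one] at hz
  exact ⟨i, by rw [← hz]; exact zpow_natCast x i⟩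

theorem not_sq_dvd_card [Finite G] (h : IsSymplecticRep p ρ F A) (hp3 : 3 < p) :
    ¬ p ^ 2 ∣ Nat.card G := by
  intro hdvd
  obtain ⟨Q, hQ⟩ := Sylow.exists_subgroup_card_pow_prime p hdvd
  have hcomm := (IsPGroup.isMulCommutative_of_card_eq_prime_sq hQ).is_comm.comm
  have hpow : ∀ y ∈ Q, y ^ p = 1 := fun y hy => h.pow_prime_eq_one_of_pow_sq hp3 (by
    have h1 := pow_card_eq_one' (x := (⟨y, hy⟩ : Q))
    rw [hQ] at h1
    exact congrArg Subtype.val h1)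
  have hQ1 : Q ≠ ⊥ := by
    rintro rfl
    rw [Subgroup.card_bot] at hQ
    exact absurd hQ.symm (Nat.one_lt_pow two_ne_zero hp.out.one_lt).ne'
  obtain ⟨x, hx, hx1⟩ := Q.bot_or_exists_ne_one.resolve_left hQ1
  have hle : Q ≤ Subgroup.zpowers x := fun y hy =>
    h.mem_zpowers_of_commute hp3 (hpow x hx) hx1 (hpow y hy)
      (congrArg Subtype.val (hcomm ⟨x, hx⟩ ⟨y, hy⟩))
  have h1 := Nat.le_of_dvd Nat.card_pos (Subgroup.card_dvd_of_le hle)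
  rw [hQ, Nat.card_zpowers, orderOf_eq_prime (hpow x hx) hx1] at h1
  nlinarith [hp.out.one_lt]

/-- The symplectic form gives rise to a square root of `-p` in the commutant. -/
theorem exists_isThetaRep [Finite G] (h : IsSymplecticRep p ρ F A) (hp3 : 3 < p) (hx : x ^ p = 1)
    (hx1 : x ≠ 1) : p % 4 = 3 ∧ ∃ θ, IsThetaRep p ρ θ F := by
  have : NeZero p := ⟨hp.out.ne_zero⟩
  have : NeZero (p : ℚ) := ⟨by exact_mod_cast hp.out.ne_zero⟩
  obtain ⟨t, htA, ht, hts⟩ := h.exists_theta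
  obtain ⟨α, hα0, hα⟩ := h.exists_theta_sq hp3 hx hx1 htA ht hts
  obtain ⟨K, _, _, _⟩ : ∃ (K : Type) (_ : Field K) (_ : Algebra ℚ K),
      IsCyclotomicExtension {p} ℚ K :=
    ⟨_, _, _, CyclotomicField.isCyclotomicExtension p ℚ⟩
  have : CharZero K := algebraRat.charZero K
  have hζ : aeval (IsCyclotomicExtension.zeta p ℚ K) (cyclotomic p ℚ) = 0 := by
    rw [aeval_def, eval₂_eq_eval_map, map_cyclotomic]
    exact (IsCyclotomicExtension.zeta_spec p ℚ K).isRoot_cyclotomic hp.out.pos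
  obtain ⟨a, ha⟩ := h.exists_cyclotomic_sq_eq hζ hp3 hx hx1 ht hα
  obtain ⟨hp4, r, hr⟩ := exists_rat_sq_eq_of_sq_eq_cyclotomic (p := p) (by omega) hα0 ha
  refine ⟨hp4, (r / α) • t, h.finrank_eq, h.injective, ?_, ?_, h.symm, h.form_pos, h.inv, ?_, ?_,
    h.not_sq_dvd_card hp3, ?_⟩
  · rw [smul_mul_smul_comm, hα, smul_smul, ← neg_smul]
    congr 1
    have := hα0.ne
    field_simp
    exact hr
  · intro g
    rw [smul_mul_assoc, ht, mul_smul_comm]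
  · intro v w
    rw [LinearMap.smul_apply, LinearMap.smul_apply, map_smul, map_smul, LinearMap.smul_apply, hts,
      smul_neg]
  · intro φ hφ hφs
    exact h.exists_eq_smul_one hp3 hx hx1 htA ht hts hφ hφs
  · intro y hy hy1
    exact finrank_ker_sub_one hp3 h.finrank_eq (map_pow_eq_one (ρ := ρ) hy) (h.map_ne_one hy1)

end IsSymplecticRep

end SymplecticRep

section MatrixGroup

variable {m : ℕ} (G : Subgroup (GL (Fin m) ℚ))

/-- The representation of a matrix group `G` on row vectors, `g` acting as `v ↦ v * g⁻¹`. -/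
def rowRep : Representation ℚ G (Fin m → ℚ) where
  toFun g := Matrix.vecMulLinear (((g⁻¹ : G) : GL (Fin m) ℚ) : Matrix (Fin m) (Fin m) ℚ)
  map_one' := by
    ext v
    simp
  map_mul' g h := by
    refine LinearMap.ext fun v => ?_
    simp [Matrix.vecMul_vecMul, -Matrix.coe_units_inv]

theorem rowRep_apply (g : G) (v : Fin m → ℚ) :
    rowRep G g v = v ᵥ* (((g⁻¹ : G) : GL (Fin m) ℚ) : Matrix (Fin m) (Fin m) ℚ) := rfl

theorem rowRep_inv_apply (g : G) (v : Fin m → ℚ) :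
    rowRep G g⁻¹ v = v ᵥ* ((g : GL (Fin m) ℚ) : Matrix (Fin m) (Fin m) ℚ) := by
  rw [rowRep_apply, inv_inv]

theorem rowRep_injective : Function.Injective (rowRep G) := by
  intro g h hgh
  rw [← _root_.inv_inj]
  refine Subtype.ext (Units.ext (Matrix.ext_of_single_vecMul fun i => ?_))
  exact LinearMap.congr_fun hgh (Pi.single i 1)

/-- The average of the standard scalar product over a finite matrix group. -/
noncomputable def rowForm [Fintype G] : (Fin m → ℚ) →ₗ[ℚ] (Fin m → ℚ) →ₗ[ℚ] ℚ :=
  ∑ g : G, (dotProductBilin ℚ ℚ).compl₁₂ (rowRep G g) (rowRep G g)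

theorem rowForm_apply [Fintype G] (v w : Fin m → ℚ) :
    rowForm G v w = ∑ g : G, rowRep G g v ⬝ᵥ rowRep G g w := by
  simp [rowForm, LinearMap.sum_apply]

variable {G}

theorem exists_isSymplecticRep [Finite G] (hs : IsSymplecticGroup G) (hi : IsRatIrreducible G)
    {p : ℕ} (hm : m = p + 1) : ∃ F A, IsSymplecticRep p (rowRep G) F A := by
  have := Fintype.ofFinite G
  obtain ⟨A, hA, hu, hg⟩ := hs
  refine ⟨rowForm G, Matrix.toLinearMap₂' ℚ A, ?_⟩
  have hA' : ∀ v w, Matrix.toLinearMap₂' ℚ A v w = (v ᵥ* A) ⬝ᵥ w := fun v w => by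
    rw [Matrix.toLinearMap₂'_apply', Matrix.dotProduct_mulVec]
  refine ⟨by simp [hm], rowRep_injective G, ?_, ?_, ?_, ?_, ?_, ?_, ?_⟩
  · intro W hW
    refine hi W fun g hgG v hv => ?_
    rw [← rowRep_inv_apply G ⟨g, hgG⟩]
    exact hW _ v hv
  · intro v w
    simp only [rowForm_apply]
    exact Finset.sum_congr rfl fun g _ => dotProduct_comm _ _
  · intro v hv
    rw [rowForm_apply]
    refine Finset.sum_pos (fun g _ => ?_) Finset.univ_nonempty
    refine lt_of_le_of_ne (Finset.sum_nonneg fun i _ => mul_self_nonneg _) (Ne.symm ?_)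
    rw [Ne, dotProduct_self_eq_zero]
    intro h0
    apply hv
    have := congrArg (rowRep G g⁻¹) h0
    rwa [← Module.End.mul_apply, ← map_mul, inv_mul_cancel, map_one, map_zero] at this
  · intro h v w
    simp only [rowForm_apply, ← Module.End.mul_apply, ← map_mul]
    exact Equiv.sum_comp (Equiv.mulRight h) fun g => rowRep G g v ⬝ᵥ rowRep G g w
  · intro v w
    rw [hA', hA', ← Matrix.dotProduct_mulVec, dotProduct_comm, ← Matrix.vecMul_transpose, hA,
      Matrix.vecMul_neg, neg_dotProduct]
  · intro v hv
    have h0 : v ᵥ* A = 0 := dotProduct_eq_zero _ fun w => by rw [← hA', hv]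
    obtain ⟨B, rfl⟩ := hu
    have := congrArg (fun u => u ᵥ* (↑B⁻¹ : Matrix (Fin m) (Fin m) ℚ)) h0
    simpa only [Matrix.vecMul_vecMul, Units.mul_inv, Matrix.vecMul_one, Matrix.zero_vecMul]
      using this
  · intro g v w
    rw [hA', hA', rowRep_apply, rowRep_apply, ← Matrix.mulVec_transpose _ w,
      Matrix.dotProduct_mulVec, Matrix.vecMul_vecMul, Matrix.vecMul_vecMul, ← mul_assoc, hg _ (g⁻¹).2]

end MatrixGroup

/-- An s.i.m.f. subgroup of `GL_{p+1}(ℚ)` (`p ≥ 11` prime) of order divisible by `p`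
exists only for `p ≡ 3 (mod 4)`, and is then isomorphic to `SL(2,p)`. -/
theorem simf_dim_p_add_one {p : ℕ} (hp : p.Prime) (hp11 : 11 ≤ p)
    (G : Subgroup (GL (Fin (p + 1)) ℚ))
    (hG : IsSIMF G) (hdvd : p ∣ Nat.card G) :
    p % 4 = 3 ∧ Nonempty (G ≃* Matrix.SpecialLinearGroup (Fin 2) (ZMod p)) := by
  have : Fact p.Prime := ⟨hp⟩
  obtain ⟨hfin, hs, hi, -⟩ := hG
  have : Finite G := hfin
  obtain ⟨F, A, h⟩ := exists_isSymplecticRep hs hi rfl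
  obtain ⟨x, hx⟩ := exists_prime_orderOf_dvd_card' p hdvd
  have hxp : x ^ p = 1 := orderOf_dvd_iff_pow_eq_one.1 hx.dvd
  have hx1 : x ≠ 1 := by
    rintro rfl
    exact hp.one_lt.ne (orderOf_one.symm.trans hx)
  obtain ⟨hp4, θ, hθ⟩ := h.exists_isThetaRep (by omega) hxp hx1
  exact ⟨hp4, hθ.nonempty_mulEquiv hp11 hp4 hxp hx1⟩
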